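/- Fix an integer t ≥ 2 and let n ≥ 2263 (so that p_n ≥ 20000). Then Ψ_t(N_n)/N_n ≤ (exp(γ + 2/p_n)/ζ(t)) · (log log N_n + 1.1253/log p_n). -/

import Mathlib

open Finset Filter

/-- Generalized Dedekind psi function `Ψ_t(n) = n ∏_{p ∣ n} (1 + 1/p + ⋯ + 1/p^(t-1))`. -/
noncomputable def Psi (t n : ℕ) : ℝ :=
  (n : ℝ) * ∏ p ∈ n.primeFactors, ∑ i ∈ Finset.range t, (1 : ℝ) / (p : ℝ) ^ i

/-- The primorial `N_n = ∏_{k=1}^n p_k`, the product of the first `n` primes. -/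
noncomputable def primorialAt (n : ℕ) : ℕ := ∏ k ∈ Finset.range n, Nat.nth Nat.Prime k

/-- The `n`-th prime `p_n` (so `nthPrime 1 = 2`). -/
noncomputable def nthPrime (n : ℕ) : ℕ := Nat.nth Nat.Prime (n - 1)

/-- The ratio `R_t(x) = Ψ_t(x) / (x log log x)`. -/
noncomputable def Rt (t n : ℕ) : ℝ := Psi t n / ((n : ℝ) * Real.log (Real.log n))

/-- The Riemann zeta value `ζ(t) = ∑_{n ≥ 1} n^{-t}` at an integer argument. -/
noncomputable def zetaNat (t : ℕ) : ℝ := ∑' k : ℕ, 1 / ((k : ℝ) + 1) ^ t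

/-- Divide an entire function by the full power of `z - ρ` that it contains. -/
lemma exists_eq_pow_analyticOrderNatAt_mul {f : ℂ → ℂ} (hf : Differentiable ℂ f) {ρ : ℂ}
    (hfin : analyticOrderAt f ρ ≠ ⊤) :
    ∃ g : ℂ → ℂ, Differentiable ℂ g ∧ (∀ z, f z = (z - ρ) ^ analyticOrderNatAt f ρ * g z) ∧
      g ρ ≠ 0 := by
  obtain ⟨g₀, hg₀, hg₀ne, hfg⟩ :=
    ((hf.analyticAt ρ).analyticOrderNatAt_eq_iff hfin (n := analyticOrderNatAt f ρ)).1 rfl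
  simp only [smul_eq_mul] at hfg
  set n := analyticOrderNatAt f ρ
  set g : ℂ → ℂ := Function.update (fun z => f z / (z - ρ) ^ n) ρ (g₀ ρ) with hg
  have hne : ∀ z, z ≠ ρ → g z = f z / (z - ρ) ^ n := fun z hz => by simp [hg, hz]
  have heq : g =ᶠ[nhds ρ] g₀ := by
    filter_upwards [hfg] with z hz
    by_cases h : z = ρ
    · simp [hg, h]
    · rw [hne z h, hz, mul_div_cancel_left₀ _ (pow_ne_zero _ (sub_ne_zero.2 h))]
  refine ⟨g, fun z => ?_, fun z => ?_, by simpa [hg] using hg₀ne⟩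
  · by_cases h : z = ρ
    · subst h; exact (hg₀.congr heq.symm).differentiableAt
    · have : (fun z => f z / (z - ρ) ^ n) =ᶠ[nhds z] g := by
        filter_upwards [isOpen_ne.mem_nhds h] with w hw using (hne w hw).symm
      refine this.differentiableAt_iff.1 (DifferentiableAt.div (hf z) (by fun_prop) ?_)
      exact pow_ne_zero _ (sub_ne_zero.2 h)
  · by_cases h : z = ρ
    · subst h
      rw [hfg.self_of_nhds]; simp [hg]
    · rw [hne z h, mul_div_cancel₀ _ (pow_ne_zero _ (sub_ne_zero.2 h))]

/-- Divide an entire function by all its zeros in a finite set. -/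
lemma exists_eq_prod_analyticOrderNatAt_mul {f : ℂ → ℂ} (hf : Differentiable ℂ f)
    (hfin : ∀ z, analyticOrderAt f z ≠ ⊤) (S : Finset ℂ) :
    ∃ g : ℂ → ℂ, Differentiable ℂ g ∧
      (∀ z, f z = (∏ ρ ∈ S, (z - ρ) ^ analyticOrderNatAt f ρ) * g z) ∧ ∀ ρ ∈ S, g ρ ≠ 0 := by
  classical
  induction S using Finset.induction_on with
  | empty => exact ⟨f, hf, by simp, by simp⟩
  | insert ρ S hρ ih =>
    obtain ⟨g, hg, hfg, hgS⟩ := ih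
    have hP : Differentiable ℂ (fun z => ∏ ρ ∈ S, (z - ρ) ^ analyticOrderNatAt f ρ) := by
      fun_prop
    have hPρ : (∏ a ∈ S, (ρ - a) ^ analyticOrderNatAt f a) ≠ 0 :=
      Finset.prod_ne_zero_iff.2 fun a ha =>
        pow_ne_zero _ (sub_ne_zero.2 fun h => hρ (h ▸ ha))
    have hmul : f = (fun z => ∏ ρ ∈ S, (z - ρ) ^ analyticOrderNatAt f ρ) * g := funext hfg
    have hord : analyticOrderAt f ρ = analyticOrderAt g ρ := by
      have := analyticOrderAt_mul (hP.analyticAt ρ) (hg.analyticAt ρ)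
      rwa [← hmul, (hP.analyticAt ρ).analyticOrderAt_eq_zero.2 hPρ, zero_add] at this
    obtain ⟨k, hk, hgk, hkρ⟩ := exists_eq_pow_analyticOrderNatAt_mul hg (hord ▸ hfin ρ)
    have hord' : analyticOrderNatAt g ρ = analyticOrderNatAt f ρ := by
      simp [analyticOrderNatAt, hord]
    refine ⟨k, hk, fun z => ?_, fun a ha => ?_⟩
    · rw [Finset.prod_insert hρ, hfg z, hgk z, hord']; ring
    · rcases Finset.mem_insert.1 ha with rfl | ha
      · exact hkρ
      · intro h; exact hgS a ha (by rw [hgk a, h, mul_zero])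

/-- A zero-free entire quotient with a growth bound has slowly varying logarithmic derivative. -/
lemma norm_logDeriv_sub_le {g : ℂ → ℂ} (hg : Differentiable ℂ g) {R M : ℝ} (hR : 0 < R)
    (hM : 0 < M) (hne : ∀ z ∈ Metric.ball (0 : ℂ) R, g z ≠ 0)
    (hbd : ∀ z ∈ Metric.ball (0 : ℂ) R, ‖g z‖ ≤ Real.exp M * ‖g 0‖) {s s₀ : ℂ}
    (hs : s ∈ Metric.ball (0 : ℂ) (R / 8)) (hs₀ : s₀ ∈ Metric.ball (0 : ℂ) (R / 8)) :
    ‖logDeriv g s - logDeriv g s₀‖ ≤ 64 * M / R ^ 2 * ‖s - s₀‖ := by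
  have h0 : (0 : ℂ) ∈ Metric.ball (0 : ℂ) R := Metric.mem_ball_self hR
  have hld : DifferentiableOn ℂ (logDeriv g) (Metric.ball 0 R) := by
    intro z hz
    exact (DifferentiableAt.div (hg.analyticAt z).deriv.differentiableAt (hg z)
      (hne z hz)).differentiableWithinAt
  obtain ⟨h, hh0, hh⟩ := (hld.isExactOn_ball).with_val_at 0 0
  have hhd : DifferentiableOn ℂ h (Metric.ball 0 R) :=
    fun z hz => (hh z hz).differentiableAt.differentiableWithinAt
  have hexp : ∀ z ∈ Metric.ball (0 : ℂ) R, g z = g 0 * Complex.exp (h z) := by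
    intro z hz
    have hder : ∀ w ∈ Metric.ball (0 : ℂ) R,
        HasDerivAt (fun w => g w * Complex.exp (-h w)) 0 w := by
      intro w hw
      have h1 := (hg w).hasDerivAt.mul (hh w hw).neg.cexp
      refine HasDerivAt.congr_deriv (f := fun w => g w * Complex.exp (-h w)) h1 ?_
      have h2 := hne w hw
      rw [logDeriv_apply]
      simp only [Pi.neg_apply]
      field_simp
      ring
    have hconst := (convex_ball (0 : ℂ) R).is_const_of_fderivWithin_eq_zero (𝕜 := ℂ)
      (f := fun w => g w * Complex.exp (-h w))
      (fun w hw => (hder w hw).differentiableAt.differentiableWithinAt)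
      (fun w hw => by
        rw [fderivWithin_of_isOpen Metric.isOpen_ball hw]
        ext; simp [(hder w hw).deriv]) hz h0
    simp only [hh0, neg_zero, Complex.exp_zero, mul_one] at hconst
    rw [← hconst, mul_assoc, ← Complex.exp_add]; simp
  have hre : Set.MapsTo h (Metric.ball 0 R) {z | z.re ≤ M} := by
    intro z hz
    have h1 := hbd z hz
    rw [hexp z hz, norm_mul, Complex.norm_exp, mul_comm] at h1
    have h2 := le_of_mul_le_mul_right h1 (norm_pos_iff.2 (hne 0 h0))
    exact Real.exp_le_exp.1 h2
  have hbound : ∀ z ∈ Metric.closedBall (0 : ℂ) (R / 2), ‖h z‖ ≤ 2 * M := by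
    intro z hz
    have hz' : ‖z‖ ≤ R / 2 := by simpa using hz
    have hzR : z ∈ Metric.ball (0 : ℂ) R := by simp; linarith
    have h1 := Complex.borelCaratheodory_zero hM hhd hre hR hzR hh0
    refine h1.trans ?_
    rw [div_le_iff₀ (by linarith)]
    nlinarith
  have hderiv : ∀ z ∈ Metric.closedBall (0 : ℂ) (R / 4), ‖logDeriv g z‖ ≤ 8 * M / R := by
    intro z hz
    have hz' : ‖z‖ ≤ R / 4 := by simpa using hz
    have hsub : ∀ w ∈ Metric.closedBall z (R / 4), w ∈ Metric.closedBall (0 : ℂ) (R / 2) := by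
      intro w hw
      have : ‖w - z‖ ≤ R / 4 := by simpa [dist_eq_norm] using hw
      have h2 := norm_add_le (w - z) z
      simp only [sub_add_cancel] at h2
      simp; linarith
    have hsubR : Metric.closedBall z (R / 4) ⊆ Metric.ball (0 : ℂ) R := by
      intro w hw
      have := hsub w hw
      simp only [Metric.mem_closedBall, dist_zero_right, Metric.mem_ball] at this ⊢
      linarith
    have hzR : z ∈ Metric.ball (0 : ℂ) R := hsubR (Metric.mem_closedBall_self (by positivity))
    have := Complex.norm_deriv_le_of_forall_mem_sphere_norm_le (c := z) (R := R / 4) (C := 2 * M)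
      (f := h) (by positivity) ((hhd.mono hsubR).diffContOnCl_ball subset_rfl)
      (fun w hw => hbound w (hsub w (Metric.sphere_subset_closedBall hw)))
    rw [(hh z hzR).deriv] at this
    convert this using 1; field_simp; ring
  have hderiv2 : ∀ z ∈ Metric.ball (0 : ℂ) (R / 8), ‖deriv (logDeriv g) z‖ ≤ 64 * M / R ^ 2 := by
    intro z hz
    have hz' : ‖z‖ < R / 8 := by simpa using hz
    have hsub : ∀ w ∈ Metric.closedBall z (R / 8), w ∈ Metric.closedBall (0 : ℂ) (R / 4) := by
      intro w hw
      have : ‖w - z‖ ≤ R / 8 := by simpa [dist_eq_norm] using hw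
      have h2 := norm_add_le (w - z) z
      simp only [sub_add_cancel] at h2
      simp; linarith
    have hsubR : Metric.closedBall z (R / 8) ⊆ Metric.ball (0 : ℂ) R := by
      intro w hw
      have := hsub w hw
      simp only [Metric.mem_closedBall, dist_zero_right, Metric.mem_ball] at this ⊢
      linarith
    have := Complex.norm_deriv_le_of_forall_mem_sphere_norm_le (c := z) (R := R / 8)
      (C := 8 * M / R) (f := logDeriv g) (by positivity)
      ((hld.mono hsubR).diffContOnCl_ball subset_rfl)
      (fun w hw => hderiv w (hsub w (Metric.sphere_subset_closedBall hw)))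
    convert this using 1; field_simp; ring
  refine (convex_ball (0 : ℂ) (R / 8)).norm_image_sub_le_of_norm_deriv_le (𝕜 := ℂ)
    (fun z hz => ?_) hderiv2 hs₀ hs
  refine hld.differentiableAt (Metric.isOpen_ball.mem_nhds ?_)
  simp only [Metric.mem_ball, dist_zero_right] at hz ⊢
  linarith

/-- The partial fraction expansion of the logarithmic derivative of an entire function of growth
`exp (o(R²))`, in differenced form. -/
theorem tendsto_sum_zeros_logDeriv {f : ℂ → ℂ} (hf : Differentiable ℂ f) (h0 : f 0 = 1)
    (S : ℝ → Finset ℂ) (hS : ∀ R z, z ∈ S R ↔ ‖z‖ ≤ R ∧ f z = 0)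
    (M : ℝ → ℝ) (hM : ∀ R z, 0 < R → ‖z‖ ≤ R → ‖f z‖ ≤ Real.exp (M R))
    (hMpos : ∀ R, 0 < R → 0 < M R) (hMo : Tendsto (fun R => M R / R ^ 2) atTop (nhds 0))
    {s s₀ : ℂ} (hs : f s ≠ 0) (hs₀ : f s₀ ≠ 0) :
    Tendsto (fun R => ∑ ρ ∈ S R, (analyticOrderNatAt f ρ : ℂ) * (1 / (s - ρ) - 1 / (s₀ - ρ)))
      atTop (nhds (logDeriv f s - logDeriv f s₀)) := by
  have hfin : ∀ z, analyticOrderAt f z ≠ ⊤ := by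
    intro z hz
    have h1 := (AnalyticOnNhd.eqOn_zero_of_preconnected_of_eventuallyEq_zero
      (f := f) (U := Set.univ) (fun w _ => hf.analyticAt w) isPreconnected_univ (Set.mem_univ z)
      (analyticOrderAt_eq_top.1 hz)) (Set.mem_univ 0)
    simp [h0] at h1
  rw [tendsto_iff_norm_sub_tendsto_zero]
  have hlim : Tendsto (fun R : ℝ => 576 * (M (3 * R) / (3 * R) ^ 2) * ‖s - s₀‖) atTop (nhds 0) := by
    have := ((hMo.comp (tendsto_id.const_mul_atTop (by norm_num : (0:ℝ) < 3))).const_mul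
      576).mul_const ‖s - s₀‖
    simpa using this
  refine squeeze_zero' (Eventually.of_forall fun R => norm_nonneg _) ?_ hlim
  filter_upwards [eventually_gt_atTop (8 * ‖s‖), eventually_gt_atTop (8 * ‖s₀‖),
    eventually_gt_atTop 0] with R hR1 hR2 hR
  obtain ⟨g, hg, hfg, hgS⟩ := exists_eq_prod_analyticOrderNatAt_mul hf hfin (S R)
  have hne : ∀ z ∈ Metric.ball (0 : ℂ) R, g z ≠ 0 := by
    intro z hz h
    have hfz : f z = 0 := by rw [hfg, h, mul_zero]
    exact hgS z ((hS R z).2 ⟨by simpa using (Metric.mem_ball.1 hz).le, hfz⟩) h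
  have hP : ∀ z, 3 * R = ‖z‖ → ‖∏ ρ ∈ S R, (0 - ρ) ^ analyticOrderNatAt f ρ‖ ≤
      ‖∏ ρ ∈ S R, (z - ρ) ^ analyticOrderNatAt f ρ‖ := by
    intro z hz
    rw [norm_prod, norm_prod]
    refine Finset.prod_le_prod (fun _ _ => norm_nonneg _) fun ρ hρ => ?_
    rw [norm_pow, norm_pow]
    have h1 : ‖ρ‖ ≤ R := ((hS R ρ).1 hρ).1
    have h2 := norm_sub_norm_le z ρ
    refine pow_le_pow_left₀ (norm_nonneg _) ?_ _
    rw [zero_sub, norm_neg]; linarith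
  have hsph : ∀ z ∈ Metric.sphere (0 : ℂ) (3 * R), ‖g z‖ ≤ Real.exp (M (3 * R)) * ‖g 0‖ := by
    intro z hz
    have hz' : ‖z‖ = 3 * R := by simpa using hz
    have h1 := hM (3 * R) z (by positivity) hz'.le
    have h2 := congrArg norm (hfg 0)
    rw [h0, norm_one, norm_mul] at h2
    rw [hfg z, norm_mul] at h1
    have h3 := hP z hz'.symm
    have h4 : 0 < ‖∏ ρ ∈ S R, (0 - ρ) ^ analyticOrderNatAt f ρ‖ := by
      by_contra h
      have : ‖∏ ρ ∈ S R, (0 - ρ) ^ analyticOrderNatAt f ρ‖ = 0 := le_antisymm (not_lt.1 h) (norm_nonneg _)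
      rw [this, zero_mul] at h2; norm_num at h2
    refine le_of_mul_le_mul_left ?_ h4
    calc _ ≤ ‖∏ ρ ∈ S R, (z - ρ) ^ analyticOrderNatAt f ρ‖ * ‖g z‖ := by gcongr
      _ ≤ Real.exp (M (3 * R)) := h1
      _ = _ := by rw [mul_left_comm, ← h2, mul_one]
  have hbd : ∀ z ∈ Metric.ball (0 : ℂ) R, ‖g z‖ ≤ Real.exp (M (3 * R)) * ‖g 0‖ := by
    intro z hz
    refine Complex.norm_le_of_forall_mem_frontier_norm_le (U := Metric.ball (0 : ℂ) (3 * R))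
      Metric.isBounded_ball hg.diffContOnCl (fun w hw => hsph w ?_) (subset_closure ?_)
    · rwa [frontier_ball _ (by positivity)] at hw
    · exact Metric.ball_subset_ball (by linarith) hz
  have hmain := norm_logDeriv_sub_le hg hR (hMpos (3 * R) (by positivity)) hne hbd
    (s := s) (s₀ := s₀) (by simp; linarith) (by simp; linarith)
  have hld : ∀ w, f w ≠ 0 → logDeriv f w =
      (∑ ρ ∈ S R, (analyticOrderNatAt f ρ : ℂ) * (1 / (w - ρ))) + logDeriv g w := by
    intro w hw
    have hfeq : f = fun z => (∏ ρ ∈ S R, (z - ρ) ^ analyticOrderNatAt f ρ) * g z := funext hfg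
    have hw' := hw
    rw [hfg w] at hw'
    obtain ⟨hw1, hw2⟩ := mul_ne_zero_iff.1 hw'
    have hdiff : ∀ ρ ∈ S R, DifferentiableAt ℂ (fun z => (z - ρ) ^ analyticOrderNatAt f ρ) w := by
      intro ρ _; fun_prop
    conv_lhs => rw [hfeq]
    rw [logDeriv_mul w hw1 hw2 (by fun_prop) (hg w),
      logDeriv_prod (fun ρ hρ => Finset.prod_ne_zero_iff.1 hw1 ρ hρ) hdiff]
    congr 1
    refine Finset.sum_congr rfl fun ρ hρ => ?_
    have := logDeriv_fun_pow (f := fun z : ℂ => z - ρ) (x := w) (by fun_prop)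
      (analyticOrderNatAt f ρ)
    rw [this, logDeriv_apply]
    simp
  rw [hld s hs, hld s₀ hs₀]
  have : (∑ ρ ∈ S R, (analyticOrderNatAt f ρ : ℂ) * (1 / (s - ρ) - 1 / (s₀ - ρ))) -
      ((∑ ρ ∈ S R, (analyticOrderNatAt f ρ : ℂ) * (1 / (s - ρ))) + logDeriv g s -
        ((∑ ρ ∈ S R, (analyticOrderNatAt f ρ : ℂ) * (1 / (s₀ - ρ))) + logDeriv g s₀)) =
      -(logDeriv g s - logDeriv g s₀) := by
    simp only [mul_sub, Finset.sum_sub_distrib]; ring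
  rw [this, norm_neg]
  refine hmain.trans (le_of_eq ?_)
  field_simp; ring

/-- Growth of the entire completed zeta function in the right half-plane. -/
lemma norm_completedRiemannZeta₀_le : ∃ C c : ℝ, 0 < C ∧ 1 ≤ c ∧ ∀ (k : ℕ) (s : ℂ), 0 ≤ s.re →
    s.re ≤ k → ‖completedRiemannZeta₀ s‖ ≤ C * (1 + k.factorial * c ^ k) := by
  open MeasureTheory in
  set P := HurwitzZeta.hurwitzEvenFEPair 0 with hP
  have hconv : ∀ s : ℂ, MellinConvergent P.f_modif s :=
    fun s => (P.isStrongFEPair_toStrongFEPair.hasMellin s).1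
  obtain ⟨p, hp, hpO⟩ := HurwitzZeta.isBigO_atTop_evenKernel_sub 0
  obtain ⟨K, hK⟩ := hpO.bound
  obtain ⟨T, hT⟩ := eventually_atTop.1 hK
  have h0 : IntegrableOn (fun t : ℝ => t ^ (-1 : ℝ) * ‖P.f_modif t‖) (Set.Ioi 0) := by
    have := (hconv 0).norm
    refine IntegrableOn.congr_fun this (fun t ht => ?_) measurableSet_Ioi
    have ht : 0 < t := ht
    simp only [zero_sub, norm_smul]
    rw [← Complex.ofReal_one, ← Complex.ofReal_neg, Complex.norm_cpow_eq_rpow_re_of_pos ht,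
      Complex.ofReal_re]
  have hmeas : AEStronglyMeasurable (fun t : ℝ => ‖P.f_modif t‖) (volume.restrict (Set.Ioi 0)) :=
    (P.hf_modif_int.aestronglyMeasurable).norm
  set U := max T 1 + 1 with hU
  have hU1 : 1 < U := by have := le_max_right T 1; linarith
  have hUT : T ≤ U := by have := le_max_left T 1; linarith
  set F : ℝ → ℝ := fun t => Real.exp (p / 2 * t) * (t ^ (-1 : ℝ) * ‖P.f_modif t‖) with hF
  have hFm : AEStronglyMeasurable F (volume.restrict (Set.Ioi 0)) :=
    (by fun_prop : Measurable fun t : ℝ => Real.exp (p / 2 * t)).aestronglyMeasurable.mul h0.1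
  have hFint : IntegrableOn F (Set.Ioi 0) := by
    have hu : Set.Ioi (0 : ℝ) = Set.Ioc 0 U ∪ Set.Ioi U :=
      (Set.Ioc_union_Ioi_eq_Ioi (by linarith)).symm
    rw [hu]
    refine IntegrableOn.union ?_ ?_
    · have h1 : IntegrableOn (fun t : ℝ => Real.exp (p / 2 * U) * (t ^ (-1 : ℝ) * ‖P.f_modif t‖))
        (Set.Ioc 0 U) := (h0.mono_set Set.Ioc_subset_Ioi_self).const_mul _
      refine Integrable.mono' h1 (hFm.mono_measure
        (Measure.restrict_mono Set.Ioc_subset_Ioi_self le_rfl)) ?_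
      refine (ae_restrict_iff' measurableSet_Ioc).2 (Eventually.of_forall fun t ht => ?_)
      have h2 : 0 ≤ t ^ (-1 : ℝ) * ‖P.f_modif t‖ :=
        mul_nonneg (Real.rpow_nonneg ht.1.le _) (norm_nonneg _)
      rw [hF, Real.norm_of_nonneg (by positivity)]
      exact mul_le_mul_of_nonneg_right (Real.exp_le_exp.2 (by nlinarith [ht.2])) h2
    · have h1 : IntegrableOn (fun t : ℝ => K * Real.exp (-(p / 2) * t)) (Set.Ioi U) :=
        (integrableOn_exp_mul_Ioi (by linarith) U).const_mul K
      refine Integrable.mono' h1 (hFm.mono_measure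
        (Measure.restrict_mono (Set.Ioi_subset_Ioi (by linarith)) le_rfl)) ?_
      refine (ae_restrict_iff' measurableSet_Ioi).2 (Eventually.of_forall fun t ht => ?_)
      have htU : U < t := ht
      have ht1 : 1 < t := hU1.trans ht
      have h3 : P.f_modif t = P.f t - P.f₀ := by
        simp [WeakFEPair.f_modif, Set.indicator, ht1, not_lt.2 ht1.le]
      have h4 : ‖P.f_modif t‖ ≤ K * Real.exp (-p * t) := by
        have := hT t (hUT.trans htU.le)
        rw [h3]
        simp only [hP, HurwitzZeta.hurwitzEvenFEPair, if_true, Function.comp] at this ⊢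
        rw [Real.norm_eq_abs (Real.exp _), abs_of_pos (Real.exp_pos _)] at this
        rwa [← Complex.ofReal_one, ← Complex.ofReal_sub, Complex.norm_real]
      have h5 : t ^ (-1 : ℝ) ≤ 1 := Real.rpow_le_one_of_one_le_of_nonpos ht1.le (by norm_num)
      rw [hF, Real.norm_of_nonneg (by positivity)]
      calc Real.exp (p / 2 * t) * (t ^ (-1 : ℝ) * ‖P.f_modif t‖)
          ≤ Real.exp (p / 2 * t) * (1 * (K * Real.exp (-p * t))) := by gcongr
        _ = K * (Real.exp (p / 2 * t) * Real.exp (-p * t)) := by ring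
        _ = K * Real.exp (-(p / 2) * t) := by rw [← Real.exp_add]; ring_nf
  have hF0 : 0 ≤ ∫ t in Set.Ioi 0, F t :=
    setIntegral_nonneg measurableSet_Ioi fun t (ht : 0 < t) => by positivity
  refine ⟨(∫ t in Set.Ioi 0, F t) + 1, max (2 / p) 1, by linarith, le_max_right _ _,
    fun k s hs hsk => ?_⟩
  have hΛ : completedRiemannZeta₀ s = mellin P.f_modif (s / 2) / 2 := rfl
  have hle : ‖mellin P.f_modif (s / 2)‖ ≤
      (1 + k.factorial * (max (2 / p) 1) ^ k) * ∫ t in Set.Ioi 0, F t := by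
    rw [mellin, ← integral_const_mul]
    refine norm_integral_le_of_norm_le (hFint.const_mul _) ?_
    refine (ae_restrict_iff' measurableSet_Ioi).2 (Eventually.of_forall fun t ht => ?_)
    have ht : 0 < t := ht
    rw [norm_smul, Complex.norm_cpow_eq_rpow_re_of_pos ht, hF]
    have hre : (s / 2 - 1).re = s.re / 2 + (-1 : ℝ) := by
      simp; ring
    rw [hre, Real.rpow_add ht]
    have h6 : t ^ (s.re / 2) ≤ (1 + k.factorial * (max (2 / p) 1) ^ k) * Real.exp (p / 2 * t) := by
      have he : 1 ≤ Real.exp (p / 2 * t) := Real.one_le_exp (by positivity)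
      have h7 : t ^ k ≤ k.factorial * (max (2 / p) 1) ^ k * Real.exp (p / 2 * t) := by
        have h8 := Real.pow_div_factorial_le_exp (x := p / 2 * t) (by positivity) k
        rw [div_le_iff₀ (by positivity)] at h8
        calc t ^ k = (2 / p) ^ k * (p / 2 * t) ^ k := by rw [← mul_pow]; congr 1; field_simp
          _ ≤ (max (2 / p) 1) ^ k * (Real.exp (p / 2 * t) * k.factorial) := by
              gcongr; exact le_max_left _ _
          _ = _ := by ring
      rcases le_total t 1 with h | h
      · have : t ^ (s.re / 2) ≤ 1 := Real.rpow_le_one ht.le h (by linarith)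
        have h9 : 0 ≤ (k.factorial : ℝ) * (max (2 / p) 1) ^ k := by positivity
        nlinarith
      · have : t ^ (s.re / 2) ≤ t ^ k := by
          rw [← Real.rpow_natCast]
          exact Real.rpow_le_rpow_of_exponent_le h (by linarith)
        nlinarith
    calc t ^ (s.re / 2) * t ^ (-1 : ℝ) * ‖P.f_modif t‖
        ≤ (1 + k.factorial * (max (2 / p) 1) ^ k) * Real.exp (p / 2 * t) * t ^ (-1 : ℝ)
          * ‖P.f_modif t‖ := by gcongr
      _ = _ := by ring
  rw [hΛ, norm_div]
  have h9 : 0 ≤ (k.factorial : ℝ) * (max (2 / p) 1) ^ k := by positivity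
  simp only [Complex.norm_ofNat]
  nlinarith

/-- The Riemann xi function, normalised by `ξ(0) = ξ(1) = 1`. -/
noncomputable def riemannXi (s : ℂ) : ℂ := s * (s - 1) * completedRiemannZeta₀ s + 1

lemma differentiable_riemannXi : Differentiable ℂ riemannXi := by
  have := differentiable_completedZeta₀
  unfold riemannXi
  fun_prop

@[simp] lemma riemannXi_zero : riemannXi 0 = 1 := by simp [riemannXi]

@[simp] lemma riemannXi_one : riemannXi 1 = 1 := by simp [riemannXi]

lemma riemannXi_one_sub (s : ℂ) : riemannXi (1 - s) = riemannXi s := by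
  simp only [riemannXi, completedRiemannZeta₀_one_sub]; ring

lemma completedRiemannZeta₀_conj (s : ℂ) :
    completedRiemannZeta₀ (starRingEnd ℂ s) = starRingEnd ℂ (completedRiemannZeta₀ s) := by
  have hΛ : ∀ s, completedRiemannZeta₀ s =
    mellin (HurwitzZeta.hurwitzEvenFEPair 0).f_modif (s / 2) / 2 := fun s => rfl
  have hf : ∀ t, starRingEnd ℂ ((HurwitzZeta.hurwitzEvenFEPair 0).f_modif t) =
      (HurwitzZeta.hurwitzEvenFEPair 0).f_modif t := by
    intro t
    simp only [WeakFEPair.f_modif, HurwitzZeta.hurwitzEvenFEPair, Set.indicator, Pi.add_apply]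
    split_ifs <;> simp
  rw [hΛ, hΛ, map_div₀, mellin, mellin, ← integral_conj]
  congr 1
  · refine MeasureTheory.setIntegral_congr_fun measurableSet_Ioi fun t (ht : 0 < t) => ?_
    simp only [smul_eq_mul, map_mul, hf]
    have harg : (t : ℂ).arg ≠ Real.pi := by
      simp [Complex.arg_ofReal_of_nonneg ht.le, Real.pi_ne_zero.symm]
    have := Complex.cpow_conj (t : ℂ) (s / 2 - 1) harg
    rw [Complex.conj_ofReal] at this
    rw [← this, map_sub, map_div₀, map_one, map_ofNat]
  · exact (map_ofNat _ 2).symm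

lemma riemannXi_conj (s : ℂ) : riemannXi (starRingEnd ℂ s) = starRingEnd ℂ (riemannXi s) := by
  simp [riemannXi, completedRiemannZeta₀_conj]

lemma riemannXi_eq {s : ℂ} (h0 : s ≠ 0) (h1 : s ≠ 1) (hΓ : Complex.Gammaℝ s ≠ 0) :
    riemannXi s = s * (s - 1) * (Complex.Gammaℝ s * riemannZeta s) := by
  have h2 : 1 - s ≠ 0 := sub_ne_zero.2 h1.symm
  rw [riemannZeta_def_of_ne_zero h0, mul_div_cancel₀ _ hΓ, completedRiemannZeta_eq, riemannXi]
  field_simp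
  ring

lemma riemannXi_ne_zero {s : ℂ} (hs : 1 ≤ s.re) : riemannXi s ≠ 0 := by
  rcases eq_or_ne s 1 with rfl | h1
  · simp
  have h0 : s ≠ 0 := by rintro rfl; norm_num at hs
  have hΓ := Complex.Gammaℝ_ne_zero_of_re_pos (s := s) (by linarith)
  rw [riemannXi_eq h0 h1 hΓ]
  exact mul_ne_zero (mul_ne_zero h0 (sub_ne_zero.2 h1))
    (mul_ne_zero hΓ (riemannZeta_ne_zero_of_one_le_re hs))

lemma re_mem_Ioo_of_riemannXi_eq_zero {s : ℂ} (hs : riemannXi s = 0) : s.re ∈ Set.Ioo 0 1 := by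
  constructor
  · by_contra! h
    refine riemannXi_ne_zero (s := 1 - s) (by simp; linarith) ?_
    rwa [riemannXi_one_sub]
  · by_contra! h
    exact riemannXi_ne_zero h hs

/-- `ξ` has order less than two. -/
lemma norm_riemannXi_le : ∃ K : ℝ, 0 < K ∧ ∀ (R : ℝ) (z : ℂ), 0 < R → ‖z‖ ≤ R →
    ‖riemannXi z‖ ≤ Real.exp (K * ((R + 3) * √(R + 3))) := by
  obtain ⟨C, c, hC, hc, hb⟩ := norm_completedRiemannZeta₀_le
  have key : ∀ (R : ℝ) (z : ℂ), 0 ≤ R → ‖z‖ ≤ R + 1 → 0 ≤ z.re →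
      ‖riemannXi z‖ ≤ Real.exp ((1 + 2 * C + 4 + c) * ((R + 3) * √(R + 3))) := by
    intro R z hR hz hre
    set k := ⌈R + 1⌉₊ with hk
    have hkR : (k : ℝ) ≤ R + 2 := by
      have := Nat.ceil_lt_add_one (a := R + 1) (by linarith); linarith
    have hk1 : R + 1 ≤ k := Nat.le_ceil _
    have h1 := hb k z hre ((Complex.re_le_norm z).trans (hz.trans hk1))
    have hX1 : 1 ≤ R + 3 := by linarith
    have hs1 : 1 ≤ √(R + 3) := Real.one_le_sqrt.2 hX1
    have hss : √(R + 3) * √(R + 3) = R + 3 := Real.mul_self_sqrt (by linarith)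
    set S := √(R + 3)
    have hkc : (k.factorial : ℝ) * c ^ k ≤ Real.exp ((2 + c) * ((R + 3) * S)) := by
      have h2 : (k.factorial : ℝ) ≤ (R + 3) ^ k := by
        calc (k.factorial : ℝ) ≤ (k : ℝ) ^ k := by exact_mod_cast Nat.factorial_le_pow k
          _ ≤ _ := by gcongr; linarith
      have h3 : R + 3 ≤ Real.exp (2 * S) := by
        have := Real.add_one_le_exp S
        calc R + 3 = S * S := hss.symm
          _ ≤ Real.exp S * Real.exp S := by gcongr <;> linarith
          _ = _ := by rw [← Real.exp_add]; ring_nf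
      have h4 : c ≤ Real.exp (c * S) := by
        have := Real.add_one_le_exp (c * S); nlinarith
      calc (k.factorial : ℝ) * c ^ k ≤ (R + 3) ^ k * c ^ k := by gcongr
        _ ≤ Real.exp (2 * S) ^ k * Real.exp (c * S) ^ k := by gcongr
        _ = Real.exp ((2 + c) * (k * S)) := by
          rw [← mul_pow, ← Real.exp_add, ← Real.exp_nat_mul]; ring_nf
        _ ≤ _ := by
          apply Real.exp_le_exp.2
          gcongr
          linarith
    have h5 : ‖z * (z - 1)‖ ≤ (R + 3) * (R + 3) := by
      rw [norm_mul]
      have : ‖z - 1‖ ≤ ‖z‖ + 1 := by simpa using norm_sub_le z 1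
      gcongr <;> linarith
    set E := (R + 3) * S with hE
    have hE1 : 1 ≤ E := by nlinarith
    have h6 : (R + 3) * (R + 3) ≤ Real.exp (2 * E) := by
      have h3 : R + 3 ≤ Real.exp E := by
        have := Real.add_one_le_exp E; nlinarith
      calc (R + 3) * (R + 3) ≤ Real.exp E * Real.exp E := by gcongr
          _ = _ := by rw [← Real.exp_add]; ring_nf
    have h7 : 1 + 2 * C ≤ Real.exp ((1 + 2 * C) * E) := by
      have := Real.add_one_le_exp ((1 + 2 * C) * E); nlinarith
    have h8 : 1 ≤ Real.exp ((2 + c) * E) := Real.one_le_exp (by positivity)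
    have h9 : 1 ≤ Real.exp (2 * E) := Real.one_le_exp (by positivity)
    calc ‖riemannXi z‖ ≤ ‖z * (z - 1)‖ * ‖completedRiemannZeta₀ z‖ + 1 := by
          rw [riemannXi, ← norm_mul]; simpa using norm_add_le (z * (z - 1) * completedRiemannZeta₀ z) 1
      _ ≤ Real.exp (2 * E) * (C * (1 + Real.exp ((2 + c) * E))) + 1 := by
          gcongr
          · exact h5.trans h6
          · refine h1.trans ?_
            gcongr
      _ ≤ (1 + 2 * C) * (Real.exp (2 * E) * Real.exp ((2 + c) * E)) := by
          have h10 : 1 ≤ Real.exp (2 * E) * Real.exp ((2 + c) * E) := one_le_mul_of_one_le_of_one_le h9 h8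
          have h11 : C * (Real.exp (2 * E) * 1) ≤ C * (Real.exp (2 * E) * Real.exp ((2 + c) * E)) := by
            gcongr
          nlinarith
      _ ≤ Real.exp ((1 + 2 * C) * E) * (Real.exp (2 * E) * Real.exp ((2 + c) * E)) := by gcongr
      _ = _ := by rw [← Real.exp_add, ← Real.exp_add]; ring_nf
  refine ⟨1 + 2 * C + 4 + c, by positivity, fun R z hR hz => ?_⟩
  rcases le_total 0 z.re with h | h
  · exact key R z hR.le (by linarith) h
  · rw [← riemannXi_one_sub]
    refine key R _ hR.le ?_ (by simp; linarith)
    have : ‖1 - z‖ ≤ 1 + ‖z‖ := by simpa using norm_sub_le 1 z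
    linarith

lemma tendsto_exponent_div_sq (K : ℝ) :
    Tendsto (fun R : ℝ => K * ((R + 3) * √(R + 3)) / R ^ 2) atTop (nhds 0) := by
  have h1 : Tendsto (fun R : ℝ => (R + 3) ^ (3 / 2 : ℝ) / R ^ (2:ℝ)) atTop (nhds 0) := by
    have h2 : Tendsto (fun R : ℝ => (1 + 3 / R) ^ (3 / 2 : ℝ) * R ^ (-(1 / 2 : ℝ))) atTop
        (nhds (1 * 0)) := by
      refine Tendsto.mul ?_ (tendsto_rpow_neg_atTop (by norm_num))
      have h3 : Tendsto (fun R : ℝ => 1 + 3 / R) atTop (nhds (1 + 0)) :=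
        tendsto_const_nhds.add (tendsto_const_nhds.div_atTop tendsto_id)
      have := h3.rpow_const (p := 3 / 2) (Or.inl (by norm_num))
      simpa using this
    rw [mul_zero] at h2
    refine h2.congr' ?_
    filter_upwards [eventually_gt_atTop 0] with R hR
    have : R + 3 = (1 + 3 / R) * R := by field_simp
    rw [this, Real.mul_rpow (by positivity) hR.le, mul_div_assoc, ← Real.rpow_sub hR]
    norm_num
  have := h1.const_mul K
  rw [mul_zero] at this
  refine this.congr' ?_
  filter_upwards [eventually_gt_atTop 0] with R hR
  rw [Real.sqrt_eq_rpow, ← Real.rpow_one_add' (by linarith) (by norm_num), mul_div_assoc]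
  norm_num

/-- The zeros of `ξ`, i.e. the nontrivial zeros of `ζ`. -/
abbrev XiZero := {ρ : ℂ // riemannXi ρ = 0}

/-- Multiplicity of a zero of `ξ`. -/
noncomputable def xiMult (ρ : XiZero) : ℝ := analyticOrderNatAt riemannXi ρ

lemma analyticOrderAt_riemannXi_ne_top (z : ℂ) : analyticOrderAt riemannXi z ≠ ⊤ := by
  intro h
  have h1 : AnalyticOnNhd ℂ riemannXi Set.univ := fun z _ => differentiable_riemannXi.analyticAt z
  have h2 := h1.eqOn_zero_of_preconnected_of_eventuallyEq_zero isPreconnected_univ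
    (Set.mem_univ z) (analyticOrderAt_eq_top.1 h) (Set.mem_univ (0 : ℂ))
  simp at h2

lemma one_le_xiMult (ρ : XiZero) : 1 ≤ xiMult ρ := by
  have h : analyticOrderNatAt riemannXi ρ ≠ 0 := by
    intro h
    have h1 : analyticOrderAt riemannXi (ρ : ℂ) = 0 := by
      rw [← Nat.cast_analyticOrderNatAt (analyticOrderAt_riemannXi_ne_top _), h]; rfl
    exact (differentiable_riemannXi.analyticAt _).analyticOrderAt_eq_zero.1 h1 ρ.2
  rw [xiMult]
  exact_mod_cast Nat.one_le_iff_ne_zero.2 h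

lemma xiMult_nonneg (ρ : XiZero) : 0 ≤ xiMult ρ := zero_le_one.trans (one_le_xiMult ρ)

/-- The symmetry `ρ ↦ 1 - ρ` of the zeros. -/
def XiZero.reflect : XiZero ≃ XiZero where
  toFun ρ := ⟨1 - ρ, by rw [riemannXi_one_sub]; exact ρ.2⟩
  invFun ρ := ⟨1 - ρ, by rw [riemannXi_one_sub]; exact ρ.2⟩
  left_inv ρ := by ext; simp
  right_inv ρ := by ext; simp

@[simp]
lemma XiZero.reflect_apply (ρ : XiZero) : (XiZero.reflect ρ : ℂ) = 1 - ρ := rfl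

/-- The symmetry `ρ ↦ conj ρ` of the zeros. -/
noncomputable def XiZero.conj (ρ : XiZero) : XiZero :=
  ⟨starRingEnd ℂ ρ, by rw [riemannXi_conj, ρ.2, map_zero]⟩

lemma xiMult_reflect (ρ : XiZero) : xiMult (XiZero.reflect ρ) = xiMult ρ := by
  have hd : HasDerivAt (fun z : ℂ => 1 - z) (-1) (ρ : ℂ) := by
    simpa using (hasDerivAt_id (ρ : ℂ)).const_sub 1
  have h := analyticOrderAt_comp_of_deriv_ne_zero (f := riemannXi) (g := fun z : ℂ => 1 - z)
    (z₀ := (ρ : ℂ)) (by fun_prop) (by rw [hd.deriv]; norm_num)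
  have h2 : riemannXi ∘ (fun z : ℂ => 1 - z) = riemannXi := by
    ext z; exact riemannXi_one_sub z
  rw [h2] at h
  simp only [xiMult, XiZero.reflect_apply, analyticOrderNatAt, h]

lemma XiZero.re_pos (ρ : XiZero) : 0 < (ρ : ℂ).re := (re_mem_Ioo_of_riemannXi_eq_zero ρ.2).1

lemma XiZero.re_lt_one (ρ : XiZero) : (ρ : ℂ).re < 1 := (re_mem_Ioo_of_riemannXi_eq_zero ρ.2).2

lemma finite_setOf_xiZero (R : ℝ) : {z : ℂ | ‖z‖ ≤ R ∧ riemannXi z = 0}.Finite := by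
  have h1 : AnalyticOnNhd ℂ riemannXi Set.univ := fun z _ => differentiable_riemannXi.analyticAt z
  have h2 := h1.preimage_zero_mem_codiscrete (x := 0) (by simp)
  have h3 := IsCompact.finite_sdiff_of_mem_codiscreteWithin (isCompact_closedBall (0 : ℂ) R)
    (codiscreteWithin_mono (Set.subset_univ _) h2)
  refine h3.subset fun z hz => ?_
  simpa using hz

/-- The zeros of `ξ` in a disc. -/
noncomputable def xiZerosIn (R : ℝ) : Finset XiZero :=
  (finite_setOf_xiZero R).toFinset.subtype _

lemma mem_xiZerosIn {R : ℝ} {ρ : XiZero} : ρ ∈ xiZerosIn R ↔ ‖(ρ : ℂ)‖ ≤ R := by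
  simp [xiZerosIn, ρ.2]

lemma xiZerosIn_mono : Monotone xiZerosIn := fun _ _ h _ hρ =>
  mem_xiZerosIn.2 ((mem_xiZerosIn.1 hρ).trans h)

lemma tendsto_xiZerosIn : Tendsto xiZerosIn atTop atTop :=
  tendsto_atTop_finset_of_monotone xiZerosIn_mono fun ρ => ⟨‖(ρ : ℂ)‖, mem_xiZerosIn.2 le_rfl⟩

lemma logDeriv_riemannXi_one_sub (s : ℂ) :
    logDeriv riemannXi (1 - s) = -logDeriv riemannXi s := by
  have h1 : HasDerivAt riemannXi (deriv riemannXi (1 - s) * -1) s := by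
    have h2 : HasDerivAt (fun z => riemannXi (1 - z)) (deriv riemannXi (1 - s) * -1) s :=
      HasDerivAt.comp s (differentiable_riemannXi (1 - s)).hasDerivAt
        (by simpa using (hasDerivAt_id s).const_sub 1)
    simpa only [riemannXi_one_sub] using h2
  rw [logDeriv_apply, logDeriv_apply, riemannXi_one_sub, h1.deriv]
  ring

lemma tendsto_sum_xiZerosIn {s : ℂ} (hs : 1 ≤ s.re) :
    Tendsto (fun R => ∑ ρ ∈ xiZerosIn R, (xiMult ρ : ℂ) * (1 / (s - ρ) + 1 / (s - 1 + ρ))) atTop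
      (nhds (2 * logDeriv riemannXi s)) := by
  obtain ⟨K, hK, hb⟩ := norm_riemannXi_le
  have h := tendsto_sum_zeros_logDeriv differentiable_riemannXi riemannXi_zero
    (fun R => (finite_setOf_xiZero R).toFinset) (fun R z => by simp)
    (fun R => K * ((R + 3) * √(R + 3))) hb (by
      intro R hR
      have : 0 < R + 3 := by linarith
      positivity) (tendsto_exponent_div_sq K) (s := s) (s₀ := 1 - s)
      (riemannXi_ne_zero hs) (by rw [riemannXi_one_sub]; exact riemannXi_ne_zero hs)
  rw [logDeriv_riemannXi_one_sub, sub_neg_eq_add, ← two_mul] at h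
  refine h.congr fun R => ?_
  have h1 : ∀ z ∈ (finite_setOf_xiZero R).toFinset, riemannXi z = 0 := fun z hz => by
    simpa using And.right (by simpa using hz)
  rw [xiZerosIn]
  refine (Finset.sum_subtype_of_mem (p := fun z => riemannXi z = 0) (fun ρ : ℂ =>
    (analyticOrderNatAt riemannXi ρ : ℂ) * (1 / (s - ρ) - 1 / (1 - s - ρ))) h1).symm.trans ?_
  refine Finset.sum_congr rfl fun ρ _ => ?_
  have : 1 - s - ρ = -(s - 1 + ρ) := by ring
  rw [this, one_div_neg_eq_neg_one_div, sub_neg_eq_add, xiMult]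
  simp

lemma re_one_div_nonneg {z : ℂ} (hz : 0 ≤ z.re) : 0 ≤ (1 / z).re := by
  rw [one_div, Complex.inv_re]
  exact div_nonneg hz (Complex.normSq_nonneg z)

/-- Partial fractions of the logarithmic derivative of `ξ`, real parts. -/
theorem hasSum_re_logDeriv_riemannXi {s : ℂ} (hs : 1 ≤ s.re) :
    HasSum (fun ρ : XiZero => xiMult ρ * (1 / (s - ρ)).re) (logDeriv riemannXi s).re := by
  have hn1 : ∀ ρ : XiZero, 0 ≤ (1 / (s - ρ)).re := fun ρ =>
    re_one_div_nonneg (by have := ρ.re_lt_one; simp; linarith)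
  have hn2 : ∀ ρ : XiZero, 0 ≤ (1 / (s - 1 + ρ)).re := fun ρ =>
    re_one_div_nonneg (by have := ρ.re_pos; simp; linarith)
  set F : XiZero → ℝ := fun ρ => xiMult ρ * ((1 / (s - ρ)).re + (1 / (s - 1 + ρ)).re) with hF
  have hF0 : ∀ ρ, 0 ≤ F ρ := fun ρ => mul_nonneg (xiMult_nonneg ρ) (add_nonneg (hn1 ρ) (hn2 ρ))
  have ht : Tendsto (fun R => ∑ ρ ∈ xiZerosIn R, F ρ) atTop
      (nhds (2 * (logDeriv riemannXi s).re)) := by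
    have := (Complex.continuous_re.tendsto _).comp (tendsto_sum_xiZerosIn hs)
    have h2 : (2 * logDeriv riemannXi s).re = 2 * (logDeriv riemannXi s).re := by simp
    rw [h2] at this
    refine this.congr fun R => ?_
    simp only [Function.comp, Complex.re_sum, Complex.re_ofReal_mul, Complex.add_re, hF]
  have hmono : Monotone fun R => ∑ ρ ∈ xiZerosIn R, F ρ := fun a b hab =>
    Finset.sum_le_sum_of_subset_of_nonneg (xiZerosIn_mono hab) fun ρ _ _ => hF0 ρ
  have hsum : Summable F := by
    refine summable_of_sum_le (c := 2 * (logDeriv riemannXi s).re) hF0 fun u => ?_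
    obtain ⟨R, hR⟩ := (tendsto_xiZerosIn.eventually_ge_atTop u).exists
    exact (Finset.sum_le_sum_of_subset_of_nonneg hR fun ρ _ _ => hF0 ρ).trans
      (hmono.ge_of_tendsto ht R)
  have hFsum : HasSum F (2 * (logDeriv riemannXi s).re) := by
    have := tendsto_nhds_unique ht (hsum.hasSum.comp tendsto_xiZerosIn)
    rw [this]; exact hsum.hasSum
  have hs1 : Summable fun ρ : XiZero => xiMult ρ * (1 / (s - ρ)).re :=
    hsum.of_nonneg_of_le (fun ρ => mul_nonneg (xiMult_nonneg ρ) (hn1 ρ)) fun ρ =>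
      mul_le_mul_of_nonneg_left (by linarith [hn2 ρ]) (xiMult_nonneg ρ)
  have hs2 : HasSum (fun ρ : XiZero => xiMult ρ * (1 / (s - 1 + ρ)).re)
      (∑' ρ : XiZero, xiMult ρ * (1 / (s - ρ)).re) := by
    have := (Equiv.hasSum_iff XiZero.reflect).2 hs1.hasSum
    refine this.congr_fun ?_
    intro ρ
    have h5 : s - 1 + (ρ : ℂ) = s - (1 - ρ) := by ring
    rw [Function.comp, xiMult_reflect, XiZero.reflect_apply, h5]
  have h := hs1.hasSum.add hs2
  have h3 := h.unique (hFsum.congr_fun fun ρ => by simp only [hF]; ring)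
  have h4 : (logDeriv riemannXi s).re = ∑' ρ : XiZero, xiMult ρ * (1 / (s - ρ)).re := by linarith
  rw [h4]
  exact hs1.hasSum

lemma hasDerivAt_realGamma {x : ℝ} (hx : 0 < x) :
    HasDerivAt Real.Gamma (deriv Real.Gamma x) x :=
  (Real.differentiableAt_Gamma fun m => by
    have := Nat.cast_nonneg (α := ℝ) m; linarith).hasDerivAt

lemma digamma_ofReal {x : ℝ} (hx : 0 < x) :
    Complex.digamma x = ((deriv Real.Gamma x / Real.Gamma x : ℝ) : ℂ) := by
  have hne : ∀ m : ℕ, (x : ℂ) ≠ -m := by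
    intro m h
    have h' : x = -m := by exact_mod_cast h
    have := Nat.cast_nonneg (α := ℝ) m
    linarith
  have h1 := (Complex.differentiableAt_Gamma _ hne).hasDerivAt.comp_ofReal
  have h2 := (hasDerivAt_realGamma hx).ofReal_comp
  simp only [Complex.Gamma_ofReal] at h1
  rw [Complex.digamma_def, logDeriv_apply, h1.unique h2, Complex.Gamma_ofReal]
  push_cast
  rfl

lemma hasDerivAt_log_realGamma {x : ℝ} (hx : 0 < x) :
    HasDerivAt (Real.log ∘ Real.Gamma) (Complex.digamma x).re x := by
  rw [digamma_ofReal hx, Complex.ofReal_re]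
  exact (hasDerivAt_realGamma hx).log (Real.Gamma_pos_of_pos hx).ne'

lemma log_realGamma_add_one {x : ℝ} (hx : 0 < x) :
    (Real.log ∘ Real.Gamma) (x + 1) = Real.log x + (Real.log ∘ Real.Gamma) x := by
  simp only [Function.comp]
  rw [Real.Gamma_add_one hx.ne', Real.log_mul hx.ne' (Real.Gamma_pos_of_pos hx).ne']

lemma re_digamma_le_log {x : ℝ} (hx : 0 < x) : (Complex.digamma x).re ≤ Real.log x := by
  have h := Real.convexOn_log_Gamma.le_slope_of_hasDerivAt (x := x) (y := x + 1) hx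
    (by simp only [Set.mem_Ioi]; linarith) (by linarith) (hasDerivAt_log_realGamma hx)
  simpa [slope_def_field, log_realGamma_add_one hx, -Function.comp_apply] using h

lemma log_le_re_digamma_add_one {x : ℝ} (hx : 0 < x) :
    Real.log x ≤ (Complex.digamma ((x + 1 : ℝ) : ℂ)).re := by
  have h := Real.convexOn_log_Gamma.slope_le_of_hasDerivAt (x := x) (y := x + 1) hx
    (by simp only [Set.mem_Ioi]; linarith) (by linarith)
    (hasDerivAt_log_realGamma (by linarith : 0 < x + 1))
  simpa [slope_def_field, log_realGamma_add_one hx, -Function.comp_apply] using h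

lemma digamma_add_natCast {z : ℂ} (hz : 0 < z.re) (N : ℕ) :
    Complex.digamma (z + N) = Complex.digamma z + ∑ n ∈ range N, 1 / (z + n) := by
  induction N with
  | zero => simp
  | succ N ih =>
    rw [sum_range_succ, ← add_assoc, ← ih]
    push_cast
    rw [← add_assoc, Complex.digamma_apply_add_one]
    · simp
    · intro m h
      have := congrArg Complex.re h
      simp at this
      have h1 := Nat.cast_nonneg (α := ℝ) m
      have h2 := Nat.cast_nonneg (α := ℝ) N
      linarith

lemma tendsto_log_sub_sum_ofReal {x : ℝ} (hx : 0 < x) :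
    Tendsto (fun N : ℕ => Real.log N - ∑ n ∈ range N, 1 / (x + n)) atTop
      (nhds (Complex.digamma x).re) := by
  have key : ∀ N : ℕ, (Complex.digamma ((x + N : ℝ) : ℂ)).re =
      (Complex.digamma x).re + ∑ n ∈ range N, 1 / (x + n) := by
    intro N
    have := congrArg Complex.re (digamma_add_natCast (z := x) (by simpa) N)
    push_cast
    rw [this, Complex.add_re, Complex.re_sum]
    congr 1
    refine sum_congr rfl fun n _ => ?_
    rw [← Complex.ofReal_natCast, ← Complex.ofReal_add, ← Complex.ofReal_one,
      ← Complex.ofReal_div, Complex.ofReal_re]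
  have h0 : ∀ a : ℝ, Tendsto (fun N : ℕ => Real.log (a + N) - Real.log N) atTop (nhds 0) := by
    intro a
    have h1 : Tendsto (fun N : ℕ => 1 + a / (N : ℝ)) atTop (nhds (1 + 0)) :=
      tendsto_const_nhds.add (tendsto_const_nhds.div_atTop tendsto_natCast_atTop_atTop)
    have h2 := h1.log (by norm_num)
    simp only [add_zero, Real.log_one] at h2
    refine h2.congr' ?_
    filter_upwards [eventually_gt_atTop 0,
      tendsto_natCast_atTop_atTop.eventually (eventually_gt_atTop (-a))] with N hN hN2
    have hN' : (0 : ℝ) < N := by exact_mod_cast hN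
    rw [← Real.log_div (by linarith) hN'.ne']
    congr 1; field_simp; ring
  have hA : Tendsto (fun N : ℕ => (Complex.digamma ((x + N : ℝ) : ℂ)).re - Real.log N) atTop
      (nhds 0) := by
    refine tendsto_of_tendsto_of_tendsto_of_le_of_le' (h0 (x - 1)) (h0 x) ?_ ?_
    · filter_upwards [eventually_ge_atTop 1] with N hN
      have hN' : (1 : ℝ) ≤ N := by exact_mod_cast hN
      have := log_le_re_digamma_add_one (x := x - 1 + N) (by linarith)
      rw [show x - 1 + N + 1 = x + (N : ℝ) by ring] at this
      linarith
    · filter_upwards with N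
      have := re_digamma_le_log (x := x + N) (by positivity)
      linarith
  have := (tendsto_const_nhds (x := (Complex.digamma x).re)).sub hA
  simp only [sub_zero] at this
  refine this.congr fun N => ?_
  rw [key]; ring

lemma digamma_term_eq {z : ℂ} (hz : 0 < z.re) (n : ℕ) :
    1 / ((n : ℂ) + 1) - 1 / (z + n) = (z - 1) / ((n + 1) * (z + n)) := by
  have h1 : (n : ℂ) + 1 ≠ 0 := Nat.cast_add_one_ne_zero n
  have h2 : z + n ≠ 0 := by
    intro h
    have := congrArg Complex.re h
    simp at this
    have := Nat.cast_nonneg (α := ℝ) n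
    linarith
  field_simp
  ring

lemma norm_digamma_term_le {δ R : ℝ} (hδ : 0 < δ) (hδ1 : δ ≤ 1) {z : ℂ} (hz : δ < z.re)
    (hR : ‖z‖ < R) (n : ℕ) :
    ‖1 / ((n : ℂ) + 1) - 1 / (z + n)‖ ≤ (R + 1) / δ * (1 / ((n : ℝ) + 1) ^ 2) := by
  rw [digamma_term_eq (hδ.trans hz), norm_div, norm_mul]
  have h1 : ‖(n : ℂ) + 1‖ = n + 1 := by
    have : ((n : ℂ) + 1) = ((n + 1 : ℕ) : ℂ) := by push_cast; rfl
    rw [this, Complex.norm_natCast]; push_cast; rfl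
  have hn := Nat.cast_nonneg (α := ℝ) n
  have h2 : δ * (n + 1) ≤ ‖z + n‖ := by
    refine le_trans ?_ (Complex.re_le_norm _)
    simp
    nlinarith
  have h3 : ‖z - 1‖ ≤ R + 1 := (norm_sub_le _ _).trans (by simp; linarith)
  rw [h1, div_mul_div_comm, mul_one]
  have : 0 ≤ ‖z‖ := norm_nonneg z
  exact div_le_div₀ (by linarith) h3 (by positivity) (by nlinarith)

lemma summable_one_div_add_one_sq : Summable fun n : ℕ => 1 / ((n : ℝ) + 1) ^ 2 := by
  have := (summable_nat_add_iff 1).2 (Real.summable_one_div_nat_pow.2 (le_refl 2))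
  simpa using this

lemma summable_digamma_term {z : ℂ} (hz : 0 < z.re) :
    Summable fun n : ℕ => 1 / ((n : ℂ) + 1) - 1 / (z + n) := by
  refine Summable.of_norm_bounded
    (g := fun n : ℕ => ((‖z‖ + 1) + 1) / (min (z.re / 2) 1) * (1 / ((n : ℝ) + 1) ^ 2))
    (summable_one_div_add_one_sq.mul_left _) fun n =>
    norm_digamma_term_le (lt_min (by linarith) one_pos) (min_le_right _ _)
      ((min_le_left _ _).trans_lt (by linarith)) (by linarith) n

lemma hasSum_digamma_ofReal {x : ℝ} (hx : 0 < x) :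
    ∑' n : ℕ, (1 / ((n : ℂ) + 1) - 1 / (x + n)) = Complex.digamma x - Complex.digamma 1 := by
  have h := (summable_digamma_term (z := x) (by simpa)).hasSum.tendsto_sum_nat
  refine tendsto_nhds_unique h ?_
  have h1 := (tendsto_log_sub_sum_ofReal hx).sub (tendsto_log_sub_sum_ofReal one_pos)
  have e : ∀ y : ℝ, 0 < y → ((Complex.digamma y).re : ℂ) = Complex.digamma y := by
    intro y hy; rw [digamma_ofReal hy]; simp
  have h2 := (Complex.continuous_ofReal.tendsto _).comp h1
  rw [Complex.ofReal_sub, e x hx, e 1 one_pos, Complex.ofReal_one] at h2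
  refine h2.congr fun N => ?_
  simp only [Function.comp]
  push_cast
  rw [sum_sub_distrib]
  simp only [add_comm]
  ring

lemma differentiableOn_digamma_series :
    DifferentiableOn ℂ (fun z : ℂ => ∑' n : ℕ, (1 / ((n : ℂ) + 1) - 1 / (z + n))) {z | 0 < z.re} := by
  intro z hz
  simp only [Set.mem_ofPred_eq] at hz
  set δ := min (z.re / 2) 1
  have hδ : 0 < δ := lt_min (by linarith) one_pos
  have hU : IsOpen ({w : ℂ | δ < w.re} ∩ {w | ‖w‖ < ‖z‖ + 1}) :=
    (isOpen_lt continuous_const Complex.continuous_re).inter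
      (isOpen_lt continuous_norm continuous_const)
  have hmem : z ∈ ({w : ℂ | δ < w.re} ∩ {w | ‖w‖ < ‖z‖ + 1}) :=
    ⟨(min_le_left _ _).trans_lt (by linarith : z.re / 2 < z.re), by simp⟩
  have := Complex.differentiableOn_tsum_of_summable_norm
    (F := fun (n : ℕ) (w : ℂ) => 1 / ((n : ℂ) + 1) - 1 / (w + n))
    (summable_one_div_add_one_sq.mul_left (((‖z‖ + 1) + 1) / δ)) (fun n => ?_) hU
    (fun n w hw => norm_digamma_term_le hδ (min_le_right _ _) hw.1 hw.2 n)
  · exact (this.differentiableAt (hU.mem_nhds hmem)).differentiableWithinAt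
  · intro w hw
    have hne : w + n ≠ 0 := by
      intro h
      have h1 := congrArg Complex.re h
      simp at h1
      have h2 := Nat.cast_nonneg (α := ℝ) n
      have h3 : δ < w.re := hw.1
      linarith
    have : DifferentiableAt ℂ (fun w : ℂ => 1 / ((n : ℂ) + 1) - 1 / (w + n)) w := by
      fun_prop (disch := exact hne)
    exact this.differentiableWithinAt

lemma differentiableOn_digamma : DifferentiableOn ℂ Complex.digamma {z | 0 < z.re} := by
  have hG : DifferentiableOn ℂ Complex.Gamma {z | 0 < z.re} := fun z hz =>
    (Complex.differentiableAt_Gamma _ fun m h => by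
      have h1 := congrArg Complex.re h
      simp at h1
      have h2 := Nat.cast_nonneg (α := ℝ) m
      simp only [Set.mem_ofPred_eq] at hz
      linarith).differentiableWithinAt
  have hU : IsOpen {z : ℂ | 0 < z.re} := isOpen_lt continuous_const Complex.continuous_re
  exact (hG.deriv hU).div hG fun z hz => Complex.Gamma_ne_zero_of_re_pos hz

theorem tsum_digamma {z : ℂ} (hz : 0 < z.re) :
    ∑' n : ℕ, (1 / ((n : ℂ) + 1) - 1 / (z + n)) = Complex.digamma z - Complex.digamma 1 := by
  have hU : IsOpen {z : ℂ | 0 < z.re} := isOpen_lt continuous_const Complex.continuous_re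
  have hpre : IsPreconnected {z : ℂ | 0 < z.re} := (convex_halfSpace_re_gt 0).isPreconnected
  have h := (differentiableOn_digamma_series.analyticOnNhd hU).eqOn_of_preconnected_of_frequently_eq
    (g := fun z => Complex.digamma z - Complex.digamma 1) 
    ((differentiableOn_digamma.sub_const _).analyticOnNhd hU) hpre
    (z₀ := 1) (by simp) ?_
  · exact h hz
  · have ht : Tendsto (fun n : ℕ => ((1 + 1 / ((n : ℝ) + 1) : ℝ) : ℂ)) atTop (nhdsWithin 1 {1}ᶜ) := by
      refine tendsto_nhdsWithin_iff.2 ⟨?_, Eventually.of_forall fun n => ?_⟩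
      · have := (tendsto_const_nhds (x := (1:ℝ))).add tendsto_one_div_add_atTop_nhds_zero_nat
        rw [add_zero] at this
        simpa [Function.comp_def] using (Complex.continuous_ofReal.tendsto 1).comp this
      · simp only [Set.mem_compl_iff, Set.mem_singleton_iff]
        norm_cast
        have : (0:ℝ) < 1 / ((n : ℝ) + 1) := by positivity
        push_cast
        linarith
    refine ht.frequently (Frequently.of_forall fun n => ?_)
    exact hasSum_digamma_ofReal (by positivity)

theorem tendsto_log_sub_sum {z : ℂ} (hz : 0 < z.re) :
    Tendsto (fun N : ℕ => Real.log N - ∑ n ∈ range N, (1 / (z + n)).re) atTop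
      (nhds (Complex.digamma z).re) := by
  have h := (summable_digamma_term hz).hasSum.tendsto_sum_nat
  rw [tsum_digamma hz] at h
  have h2 := ((Complex.continuous_re.tendsto _).comp h).add (tendsto_log_sub_sum_ofReal one_pos)
  simp only [Complex.sub_re, Complex.ofReal_one, sub_add_cancel] at h2
  refine h2.congr fun N => ?_
  simp only [Function.comp, Complex.re_sum, Complex.sub_re, sum_sub_distrib]
  have : ∀ n : ℕ, (1 / ((n : ℂ) + 1)).re = 1 / (1 + (n : ℝ)) := by
    intro n
    rw [show (1 / ((n : ℂ) + 1)) = ((1 / (1 + (n : ℝ)) : ℝ) : ℂ) by push_cast; ring,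
      Complex.ofReal_re]
  simp only [this]
  ring

/-- The real part of `1 / (u + i b)`. -/
noncomputable def cauchyKernel (b u : ℝ) : ℝ := u / (u ^ 2 + b ^ 2)

lemma cauchyKernel_le {b v m : ℝ} (hb : 0 < b) (h : 0 ≤ (m - v) * (b ^ 2 - m * v)) :
    cauchyKernel b v ≤ cauchyKernel b m := by
  unfold cauchyKernel
  rw [div_le_div_iff₀ (by positivity) (by positivity)]
  nlinarith

lemma hasDerivAt_half_log {b : ℝ} (hb : 0 < b) (u : ℝ) :
    HasDerivAt (fun u => Real.log (u ^ 2 + b ^ 2) / 2) (cauchyKernel b u) u := by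
  have h := ((((hasDerivAt_id u).pow 2).add_const (b ^ 2)).log
    (by simp; positivity)).div_const 2
  refine h.congr_deriv ?_
  simp [cauchyKernel]
  field_simp

lemma half_log_add_one_sub_le {b u M : ℝ} (hb : 0 < b)
    (hM : ∀ v ∈ Set.Icc u (u + 1), cauchyKernel b v ≤ M) :
    Real.log ((u + 1) ^ 2 + b ^ 2) / 2 - Real.log (u ^ 2 + b ^ 2) / 2 ≤ M := by
  obtain ⟨c, hc, h⟩ := exists_hasDerivAt_eq_slope (fun u => Real.log (u ^ 2 + b ^ 2) / 2)
    (cauchyKernel b) (by linarith : u < u + 1)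
    (fun x _ => (hasDerivAt_half_log hb x).continuousAt.continuousWithinAt)
    (fun x _ => hasDerivAt_half_log hb x)
  have := hM c ⟨hc.1.le, hc.2.le⟩
  rw [h] at this
  simpa using this

lemma half_log_step {b u : ℝ} (hb : 0 < b) (hu : 0 < u) :
    Real.log ((u + 1) ^ 2 + b ^ 2) / 2 - Real.log (u ^ 2 + b ^ 2) / 2 ≤
      cauchyKernel b u + cauchyKernel b (min (u + 1) b) - cauchyKernel b (min u b) := by
  rcases le_total b u with h | h
  · rw [min_eq_right h, min_eq_right (by linarith), add_sub_cancel_right]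
    refine half_log_add_one_sub_le hb fun v hv => cauchyKernel_le hb ?_
    exact mul_nonneg_of_nonpos_of_nonpos (by linarith [hv.1]) (by nlinarith [hv.1])
  · rw [min_eq_left h, add_sub_cancel_left]
    refine half_log_add_one_sub_le hb fun v hv => cauchyKernel_le hb ?_
    rcases le_total v (min (u + 1) b) with hvm | hvm
    · have : min (u + 1) b ≤ b := min_le_right _ _
      have h0 : 0 < v := hu.trans_le hv.1
      exact mul_nonneg (by linarith) (by nlinarith)
    · rcases le_total (u + 1) b with h1 | h1
      · rw [min_eq_left h1] at hvm ⊢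
        have : v = u + 1 := le_antisymm hv.2 hvm
        simp [this]
      · rw [min_eq_right h1] at hvm ⊢
        nlinarith [mul_nonneg hb.le (sq_nonneg (b - v))]

lemma half_log_sub_le {b a : ℝ} (hb : 0 < b) (ha : 0 < a) (N : ℕ) :
    Real.log ((a + N) ^ 2 + b ^ 2) / 2 - Real.log (a ^ 2 + b ^ 2) / 2 ≤
      ∑ n ∈ range N, cauchyKernel b (a + n) + cauchyKernel b (min (a + N) b)
        - cauchyKernel b (min a b) := by
  induction N with
  | zero => simp
  | succ N ih =>
    have := half_log_step hb (u := a + N) (by positivity)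
    rw [sum_range_succ]
    push_cast
    rw [← add_assoc]
    linarith

/-- Stirling-type upper bound for the real part of the digamma function. -/
theorem re_digamma_le {a b : ℝ} (ha : 0 < a) (hb : 0 < b) :
    (Complex.digamma (⟨a, b⟩ : ℂ)).re ≤ Real.log (a ^ 2 + b ^ 2) / 2 + 1 / (2 * b) := by
  refine le_of_tendsto (tendsto_log_sub_sum (z := ⟨a, b⟩) ha) ?_
  filter_upwards [eventually_gt_atTop 0] with N hN
  have hN' : (0 : ℝ) < N := by exact_mod_cast hN
  have h := half_log_sub_le hb ha N
  have h1 : ∀ n : ℕ, (1 / ((⟨a, b⟩ : ℂ) + n)).re = cauchyKernel b (a + n) := by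
    intro n
    simp [cauchyKernel, Complex.inv_re, Complex.normSq_apply]
    ring
  simp only [h1]
  have h2 : cauchyKernel b (min (a + N) b) ≤ 1 / (2 * b) := by
    have : cauchyKernel b b = 1 / (2 * b) := by unfold cauchyKernel; field_simp; ring
    rw [← this]
    exact cauchyKernel_le hb (by nlinarith [mul_nonneg hb.le (sq_nonneg (b - min (a + N) b))])
  have h3 : 0 ≤ cauchyKernel b (min a b) := by
    unfold cauchyKernel
    have : 0 < min a b := lt_min ha hb
    positivity
  have h4 : Real.log N ≤ Real.log ((a + N) ^ 2 + b ^ 2) / 2 := by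
    have := Real.log_le_log (by positivity : 0 < (N : ℝ) ^ 2)
      (by nlinarith : (N : ℝ) ^ 2 ≤ (a + N) ^ 2 + b ^ 2)
    rw [Real.log_pow] at this
    push_cast at this
    linarith
  linarith

lemma logDeriv_Gammaℝ {s : ℂ} (hs : 0 < s.re) :
    DifferentiableAt ℂ Complex.Gammaℝ s ∧
    logDeriv Complex.Gammaℝ s = Complex.digamma (s / 2) / 2 - (Real.log Real.pi : ℂ) / 2 := by
  have hre : 0 < (s / 2).re := by simpa using hs
  have hG : HasDerivAt Complex.Gamma (deriv Complex.Gamma (s / 2)) (s / 2) :=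
    (Complex.differentiableAt_Gamma _ fun m h => by
      have h1 := congrArg Complex.re h
      rw [Complex.neg_re, Complex.natCast_re] at h1
      have h2 := Nat.cast_nonneg (α := ℝ) m
      linarith).hasDerivAt
  have hd1 : HasDerivAt (fun s : ℂ => -s / 2) (-1 / 2) s := (hasDerivAt_id s).neg.div_const 2
  have hd2 : HasDerivAt (fun s : ℂ => s / 2) (1 / 2) s := (hasDerivAt_id s).div_const 2
  have hpi : (Real.pi : ℂ) ≠ 0 := by exact_mod_cast Real.pi_ne_zero
  have h1 : HasDerivAt (fun s : ℂ => (Real.pi : ℂ) ^ (-s / 2)) _ s :=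
    hd1.const_cpow (Or.inl hpi)
  have h2 : HasDerivAt (fun s : ℂ => Complex.Gamma (s / 2)) _ s := HasDerivAt.comp s hG hd2
  have h := h1.mul h2
  have hne : Complex.Gamma (s / 2) ≠ 0 := Complex.Gamma_ne_zero_of_re_pos hre
  have hne2 : (Real.pi : ℂ) ^ (-s / 2) ≠ 0 := by simp [Complex.cpow_eq_zero_iff, hpi]
  have h' : HasDerivAt Complex.Gammaℝ _ s := h
  refine ⟨h'.differentiableAt, ?_⟩
  rw [logDeriv_apply, h'.deriv, Complex.Gammaℝ_def, Complex.digamma_def, logDeriv_apply,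
    Complex.ofReal_log Real.pi_pos.le]
  field_simp
  ring

theorem logDeriv_riemannXi_eq {s : ℂ} (hs : 1 < s.re) :
    logDeriv riemannXi s = 1 / s + 1 / (s - 1) + Complex.digamma (s / 2) / 2
      - (Real.log Real.pi : ℂ) / 2 + logDeriv riemannZeta s := by
  have h0 : s ≠ 0 := by rintro rfl; simp at hs; linarith
  have h1 : s - 1 ≠ 0 := by
    intro h; rw [sub_eq_zero.1 h] at hs; simp at hs
  have hU : IsOpen {z : ℂ | 1 < z.re} := isOpen_lt continuous_const Complex.continuous_re
  have heq : riemannXi =ᶠ[nhds s]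
      fun z => z * (z - 1) * (Complex.Gammaℝ z * riemannZeta z) := by
    filter_upwards [hU.mem_nhds hs] with z hz
    have hz : 1 < z.re := hz
    refine riemannXi_eq ?_ ?_ (Complex.Gammaℝ_ne_zero_of_re_pos (by linarith))
    · rintro rfl; simp at hz; linarith
    · rintro rfl; simp at hz
  obtain ⟨hd, hG⟩ := logDeriv_Gammaℝ (s := s) (by linarith)
  have hζ : DifferentiableAt ℂ riemannZeta s := differentiableAt_riemannZeta (sub_ne_zero.1 h1)
  have hG0 := Complex.Gammaℝ_ne_zero_of_re_pos (s := s) (by linarith)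
  have hζ0 := riemannZeta_ne_zero_of_one_le_re hs.le
  have hsub : DifferentiableAt ℂ (fun z : ℂ => z - 1) s := by fun_prop
  rw [(logDeriv_congr_nhds heq).eq_of_nhds,
    logDeriv_mul (f := fun z => z * (z - 1)) (g := fun z => Complex.Gammaℝ z * riemannZeta z) s
      (mul_ne_zero h0 h1) (mul_ne_zero hG0 hζ0) (by fun_prop) (hd.mul hζ),
    logDeriv_mul (f := fun z => z) s h0 h1 differentiableAt_id hsub, logDeriv_mul s hG0 hζ0 hd hζ, hG, logDeriv_id']
  have : logDeriv (fun z : ℂ => z - 1) s = 1 / (s - 1) := by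
    simp [logDeriv_apply]
  rw [this]
  ring

theorem logDeriv_riemannXi_one :
    (logDeriv riemannXi 1).re = 1 + Real.eulerMascheroniConstant / 2 - Real.log (4 * Real.pi) / 2 := by
  have hd : HasDerivAt riemannXi
      ((1 * (1 - 1) * deriv completedRiemannZeta₀ 1 + (1 * (1 - 1) + 1 * 1) * completedRiemannZeta₀ 1)) 1 := by
    have h1 : HasDerivAt (fun s : ℂ => s * (s - 1)) (1 * (1 - 1) + 1 * 1) 1 :=
      (hasDerivAt_id (1 : ℂ)).mul ((hasDerivAt_id (1 : ℂ)).sub_const 1)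
    have h2 := (differentiable_completedZeta₀ 1).hasDerivAt
    refine ((h1.mul h2).add_const 1).congr_deriv ?_
    simp
  rw [logDeriv_apply, hd.deriv, riemannXi_one, completedRiemannZeta₀_one]
  have : Complex.log (4 * Real.pi) = (Real.log (4 * Real.pi) : ℂ) := by
    rw [Complex.ofReal_log (by positivity)]; push_cast; rfl
  rw [this]
  simp only [one_mul, sub_self, zero_mul, zero_add, div_one]
  rw [← Complex.ofReal_sub, show ((2:ℂ)) = ((2 : ℝ) : ℂ) by norm_num, ← Complex.ofReal_div,
    ← Complex.ofReal_one, ← Complex.ofReal_add, Complex.ofReal_re]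
  ring

/-- The midpoint sequence `H_n - log (n + 1/2)`, which decreases to Euler's constant. -/
noncomputable def eulerMidSeq (n : ℕ) : ℝ := harmonic n - Real.log (n + 1 / 2)

lemma antitone_eulerMidSeq : Antitone eulerMidSeq := by
  refine antitone_nat_of_succ_le fun n => ?_
  have hn := Nat.cast_nonneg (α := ℝ) n
  set x : ℝ := 1 / (2 * n + 2) with hx
  have hx0 : 0 < x := by positivity
  have hx1 : x < 1 := by rw [hx, div_lt_one (by positivity)]; linarith
  have h := Real.hasSum_log_sub_log_of_abs_lt_one (x := x) (by rwa [abs_of_pos hx0])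
  have h1 := h.summable.sum_le_tsum {0} (fun k _ => by positivity)
  rw [h.tsum_eq] at h1
  have e1 : 1 + x = (n + 1 + 1 / 2) / (n + 1) := by rw [hx]; field_simp
  have e2 : 1 - x = (n + 1 / 2) / (n + 1) := by rw [hx]; field_simp; ring
  rw [e1, e2, Real.log_div (by positivity) (by positivity),
    Real.log_div (by positivity) (by positivity)] at h1
  simp at h1
  have h2 : 2 * x = (n + 1 : ℝ)⁻¹ := by rw [hx]; field_simp
  rw [eulerMidSeq, eulerMidSeq, harmonic_succ]
  push_cast
  norm_num at h1 ⊢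
  linarith

lemma tendsto_eulerMidSeq :
    Tendsto eulerMidSeq atTop (nhds Real.eulerMascheroniConstant) := by
  refine tendsto_of_tendsto_of_tendsto_of_le_of_le' Real.tendsto_eulerMascheroniSeq
    Real.tendsto_eulerMascheroniSeq' ?_ ?_
  · filter_upwards with n
    rw [eulerMidSeq, Real.eulerMascheroniSeq]
    gcongr
    norm_num
  · filter_upwards [eventually_gt_atTop 0] with n hn
    rw [eulerMidSeq, Real.eulerMascheroniSeq', if_neg hn.ne']
    gcongr
    norm_num

lemma eulerMascheroniConstant_lt : Real.eulerMascheroniConstant < 0.5775 := by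
  have h := antitone_eulerMidSeq.le_of_tendsto tendsto_eulerMidSeq 31
  have h2 : (harmonic 31 : ℝ) < 4.02725 := by
    have : harmonic 31 < 4.02725 := by decide +kernel
    have := (Rat.cast_lt (K := ℝ)).2 this
    norm_num at this ⊢
  have h3 : Real.log (31 + 1 / 2) = 5 * Real.log 2 + Real.log (63 / 64) := by
    rw [← Real.log_rpow two_pos, ← Real.log_mul (by norm_num) (by norm_num)]; norm_num
  have h4 : 1 - (63 / 64 : ℝ)⁻¹ ≤ Real.log (63 / 64) := Real.one_sub_inv_le_log_of_pos (by norm_num)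
  have h5 := Real.log_two_gt_d9
  rw [eulerMidSeq] at h
  norm_num at h h2 h3 h4 ⊢
  linarith

lemma lt_log_four_mul_pi : 2.5309 < Real.log (4 * Real.pi) := by
  have h1 : Real.log (4 * 3.14159) ≤ Real.log (4 * Real.pi) :=
    Real.log_le_log (by norm_num) (by linarith [Real.pi_gt_d6])
  have h2 : Real.log (4 * 3.14159) = 4 * Real.log 2 - Real.log (16 / (4 * 3.14159)) := by
    rw [← Real.log_rpow two_pos, ← Real.log_div (by norm_num) (by norm_num)]; norm_num
  have h3 : Real.log (16 / (4 * 3.14159)) ≤ 0.2416 := by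
    rw [Real.log_le_iff_le_exp (by norm_num)]
    refine le_trans ?_ (Real.sum_le_exp_of_nonneg (by norm_num) 5)
    norm_num [Finset.sum_range_succ, Nat.factorial]
  have h5 := Real.log_two_gt_d9
  linarith

lemma re_logDeriv_riemannXi_one_lt : (logDeriv riemannXi 1).re < 0.0233 := by
  rw [logDeriv_riemannXi_one]
  have := lt_log_four_mul_pi
  have := eulerMascheroniConstant_lt
  linarith

/-- The contribution of a zero and of its reflection to the logarithmic derivative of `ξ`. -/
noncomputable def xiPair (σ : ℝ) (ρ : XiZero) : ℝ :=
  (σ - (ρ : ℂ).re) / ((σ - (ρ : ℂ).re) ^ 2 + (ρ : ℂ).im ^ 2) +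
    (σ - 1 + (ρ : ℂ).re) / ((σ - 1 + (ρ : ℂ).re) ^ 2 + (ρ : ℂ).im ^ 2)

lemma re_one_div_sub (σ : ℝ) (ρ : ℂ) :
    (1 / ((σ : ℂ) - ρ)).re = (σ - ρ.re) / ((σ - ρ.re) ^ 2 + ρ.im ^ 2) := by
  simp [Complex.inv_re, Complex.normSq_apply]
  ring

lemma hasSum_xiPair {σ : ℝ} (hσ : 1 ≤ σ) :
    HasSum (fun ρ : XiZero => xiMult ρ * xiPair σ ρ) (2 * (logDeriv riemannXi σ).re) := by
  have h1 := hasSum_re_logDeriv_riemannXi (s := σ) (by simpa)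
  have h2 := (Equiv.hasSum_iff XiZero.reflect).2 h1
  have h3 := h1.add h2
  rw [← two_mul] at h3
  refine h3.congr_fun ?_
  intro ρ
  simp only [Function.comp, xiMult_reflect]
  simp only [re_one_div_sub, xiPair, XiZero.reflect_apply]
  simp only [Complex.sub_re, Complex.one_re, Complex.sub_im, Complex.one_im, zero_sub, neg_sq]
  rw [show σ - (1 - (ρ : ℂ).re) = σ - 1 + (ρ : ℂ).re by ring]
  ring

lemma xiPair_ge {σ : ℝ} (hσ : 1 ≤ σ) (ρ : XiZero) :
    (2 * σ - 1) / (σ ^ 2 + (ρ : ℂ).im ^ 2) ≤ xiPair σ ρ := by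
  have h0 := ρ.re_pos
  have h1 := ρ.re_lt_one
  rw [xiPair, show 2 * σ - 1 = (σ - (ρ : ℂ).re) + (σ - 1 + (ρ : ℂ).re) by ring, add_div]
  have a1 : 0 < σ - (ρ : ℂ).re := by linarith
  have a2 : 0 < σ - 1 + (ρ : ℂ).re := by linarith
  have : 0 ≤ (ρ : ℂ).im ^ 2 := sq_nonneg _
  gcongr <;> linarith

lemma xiPair_nonneg {σ : ℝ} (hσ : 1 ≤ σ) (ρ : XiZero) : 0 ≤ xiPair σ ρ :=
  le_trans (div_nonneg (by linarith) (by positivity)) (xiPair_ge hσ ρ)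

lemma xiPair_reflect (σ : ℝ) (ρ : XiZero) : xiPair σ (XiZero.reflect ρ) = xiPair σ ρ := by
  simp only [xiPair, XiZero.reflect_apply, Complex.sub_re, Complex.one_re, Complex.sub_im,
    Complex.one_im, zero_sub, neg_sq]
  rw [show σ - (1 - (ρ : ℂ).re) = σ - 1 + (ρ : ℂ).re by ring,
    show σ - 1 + (1 - (ρ : ℂ).re) = σ - (ρ : ℂ).re by ring]
  ring

lemma XiZero.conj_re (ρ : XiZero) : (ρ.conj : ℂ).re = (ρ : ℂ).re := by
  simp [XiZero.conj]

lemma XiZero.conj_im (ρ : XiZero) : (ρ.conj : ℂ).im = -(ρ : ℂ).im := by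
  simp [XiZero.conj]

lemma xiPair_conj (σ : ℝ) (ρ : XiZero) : xiPair σ ρ.conj = xiPair σ ρ := by
  simp only [xiPair, XiZero.conj_re, XiZero.conj_im, neg_sq]

lemma sum_xiPair_one_le (F : Finset XiZero) : ∑ ρ ∈ F, xiPair 1 ρ ≤ 0.0466 := by
  have h := hasSum_xiPair (le_refl 1)
  have h1 : ∑ ρ ∈ F, xiMult ρ * xiPair 1 ρ ≤ 2 * (logDeriv riemannXi (1 : ℝ)).re :=
    sum_le_hasSum F (fun ρ _ => mul_nonneg (xiMult_nonneg ρ) (xiPair_nonneg le_rfl ρ)) h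
  have h2 := re_logDeriv_riemannXi_one_lt
  rw [Complex.ofReal_one] at h1
  have h3 : ∑ ρ ∈ F, xiPair 1 ρ ≤ ∑ ρ ∈ F, xiMult ρ * xiPair 1 ρ :=
    sum_le_sum fun ρ _ => le_mul_of_one_le_left (xiPair_nonneg le_rfl ρ) (one_le_xiMult ρ)
  linarith

lemma XiZero.im_sq_gt_crude (ρ : XiZero) : 20 < (ρ : ℂ).im ^ 2 := by
  have h := sum_xiPair_one_le {ρ}
  rw [sum_singleton] at h
  have h1 := (xiPair_ge le_rfl ρ).trans h
  rw [div_le_iff₀ (by positivity)] at h1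
  norm_num at h1
  linarith

lemma XiZero.im_ne_zero (ρ : XiZero) : (ρ : ℂ).im ≠ 0 := by
  intro h
  have := ρ.im_sq_gt_crude
  rw [h] at this
  norm_num at this

lemma XiZero.conj_ne (ρ : XiZero) : ρ.conj ≠ ρ := by
  intro h
  have h1 := congrArg (fun ρ : XiZero => (ρ : ℂ).im) h
  simp only [XiZero.conj_im] at h1
  exact ρ.im_ne_zero (by linarith)

lemma xiPair_one_le (ρ : XiZero) : xiPair 1 ρ ≤ 0.0233 := by
  have h := sum_xiPair_one_le {ρ.conj, ρ}
  rw [sum_pair ρ.conj_ne, xiPair_conj] at h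
  linarith

lemma xiPair_one_le_of_off_line (ρ : XiZero) (h : (ρ : ℂ).re ≠ 1 / 2) :
    xiPair 1 ρ ≤ 0.01165 := by
  have hre : (XiZero.reflect ρ : ℂ).re = 1 - (ρ : ℂ).re := by simp
  have hne : ∀ ρ₁ ρ₂ : XiZero, (ρ₁ : ℂ).re = 1 - (ρ : ℂ).re → (ρ₂ : ℂ).re = (ρ : ℂ).re →
      ρ₁ ≠ ρ₂ := by
    rintro ρ₁ ρ₂ h1 h2 rfl
    exact h (by linarith)
  have hs := sum_xiPair_one_le {(XiZero.reflect ρ).conj, XiZero.reflect ρ, ρ.conj, ρ}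
  rw [sum_insert, sum_insert, sum_pair ρ.conj_ne, xiPair_conj, xiPair_conj, xiPair_reflect] at hs
  · linarith
  · simp only [mem_insert, mem_singleton, not_or]
    exact ⟨hne _ _ hre (by rw [XiZero.conj_re]), hne _ _ hre rfl⟩
  · simp only [mem_insert, mem_singleton, not_or]
    exact ⟨(XiZero.reflect ρ).conj_ne, hne _ _ (by rw [XiZero.conj_re, hre]) (by rw [XiZero.conj_re]),
      hne _ _ (by rw [XiZero.conj_re, hre]) rfl⟩

lemma xiPair_one_of_on_line {ρ : XiZero} (h : (ρ : ℂ).re = 1 / 2) :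
    xiPair 1 ρ = 1 / (1 / 4 + (ρ : ℂ).im ^ 2) := by
  rw [xiPair, h]
  ring

lemma XiZero.im_sq_gt_of_off_line (ρ : XiZero) (h : (ρ : ℂ).re ≠ 1 / 2) :
    9.2 ^ 2 < (ρ : ℂ).im ^ 2 := by
  have h1 := (xiPair_ge le_rfl ρ).trans (xiPair_one_le_of_off_line ρ h)
  rw [div_le_iff₀ (by positivity)] at h1
  norm_num at h1 ⊢
  linarith

lemma XiZero.im_sq_gt (ρ : XiZero) : 6.5 ^ 2 < (ρ : ℂ).im ^ 2 := by
  by_cases h : (ρ : ℂ).re = 1 / 2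
  · have h1 := xiPair_one_le ρ
    rw [xiPair_one_of_on_line h, div_le_iff₀ (by positivity)] at h1
    norm_num at h1 ⊢
    linarith
  · have := ρ.im_sq_gt_of_off_line h
    norm_num at this ⊢
    linarith

lemma XiZero.abs_im_gt (ρ : XiZero) : 6.5 < |(ρ : ℂ).im| := by
  have := ρ.im_sq_gt
  rw [← sq_abs (ρ : ℂ).im] at this
  exact lt_of_pow_lt_pow_left₀ 2 (abs_nonneg _) this

lemma XiZero.one_div_im_sq_le (ρ : XiZero) : 1 / (ρ : ℂ).im ^ 2 ≤ 1.0119 * xiPair 1 ρ := by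
  by_cases h : (ρ : ℂ).re = 1 / 2
  · have h1 := ρ.im_sq_gt
    rw [xiPair_one_of_on_line h, mul_one_div, div_le_div_iff₀ (by linarith) (by linarith)]
    norm_num at h1 ⊢
    linarith
  · have h1 := ρ.im_sq_gt_of_off_line h
    refine le_trans ?_ (mul_le_mul_of_nonneg_left (xiPair_ge le_rfl ρ) (by norm_num))
    rw [mul_div_assoc', div_le_div_iff₀ (by linarith) (by positivity)]
    norm_num at h1 ⊢
    linarith

lemma summable_xiMult_div_im_sq :
    Summable fun ρ : XiZero => xiMult ρ / (ρ : ℂ).im ^ 2 := by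
  refine Summable.of_nonneg_of_le (fun ρ => div_nonneg (xiMult_nonneg ρ) (sq_nonneg _)) (fun ρ => ?_)
    ((hasSum_xiPair (le_refl 1)).summable.mul_left 1.0119)
  have := mul_le_mul_of_nonneg_left ρ.one_div_im_sq_le (xiMult_nonneg ρ)
  rw [mul_one_div] at this
  linarith

/-- The sum of `1 / Im(ρ)^2` over the zeros of `ξ` is less than `0.0472`. -/
theorem tsum_xiMult_div_im_sq_le : ∑' ρ : XiZero, xiMult ρ / (ρ : ℂ).im ^ 2 ≤ 0.0472 := by
  have h := (hasSum_xiPair (le_refl 1)).mul_left 1.0119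
  have h2 := re_logDeriv_riemannXi_one_lt
  have := hasSum_le (fun ρ => ?_) summable_xiMult_div_im_sq.hasSum h
  · rw [Complex.ofReal_one] at this
    linarith
  · have := mul_le_mul_of_nonneg_left ρ.one_div_im_sq_le (xiMult_nonneg ρ)
    rw [mul_one_div] at this
    linarith

open ArithmeticFunction in
/-- The Dirichlet series of the real part of the logarithmic derivative of `1 / ζ` at `σ + i t`. -/
lemma hasSum_vonMangoldt_cos {σ : ℝ} (hσ : 1 < σ) (t : ℝ) :
    HasSum (fun n : ℕ => vonMangoldt n * (n : ℝ) ^ (-σ) * Real.cos (t * Real.log n))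
      (-(logDeriv riemannZeta ⟨σ, t⟩).re) := by
  have hs : 1 < (⟨σ, t⟩ : ℂ).re := hσ
  have h1 := LSeriesSummable_vonMangoldt hs
  have h2 := Complex.hasSum_re h1.hasSum
  have h3 := LSeries_vonMangoldt_eq_deriv_riemannZeta_div hs
  rw [LSeries] at h3
  rw [h3, neg_div, Complex.neg_re, ← logDeriv_apply] at h2
  refine h2.congr_fun fun n => ?_
  rcases eq_or_ne n 0 with rfl | hn
  · simp
  have hn' : (0 : ℝ) < n := by exact_mod_cast Nat.pos_of_ne_zero hn
  rw [LSeries.term_of_ne_zero hn, div_eq_mul_inv, ← Complex.cpow_neg, Complex.re_ofReal_mul,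
    mul_assoc]
  congr 1
  rw [Complex.cpow_def_of_ne_zero (by exact_mod_cast hn), ← Complex.natCast_log, Complex.exp_re,
    Real.rpow_def_of_pos hn']
  generalize Real.log n = l
  simp only [Complex.mul_re, Complex.mul_im, Complex.neg_re, Complex.neg_im, Complex.ofReal_re,
    Complex.ofReal_im, zero_mul, sub_zero, add_zero]
  rw [show l * -t = -(t * l) by ring, Real.cos_neg]

lemma re_logDeriv_riemannZeta_nonpos {σ : ℝ} (hσ : 1 < σ) :
    (logDeriv riemannZeta (σ : ℂ)).re ≤ 0 := by
  have h := hasSum_vonMangoldt_cos hσ 0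
  have h1 : (⟨σ, 0⟩ : ℂ) = σ := rfl
  rw [h1] at h
  have := h.nonneg fun n => by
    simp only [zero_mul, Real.cos_zero, mul_one]
    exact mul_nonneg ArithmeticFunction.vonMangoldt_nonneg (by positivity)
  linarith

lemma re_logDeriv_riemannXi_ofReal {σ : ℝ} (hσ : 1 < σ) :
    (logDeriv riemannXi (σ : ℂ)).re = 1 / σ + 1 / (σ - 1) +
      (Complex.digamma ((σ / 2 : ℝ) : ℂ)).re / 2 - Real.log Real.pi / 2 +
      (logDeriv riemannZeta (σ : ℂ)).re := by
  rw [logDeriv_riemannXi_eq (by simpa)]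
  have e1 : (1 / (σ : ℂ)) = ((1 / σ : ℝ) : ℂ) := by push_cast; rfl
  have e2 : (1 / ((σ : ℂ) - 1)) = ((1 / (σ - 1) : ℝ) : ℂ) := by push_cast; rfl
  have e3 : (σ : ℂ) / 2 = ((σ / 2 : ℝ) : ℂ) := by push_cast; rfl
  have e4 : (Real.log Real.pi : ℂ) / 2 = ((Real.log Real.pi / 2 : ℝ) : ℂ) := by push_cast; rfl
  rw [e1, e2, e3, e4]
  simp only [Complex.add_re, Complex.sub_re, Complex.ofReal_re]
  congr 3
  rw [show (2 : ℂ) = ((2 : ℝ) : ℂ) by norm_num, Complex.div_ofReal_re]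

lemma summable_xiMult_div_sq_add (σ : ℝ) :
    Summable fun ρ : XiZero => xiMult ρ / (σ ^ 2 + (ρ : ℂ).im ^ 2) := by
  refine Summable.of_nonneg_of_le (fun ρ => div_nonneg (xiMult_nonneg ρ) (by positivity))
    (fun ρ => ?_) summable_xiMult_div_im_sq
  have h := ρ.im_sq_gt
  have h2 := xiMult_nonneg ρ
  have h3 : (0 : ℝ) < (ρ : ℂ).im ^ 2 := by linarith
  gcongr
  nlinarith [sq_nonneg σ]

lemma log_fifteen_bounds : 2.7 < Real.log 15 ∧ Real.log 15 < 2.7102 := by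
  have h2 : Real.log 15 = 4 * Real.log 2 - Real.log (16 / 15) := by
    rw [← Real.log_rpow two_pos, ← Real.log_div (by norm_num) (by norm_num)]; norm_num
  have h3 := Real.log_le_sub_one_of_pos (by norm_num : (0:ℝ) < 16 / 15)
  have h4 : 1 - (16 / 15 : ℝ)⁻¹ ≤ Real.log (16 / 15) := Real.one_sub_inv_le_log_of_pos (by norm_num)
  have h5 := Real.log_two_gt_d9
  have h6 := Real.log_two_lt_d9
  norm_num at h3 h4 ⊢
  constructor <;> linarith

lemma tsum_xiMult_div_sq_add_le {σ : ℝ} (hσ : 15 ≤ σ) :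
    ∑' ρ : XiZero, xiMult ρ / (σ ^ 2 + (ρ : ℂ).im ^ 2) ≤ (0.5173 * Real.log σ - 0.8) / σ := by
  have h1 := hasSum_xiPair (σ := σ) (by linarith)
  have h2 := (summable_xiMult_div_sq_add σ).hasSum.mul_left (2 * σ - 1)
  have h3 := hasSum_le (fun ρ => ?_) h2 h1
  · rw [re_logDeriv_riemannXi_ofReal (by linarith)] at h3
    have h4 := re_logDeriv_riemannZeta_nonpos (σ := σ) (by linarith)
    have h5 := re_digamma_le_log (x := σ / 2) (by linarith)
    rw [Real.log_div (by linarith) two_ne_zero] at h5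
    have h6 := lt_log_four_mul_pi
    rw [show 4 * Real.pi = 2 * 2 * Real.pi by ring, Real.log_mul (by norm_num) Real.pi_ne_zero,
      Real.log_mul (by norm_num) (by norm_num)] at h6
    have h7 := Real.log_two_lt_d9
    have h8 : 1 / σ ≤ 1 / 15 := by gcongr
    have h9 : 1 / (σ - 1) ≤ 1 / 14 := one_div_le_one_div_of_le (by norm_num) (by linarith)
    have h10 : Real.log 15 ≤ Real.log σ := Real.log_le_log (by norm_num) hσ
    have h11 := log_fifteen_bounds.1
    rw [le_div_iff₀ (by linarith)]
    set H := ∑' ρ : XiZero, xiMult ρ / (σ ^ 2 + (ρ : ℂ).im ^ 2)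
    have h12 : (2 * σ - 1) * H ≤ Real.log σ - 1.56 := by linarith
    have h13 : (2 * σ - 1) * (H * σ) ≤ (2 * σ - 1) * (0.5173 * Real.log σ - 0.8) := by
      nlinarith [mul_le_mul_of_nonneg_right h12 (by linarith : (0:ℝ) ≤ σ),
        mul_nonneg (by linarith : 0 ≤ σ - 15) (by linarith : 0 ≤ Real.log σ - 2.7)]
    exact le_of_mul_le_mul_left h13 (by linarith)
  · have := mul_le_mul_of_nonneg_left (xiPair_ge (by linarith : 1 ≤ σ) ρ) (xiMult_nonneg ρ)
    convert this using 1
    ring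

lemma hasDerivAt_log_one_add_div {g Y : ℝ} (hg : g ≠ 0) (hY : 0 < Y) (m : ℝ) :
    HasDerivAt (fun Y => m / g ^ 2 * (Real.log (1 + g ^ 2 / Y ^ 2) / 2))
      (-(m / (Y ^ 2 + g ^ 2)) / Y) Y := by
  have h1 : HasDerivAt (fun Y : ℝ => 1 + g ^ 2 / Y ^ 2) (-(2 * g ^ 2 / Y ^ 3)) Y := by
    have := ((hasDerivAt_const Y (g ^ 2)).div ((hasDerivAt_id Y).pow 2)
      (by simp; positivity)).const_add 1
    refine this.congr_deriv ?_
    simp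
    field_simp
  refine (((h1.log (by positivity)).div_const 2).const_mul (m / g ^ 2)).congr_deriv ?_
  field_simp

lemma sum_xiMult_log_le (F : Finset XiZero) :
    ∑ ρ ∈ F, xiMult ρ / (ρ : ℂ).im ^ 2 * (Real.log (1 + (ρ : ℂ).im ^ 2 / 15 ^ 2) / 2) ≤
      (0.5173 * Real.log 15 - 0.2827) / 15 := by
  set Φ : ℝ → ℝ := fun Y =>
    ∑ ρ ∈ F, xiMult ρ / (ρ : ℂ).im ^ 2 * (Real.log (1 + (ρ : ℂ).im ^ 2 / Y ^ 2) / 2) with hΦ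
  set J : ℝ → ℝ := fun Y => (0.5173 * Real.log Y - 0.2827) / Y with hJ
  have hd : ∀ Y : ℝ, 0 < Y → HasDerivAt (fun Y => J Y - Φ Y)
      (-((0.5173 * Real.log Y - 0.8) / Y) / Y +
        (∑ ρ ∈ F, xiMult ρ / (Y ^ 2 + (ρ : ℂ).im ^ 2)) / Y) Y := by
    intro Y hY
    have h1 : HasDerivAt J (-((0.5173 * Real.log Y - 0.8) / Y) / Y) Y := by
      refine ((((Real.hasDerivAt_log hY.ne').const_mul 0.5173).sub_const 0.2827).div
        (hasDerivAt_id Y) hY.ne').congr_deriv ?_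
      simp
      field_simp
      ring
    have h2 : HasDerivAt Φ (∑ ρ ∈ F, -(xiMult ρ / (Y ^ 2 + (ρ : ℂ).im ^ 2)) / Y) Y :=
      HasDerivAt.fun_sum fun ρ _ => hasDerivAt_log_one_add_div ρ.im_ne_zero hY _
    refine (h1.sub h2).congr_deriv ?_
    rw [← sum_div, sum_neg_distrib]
    ring
  have hanti : AntitoneOn (fun Y => J Y - Φ Y) (Set.Ici 15) := by
    refine antitoneOn_of_deriv_nonpos (convex_Ici 15)
      (fun Y hY => (hd Y (by have : (15:ℝ) ≤ Y := hY; linarith)).continuousAt.continuousWithinAt)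
      (fun Y hY => ?_) (fun Y hY => ?_)
    · rw [interior_Ici] at hY
      exact (hd Y (by have : (15:ℝ) < Y := hY; linarith)).differentiableAt.differentiableWithinAt
    · rw [interior_Ici] at hY
      have hY' : (15 : ℝ) < Y := hY
      rw [(hd Y (by linarith)).deriv, ← add_div]
      refine div_nonpos_of_nonpos_of_nonneg ?_ (by linarith)
      have h1 := tsum_xiMult_div_sq_add_le hY'.le
      have h2 := (summable_xiMult_div_sq_add Y).sum_le_tsum F
        (fun ρ _ => div_nonneg (xiMult_nonneg ρ) (by positivity))
      linarith
  have hlim : Tendsto (fun Y => J Y - Φ Y) atTop (nhds 0) := by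
    have h1 : Tendsto J atTop (nhds 0) := by
      have a := (Real.tendsto_pow_log_div_mul_add_atTop 1 0 1 one_ne_zero).const_mul 0.5173
      have b := (tendsto_inv_atTop_zero (𝕜 := ℝ)).const_mul 0.2827
      have := a.sub b
      simp only [mul_zero, sub_zero] at this
      refine this.congr fun Y => ?_
      simp [hJ]
      ring
    have h2 : Tendsto Φ atTop (nhds 0) := by
      rw [show (0 : ℝ) = ∑ ρ ∈ F, xiMult ρ / (ρ : ℂ).im ^ 2 * (Real.log (1 + 0) / 2) by simp]
      refine tendsto_finsetSum _ fun ρ _ => ?_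
      refine (((tendsto_const_nhds.add (tendsto_const_nhds.div_atTop
        (tendsto_pow_atTop two_ne_zero))).log (by norm_num)).div_const 2).const_mul _
    simpa using h1.sub h2
  have : 0 ≤ J 15 - Φ 15 := by
    refine le_of_tendsto hlim ?_
    filter_upwards [eventually_ge_atTop 15] with Y hY
    exact hanti (Set.mem_Ici.2 le_rfl) hY hY
  exact sub_nonneg.1 this

/-- The quantity whose reciprocal controls the width of the zero-free region at height `Im ρ`. -/
noncomputable def zeroHeight (ρ : XiZero) : ℝ := 2.5 * Real.log (ρ : ℂ).im - 3.85

lemma XiZero.log_im (ρ : XiZero) : Real.log (ρ : ℂ).im = Real.log ((ρ : ℂ).im ^ 2) / 2 := by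
  rw [Real.log_pow]; push_cast; ring

lemma zeroHeight_ge (ρ : XiZero) : 0.8 ≤ zeroHeight ρ := by
  rw [zeroHeight, ← Real.log_abs]
  have h1 : Real.log 6.5 ≤ Real.log |(ρ : ℂ).im| := Real.log_le_log (by norm_num) ρ.abs_im_gt.le
  have h2 : Real.log 6.5 = 3 * Real.log 2 - Real.log (8 / 6.5) := by
    rw [← Real.log_rpow two_pos, ← Real.log_div (by norm_num) (by norm_num)]; norm_num
  have h3 : Real.log (8 / 6.5) ≤ 0.21 := by
    rw [Real.log_le_iff_le_exp (by norm_num)]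
    refine le_trans ?_ (Real.sum_le_exp_of_nonneg (by norm_num) 4)
    norm_num [Finset.sum_range_succ, Nat.factorial]
  have h5 := Real.log_two_gt_d9
  linarith

lemma summable_and_tsum_zeroHeight_le :
    Summable (fun ρ : XiZero => xiMult ρ / (ρ : ℂ).im ^ 2 * zeroHeight ρ) ∧
    ∑' ρ : XiZero, xiMult ρ / (ρ : ℂ).im ^ 2 * zeroHeight ρ ≤ 0.33 := by
  have hF : ∀ F : Finset XiZero,
      ∑ ρ ∈ F, xiMult ρ / (ρ : ℂ).im ^ 2 * zeroHeight ρ ≤ 0.33 := by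
    intro F
    have h1 := sum_xiMult_log_le F
    have h2 : ∑ ρ ∈ F, xiMult ρ / (ρ : ℂ).im ^ 2 ≤ 0.0472 :=
      (summable_xiMult_div_im_sq.sum_le_tsum F fun ρ _ =>
        div_nonneg (xiMult_nonneg ρ) (sq_nonneg _)).trans tsum_xiMult_div_im_sq_le
    obtain ⟨hl, hu⟩ := log_fifteen_bounds
    have h3 : ∑ ρ ∈ F, xiMult ρ / (ρ : ℂ).im ^ 2 * zeroHeight ρ ≤
        ∑ ρ ∈ F, ((2.5 * Real.log 15 - 3.85) * (xiMult ρ / (ρ : ℂ).im ^ 2) + 2.5 *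
          (xiMult ρ / (ρ : ℂ).im ^ 2 * (Real.log (1 + (ρ : ℂ).im ^ 2 / 15 ^ 2) / 2))) := by
      refine sum_le_sum fun ρ _ => ?_
      have h4 : Real.log (ρ : ℂ).im ≤
          Real.log 15 + Real.log (1 + (ρ : ℂ).im ^ 2 / 15 ^ 2) / 2 := by
        have h5 : Real.log (15 ^ 2 * (1 + (ρ : ℂ).im ^ 2 / 15 ^ 2)) =
            2 * Real.log 15 + Real.log (1 + (ρ : ℂ).im ^ 2 / 15 ^ 2) := by
          rw [Real.log_mul (by norm_num) (by positivity), Real.log_pow]; push_cast; ring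
        have h6 : Real.log ((ρ : ℂ).im ^ 2) ≤ Real.log (15 ^ 2 * (1 + (ρ : ℂ).im ^ 2 / 15 ^ 2)) := by
          refine Real.log_le_log (by have := ρ.im_sq_gt; linarith) ?_
          field_simp
          norm_num
        rw [ρ.log_im]
        linarith
      have h5 : 0 ≤ xiMult ρ / (ρ : ℂ).im ^ 2 := div_nonneg (xiMult_nonneg ρ) (sq_nonneg _)
      rw [zeroHeight]
      nlinarith [mul_le_mul_of_nonneg_left h4 h5]
    rw [sum_add_distrib, ← mul_sum, ← mul_sum] at h3
    nlinarith
  have hnn : ∀ ρ : XiZero, 0 ≤ xiMult ρ / (ρ : ℂ).im ^ 2 * zeroHeight ρ := fun ρ =>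
    mul_nonneg (div_nonneg (xiMult_nonneg ρ) (sq_nonneg _)) (by linarith [zeroHeight_ge ρ])
  exact ⟨summable_of_sum_le hnn hF, Real.tsum_le_of_sum_le hnn hF⟩

lemma three_four_one {σ : ℝ} (hσ : 1 < σ) (t : ℝ) :
    0 ≤ 3 * -(logDeriv riemannZeta (σ : ℂ)).re + 4 * -(logDeriv riemannZeta ⟨σ, t⟩).re +
      -(logDeriv riemannZeta ⟨σ, 2 * t⟩).re := by
  have h0 := hasSum_vonMangoldt_cos hσ 0
  have h1 : (⟨σ, 0⟩ : ℂ) = σ := rfl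
  rw [h1] at h0
  have h := ((h0.mul_left 3).add ((hasSum_vonMangoldt_cos hσ t).mul_left 4)).add
    (hasSum_vonMangoldt_cos hσ (2 * t))
  refine h.nonneg fun n => ?_
  have hc : Real.cos (2 * t * Real.log n) = 2 * Real.cos (t * Real.log n) ^ 2 - 1 := by
    rw [mul_assoc, Real.cos_two_mul]
  have ha : 0 ≤ ArithmeticFunction.vonMangoldt n * (n : ℝ) ^ (-σ) :=
    mul_nonneg ArithmeticFunction.vonMangoldt_nonneg (by positivity)
  simp only [zero_mul, Real.cos_zero, mul_one, hc]
  nlinarith [mul_nonneg ha (sq_nonneg (1 + Real.cos (t * Real.log n)))]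

lemma neg_re_logDeriv_riemannZeta_le {σ : ℝ} (hσ : 1 < σ) (hσ2 : σ ≤ 2) :
    -(logDeriv riemannZeta (σ : ℂ)).re ≤ 1 / (σ - 1) := by
  have h := re_logDeriv_riemannXi_ofReal hσ
  have h1 : 0 ≤ (logDeriv riemannXi (σ : ℂ)).re :=
    (hasSum_re_logDeriv_riemannXi (s := σ) (by simpa using hσ.le)).nonneg fun ρ =>
      mul_nonneg (xiMult_nonneg ρ) (by
        rw [re_one_div_sub]
        have := ρ.re_lt_one
        exact div_nonneg (by linarith) (by positivity))
  have h2 : Complex.digamma (((σ / 2 + 1 : ℝ)) : ℂ) = Complex.digamma ((σ / 2 : ℝ) : ℂ) +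
      1 / ((σ / 2 : ℝ) : ℂ) := by
    have := digamma_add_natCast (z := ((σ / 2 : ℝ) : ℂ)) (by rw [Complex.ofReal_re]; linarith) 1
    simpa using this
  have h3 := congrArg Complex.re h2
  rw [Complex.add_re, ← Complex.ofReal_one, ← Complex.ofReal_div, Complex.ofReal_re] at h3
  have h4 := re_digamma_le_log (x := σ / 2 + 1) (by linarith)
  have h5 : Real.log (σ / 2 + 1) ≤ Real.log Real.pi :=
    Real.log_le_log (by linarith) (by linarith [Real.pi_gt_three])
  have h6 : 1 / (σ / 2) = 2 * (1 / σ) := by field_simp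
  linarith

/-- Upper bound for `-Re ζ'/ζ` up to the contribution of the zeros. -/
noncomputable def zetaGrowth (σ t : ℝ) : ℝ :=
  (2 * σ - 1 + σ ^ 2 / 4) / t ^ 2 + Real.log t / 2 - Real.log (2 * Real.pi) / 2 + 1 / (2 * t)

lemma neg_re_logDeriv_riemannZeta_le_growth {σ t : ℝ} (hσ : 1 < σ) (ht : 0 < t) :
    -(logDeriv riemannZeta ⟨σ, t⟩).re ≤ zetaGrowth σ t - (logDeriv riemannXi ⟨σ, t⟩).re := by
  have h := congrArg Complex.re (logDeriv_riemannXi_eq (s := ⟨σ, t⟩) hσ)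
  have e3 : (⟨σ, t⟩ : ℂ) / 2 = ⟨σ / 2, t / 2⟩ := by
    apply Complex.ext <;> simp
  have e4 : (Real.log Real.pi : ℂ) / 2 = ((Real.log Real.pi / 2 : ℝ) : ℂ) := by push_cast; rfl
  rw [e3, e4, show (2 : ℂ) = ((2 : ℝ) : ℂ) by norm_num] at h
  simp only [Complex.add_re, Complex.sub_re, Complex.ofReal_re, Complex.div_ofReal_re] at h
  have h1 : (1 / (⟨σ, t⟩ : ℂ)).re ≤ σ / t ^ 2 := by
    rw [one_div, Complex.inv_re, Complex.normSq_mk]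
    gcongr
    nlinarith
  have h2 : (1 / ((⟨σ, t⟩ : ℂ) - 1)).re ≤ (σ - 1) / t ^ 2 := by
    rw [one_div, Complex.inv_re, Complex.normSq_apply]
    simp only [Complex.sub_re, Complex.sub_im, Complex.one_re, Complex.one_im, sub_zero]
    have : 0 < σ - 1 := by linarith
    gcongr
    nlinarith
  have h3 := re_digamma_le (a := σ / 2) (b := t / 2) (by linarith) (by linarith)
  have h4 : Real.log ((σ / 2) ^ 2 + (t / 2) ^ 2) ≤ 2 * Real.log t + σ ^ 2 / t ^ 2 - 2 * Real.log 2 := by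
    have : (σ / 2) ^ 2 + (t / 2) ^ 2 = t ^ 2 / 2 ^ 2 * (1 + σ ^ 2 / t ^ 2) := by field_simp; ring
    rw [this, Real.log_mul (by positivity) (by positivity), Real.log_div (by positivity) (by norm_num),
      Real.log_pow, Real.log_pow]
    have := Real.log_le_sub_one_of_pos (by positivity : 0 < 1 + σ ^ 2 / t ^ 2)
    push_cast
    linarith
  rw [zetaGrowth, Real.log_mul two_ne_zero Real.pi_ne_zero]
  have e : 1 / (2 * (t / 2)) = 2 * (1 / (2 * t)) := by field_simp
  rw [e] at h3
  have e5 : (2 * σ - 1 + σ ^ 2 / 4) / t ^ 2 = σ / t ^ 2 + (σ - 1) / t ^ 2 + σ ^ 2 / t ^ 2 / 4 := by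
    ring
  rw [e5]
  linarith

lemma zetaGrowth_comb_le {σ t : ℝ} (hσ : 1 < σ) (hσ2 : σ ≤ 1.282) (ht : 9.2 ≤ t) :
    4 * zetaGrowth σ t + zetaGrowth σ (2 * t) ≤ 2.5 * Real.log t - 3.85 := by
  unfold zetaGrowth
  rw [Real.log_mul two_ne_zero Real.pi_ne_zero, Real.log_mul two_ne_zero (by linarith)]
  have h6 := lt_log_four_mul_pi
  rw [show 4 * Real.pi = 2 * 2 * Real.pi by ring, Real.log_mul (by norm_num) Real.pi_ne_zero,
    Real.log_mul (by norm_num) (by norm_num)] at h6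
  have h7 := Real.log_two_lt_d9
  have h8 : 1 / (2 * t) ≤ 1 / (2 * 9.2) := by gcongr
  have h9 : 1 / (2 * (2 * t)) ≤ 1 / (2 * (2 * 9.2)) := by gcongr
  have hn : 2 * σ - 1 + σ ^ 2 / 4 ≤ 1.976 := by nlinarith
  have h10 : (2 * σ - 1 + σ ^ 2 / 4) / t ^ 2 ≤ 1.976 / 9.2 ^ 2 := by gcongr
  have h11 : (2 * σ - 1 + σ ^ 2 / 4) / (2 * t) ^ 2 ≤ 1.976 / (2 * 9.2) ^ 2 := by gcongr
  norm_num at h8 h9 h10 h11 ⊢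
  linarith

lemma zeroFree_of_large_im (ρ : XiZero) (ht : 9.2 < (ρ : ℂ).im) :
    0.0717 ≤ zeroHeight ρ * (1 - (ρ : ℂ).re) := by
  set t := (ρ : ℂ).im with htdef
  set A := zeroHeight ρ with hA
  have hA1 : 1.65 ≤ A := by
    rw [hA, zeroHeight, ← htdef]
    have h1 : Real.log 9.2 ≤ Real.log t := Real.log_le_log (by norm_num) ht.le
    have h2 : Real.log 9.2 = 3 * Real.log 2 + Real.log 1.15 := by
      rw [← Real.log_rpow two_pos, ← Real.log_mul (by norm_num) (by norm_num)]; norm_num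
    have h3 : 1 - (1.15 : ℝ)⁻¹ ≤ Real.log 1.15 := Real.one_sub_inv_le_log_of_pos (by norm_num)
    have h5 := Real.log_two_gt_d9
    norm_num at h3
    linarith
  set δ := 0.464 / A with hδ
  have hA0 : 0 < A := by linarith
  have hδ0 : 0 < δ := by positivity
  have hδ1 : δ ≤ 0.282 := by rw [hδ, div_le_iff₀ hA0]; linarith
  have hη : 0 < 1 - (ρ : ℂ).re := by linarith [ρ.re_lt_one]
  have h341 := three_four_one (σ := 1 + δ) (by linarith) t
  have h1 := neg_re_logDeriv_riemannZeta_le (σ := 1 + δ) (by linarith) (by linarith)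
  have h2 := neg_re_logDeriv_riemannZeta_le_growth (σ := 1 + δ) (t := t) (by linarith) (by linarith)
  have h3 := neg_re_logDeriv_riemannZeta_le_growth (σ := 1 + δ) (t := 2 * t) (by linarith)
    (by linarith)
  have hpos : ∀ (u : ℝ) (τ : XiZero), 0 ≤ xiMult τ * (1 / ((⟨1 + δ, u⟩ : ℂ) - τ)).re := by
    intro u τ
    refine mul_nonneg (xiMult_nonneg τ) ?_
    rw [one_div, Complex.inv_re]
    refine div_nonneg ?_ (Complex.normSq_nonneg _)
    simp only [Complex.sub_re]
    linarith [τ.re_lt_one]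
  have h4 : 0 ≤ (logDeriv riemannXi ⟨1 + δ, 2 * t⟩).re :=
    (hasSum_re_logDeriv_riemannXi (s := ⟨1 + δ, 2 * t⟩) (by simpa using hδ0.le)).nonneg (hpos _)
  have h5 : 1 / (δ + (1 - (ρ : ℂ).re)) ≤ (logDeriv riemannXi ⟨1 + δ, t⟩).re := by
    have h := sum_le_hasSum {ρ} (fun τ _ => hpos t τ)
      (hasSum_re_logDeriv_riemannXi (s := ⟨1 + δ, t⟩) (by simpa using hδ0.le))
    rw [sum_singleton] at h
    refine le_trans ?_ h
    have e : (⟨1 + δ, t⟩ : ℂ) - ρ = ((δ + (1 - (ρ : ℂ).re) : ℝ) : ℂ) := by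
      apply Complex.ext
      · simp; ring
      · simp [htdef]
    rw [e, ← Complex.ofReal_one, ← Complex.ofReal_div, Complex.ofReal_re]
    exact le_mul_of_one_le_left (by positivity) (one_le_xiMult ρ)
  have h6 := zetaGrowth_comb_le (σ := 1 + δ) (by linarith) (by norm_num at hδ1 ⊢; linarith) ht.le
  have h7 : 2.5 * Real.log t - 3.85 = A := by rw [hA, zeroHeight]
  rw [h7] at h6
  rw [add_sub_cancel_left] at h1
  set η := 1 - (ρ : ℂ).re
  have h8 : 4 * (1 / (δ + η)) ≤ 3 * (1 / δ) + A := by linarith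
  have h9 : 1 / δ = A / 0.464 := by rw [hδ]; field_simp
  have h10 : A * δ = 0.464 := by rw [hδ]; field_simp
  rw [h9, mul_one_div, div_le_iff₀ (by positivity)] at h8
  norm_num at h8 h10 ⊢
  nlinarith

/-- The classical zero-free region with explicit constants. -/
theorem zeroFree (ρ : XiZero) : 0.0717 ≤ zeroHeight ρ * (1 - (ρ : ℂ).re) := by
  by_cases h : (ρ : ℂ).re = 1 / 2
  · have := zeroHeight_ge ρ
    rw [h]
    norm_num at this ⊢
    linarith
  · have h1 := ρ.im_sq_gt_of_off_line h
    rcases lt_or_ge 0 (ρ : ℂ).im with h2 | h2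
    · exact zeroFree_of_large_im ρ (lt_of_pow_lt_pow_left₀ 2 h2.le h1)
    · have h3 : 9.2 < (ρ.conj : ℂ).im := by
        rw [XiZero.conj_im]
        refine lt_of_pow_lt_pow_left₀ 2 (by linarith) ?_
        rwa [neg_sq]
      have := zeroFree_of_large_im ρ.conj h3
      rw [zeroHeight, XiZero.conj_im, Real.log_neg_eq_log, XiZero.conj_re] at this
      exact this

lemma zeroHeight_reflect (ρ : XiZero) : zeroHeight (XiZero.reflect ρ) = zeroHeight ρ := by
  simp only [zeroHeight, XiZero.reflect_apply, Complex.sub_im, Complex.one_im, zero_sub,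
    Real.log_neg_eq_log]

theorem zeroFree' (ρ : XiZero) : 0.0717 ≤ zeroHeight ρ * (ρ : ℂ).re := by
  have h := zeroFree (XiZero.reflect ρ)
  rw [zeroHeight_reflect] at h
  simpa using h

/-- The sum over the zeros majorizing the error term of the explicit formula. -/
noncomputable def zeroSum (t : ℝ) : ℝ :=
  ∑' ρ : XiZero, xiMult ρ / (ρ : ℂ).im ^ 2 * t ^ ((ρ : ℂ).re - 1)

lemma xiWeight_nonneg (ρ : XiZero) : 0 ≤ xiMult ρ / (ρ : ℂ).im ^ 2 :=
  div_nonneg (xiMult_nonneg ρ) (sq_nonneg _)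

lemma summable_zeroSum {t : ℝ} (ht : 1 ≤ t) :
    Summable fun ρ : XiZero => xiMult ρ / (ρ : ℂ).im ^ 2 * t ^ ((ρ : ℂ).re - 1) := by
  refine Summable.of_nonneg_of_le (fun ρ => mul_nonneg (xiWeight_nonneg ρ) (by positivity))
    (fun ρ => ?_) summable_xiMult_div_im_sq
  exact mul_le_of_le_one_right (xiWeight_nonneg ρ)
    (Real.rpow_le_one_of_one_le_of_nonpos ht (by linarith [ρ.re_lt_one]))

lemma hasSum_zeroSum_symm {t : ℝ} (ht : 1 ≤ t) :
    HasSum (fun ρ : XiZero => xiMult ρ / (ρ : ℂ).im ^ 2 *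
      ((t ^ ((ρ : ℂ).re - 1) + t ^ (-(ρ : ℂ).re)) / 2)) (zeroSum t) := by
  have h1 := (summable_zeroSum ht).hasSum
  have h2 := (Equiv.hasSum_iff XiZero.reflect).2 h1
  have h3 := (h1.add h2).div_const 2
  rw [zeroSum]
  have e : ∀ x : ℝ, (x + x) / 2 = x := fun x => by ring
  rw [e] at h3
  refine h3.congr_fun fun ρ => ?_
  simp only [Function.comp, xiMult_reflect]
  simp only [XiZero.reflect_apply, Complex.sub_re, Complex.sub_im, Complex.one_re, Complex.one_im,
    zero_sub, neg_sq]
  rw [show 1 - (ρ : ℂ).re - 1 = -(ρ : ℂ).re by ring]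
  ring

lemma zeroSum_le {t : ℝ} (ht : 1 ≤ t) : zeroSum t ≤ 0.0236 * (1 + 1 / t) := by
  have h := hasSum_le (fun ρ => ?_) (hasSum_zeroSum_symm ht)
    (summable_xiMult_div_im_sq.hasSum.mul_right ((1 + 1 / t) / 2))
  · refine h.trans ?_
    have := tsum_xiMult_div_im_sq_le
    have h0 : 0 ≤ (1 + 1 / t) / 2 := by positivity
    nlinarith
  · refine mul_le_mul_of_nonneg_left ?_ (xiWeight_nonneg ρ)
    have h1 : t ^ ((ρ : ℂ).re - 1) ≤ 1 :=
      Real.rpow_le_one_of_one_le_of_nonpos ht (by linarith [ρ.re_lt_one])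
    have h2 : t ^ (-(ρ : ℂ).re) ≤ 1 :=
      Real.rpow_le_one_of_one_le_of_nonpos ht (by linarith [ρ.re_pos])
    have h3 : t ^ ((ρ : ℂ).re - 1) * t ^ (-(ρ : ℂ).re) = 1 / t := by
      rw [← Real.rpow_add (by linarith), show (ρ : ℂ).re - 1 + -(ρ : ℂ).re = -1 by ring,
        Real.rpow_neg_one, one_div]
    nlinarith [mul_nonneg (sub_nonneg.2 h1) (sub_nonneg.2 h2)]

lemma zeroSum_nonneg (t : ℝ) (ht : 0 ≤ t) : 0 ≤ zeroSum t :=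
  tsum_nonneg fun ρ => mul_nonneg (xiWeight_nonneg ρ) (by positivity)

lemma log_mul_rpow_neg_le {t η : ℝ} (ht : 1 ≤ t) (hη : 0 < η) :
    Real.log t * t ^ (-η) ≤ 1 / (2.718 * η) := by
  have h1 := Real.add_one_le_exp (Real.log t * η - 1)
  rw [sub_add_cancel, Real.exp_sub] at h1
  rw [Real.rpow_def_of_pos (by linarith), mul_neg, Real.exp_neg, ← div_eq_mul_inv,
    div_le_div_iff₀ (Real.exp_pos _) (by positivity)]
  have h2 := Real.exp_one_gt_d9
  rw [le_div_iff₀ (Real.exp_pos _)] at h1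
  have h3 := Real.log_nonneg ht
  have h4 : Real.log t * η * 2.718 ≤ Real.log t * η * Real.exp 1 := by
    gcongr; linarith
  linarith

lemma log_mul_zeroSum_le {t : ℝ} (ht : 1 ≤ t) : Real.log t * zeroSum t ≤ 0.87 := by
  obtain ⟨hs, hle⟩ := summable_and_tsum_zeroHeight_le
  have h := hasSum_le (fun ρ => ?_) ((hasSum_zeroSum_symm ht).mul_left (Real.log t))
    ((hs.hasSum.mul_left (1 / (2 * 0.0717 * 2.718))).add
      (summable_xiMult_div_im_sq.hasSum.mul_left (1 / 2.718)))
  · refine h.trans ?_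
    have := tsum_xiMult_div_im_sq_le
    norm_num at this hle ⊢
    linarith
  · have hA := zeroHeight_ge ρ
    have key : ∀ η : ℝ, 0 < η → 0.0717 ≤ zeroHeight ρ * η →
        Real.log t * t ^ (-η) ≤ zeroHeight ρ / (0.0717 * 2.718) := by
      intro η hη h1
      refine (log_mul_rpow_neg_le ht hη).trans ?_
      rw [div_le_div_iff₀ (by positivity) (by norm_num)]
      norm_num at h1 ⊢
      linarith
    have key2 : ∀ η : ℝ, 1 / 2 ≤ η → Real.log t * t ^ (-η) ≤ 2 / 2.718 := by
      intro η hη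
      refine (log_mul_rpow_neg_le ht (by linarith)).trans ?_
      rw [div_le_div_iff₀ (by positivity) (by norm_num)]
      norm_num
      linarith
    have h1 : Real.log t * (t ^ ((ρ : ℂ).re - 1) + t ^ (-(ρ : ℂ).re)) ≤
        zeroHeight ρ / (0.0717 * 2.718) + 2 / 2.718 := by
      rw [mul_add, show (ρ : ℂ).re - 1 = -(1 - (ρ : ℂ).re) by ring]
      rcases le_total (1 / 2) (ρ : ℂ).re with hβ | hβ
      · exact add_le_add (key _ (by linarith [ρ.re_lt_one]) (zeroFree ρ)) (key2 _ hβ)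
      · rw [add_comm]
        exact add_le_add (key _ ρ.re_pos (zeroFree' ρ)) (key2 _ (by linarith))
    have := mul_le_mul_of_nonneg_left h1 (xiWeight_nonneg ρ)
    have e : zeroHeight ρ / (0.0717 * 2.718) + 2 / 2.718 =
      2 * (1 / (2 * 0.0717 * 2.718) * zeroHeight ρ + 1 / 2.718) := by ring
    rw [e] at this
    nlinarith

instance countable_xiZero : Countable XiZero := by
  have h := summable_xiMult_div_im_sq.countable_support
  have e : Function.support (fun ρ : XiZero => xiMult ρ / (ρ : ℂ).im ^ 2) = Set.univ := by
    ext ρ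
    simp only [Function.mem_support, Set.mem_univ, iff_true]
    have := one_le_xiMult ρ
    have := ρ.im_sq_gt
    exact div_ne_zero (by linarith) (by linarith)
  rw [e] at h
  exact Set.countable_univ_iff.1 h

lemma hasSum_moments {ι : Type*} [Countable ι] {F : ι → ℝ → ℝ} {M c : ι → ℝ} (k : ℕ)
    (hc : ∀ i, ContinuousOn (F i) (Set.Icc 0 1)) (hM : ∀ i, ∀ u ∈ Set.Icc (0:ℝ) 1, |F i u| ≤ M i)
    (hs : Summable M) (hmom : ∀ i, ∫ u in (0:ℝ)..1, u ^ k * F i u = c i) :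
    HasSum c (∫ u in (0:ℝ)..1, u ^ k * ∑' i, F i u) := by
  have hsub : Set.uIoc (0:ℝ) 1 ⊆ Set.Icc 0 1 := by
    rw [Set.uIoc_of_le zero_le_one]; exact Set.Ioc_subset_Icc_self
  have h := intervalIntegral.hasSum_integral_of_dominated_convergence (μ := MeasureTheory.volume)
    (a := 0) (b := 1) (F := fun i u => u ^ k * F i u) (f := fun u => u ^ k * ∑' i, F i u)
    (fun i _ => M i) ?_ ?_ ?_ ?_ ?_
  · simpa only [hmom] using h
  · intro i
    have : ContinuousOn (fun u : ℝ => u ^ k * F i u) (Set.uIoc 0 1) :=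
      ((continuous_pow k).continuousOn.mul (hc i)).mono hsub
    exact this.aestronglyMeasurable measurableSet_uIoc
  · refine fun i => Eventually.of_forall fun u hu => ?_
    have hu' := hsub hu
    rw [norm_mul, Real.norm_eq_abs, Real.norm_eq_abs, abs_of_nonneg (pow_nonneg hu'.1 k)]
    have h1 : u ^ k ≤ 1 := pow_le_one₀ hu'.1 hu'.2
    have h2 := hM i u hu'
    have h3 : 0 ≤ u ^ k := pow_nonneg hu'.1 k
    nlinarith [abs_nonneg (F i u)]
  · exact Eventually.of_forall fun _ _ => hs
  · exact intervalIntegrable_const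
  · refine Eventually.of_forall fun u hu => ?_
    have hsm : Summable fun i => F i u :=
      Summable.of_norm_bounded (g := M) hs fun i => hM i u (hsub hu)
    exact hsm.hasSum.mul_left (u ^ k)

lemma continuousOn_tsum_of_bound {ι : Type*} {F : ι → ℝ → ℝ} {M : ι → ℝ}
    (hc : ∀ i, ContinuousOn (F i) (Set.Icc 0 1)) (hM : ∀ i, ∀ u ∈ Set.Icc (0:ℝ) 1, |F i u| ≤ M i)
    (hs : Summable M) : ContinuousOn (fun u => ∑' i, F i u) (Set.Icc 0 1) :=
  continuousOn_tsum hc hs hM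

/-- A continuous function on `[0, 1]` all of whose moments vanish is zero. -/
theorem eqOn_zero_of_moments {f : ℝ → ℝ} (hf : ContinuousOn f (Set.Icc 0 1))
    (h : ∀ k : ℕ, ∫ u in (0:ℝ)..1, u ^ k * f u = 0) : ∀ u ∈ Set.Icc (0:ℝ) 1, f u = 0 := by
  have hu : Set.uIcc (0:ℝ) 1 = Set.Icc 0 1 := Set.uIcc_of_le zero_le_one
  have hII : ∀ g : ℝ → ℝ, ContinuousOn g (Set.Icc 0 1) →
      IntervalIntegrable g MeasureTheory.volume 0 1 := fun g hg =>
    ContinuousOn.intervalIntegrable (by rwa [hu])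
  have hp : ∀ p : Polynomial ℝ, ∫ u in (0:ℝ)..1, p.eval u * f u = 0 := by
    intro p
    have e : ∀ u : ℝ, p.eval u * f u = ∑ k ∈ range (p.natDegree + 1), p.coeff k * (u ^ k * f u) := by
      intro u
      rw [Polynomial.eval_eq_sum_range, sum_mul]
      exact sum_congr rfl fun k _ => by ring
    simp only [e]
    rw [intervalIntegral.integral_finsetSum]
    · refine sum_eq_zero fun k _ => ?_
      rw [intervalIntegral.integral_const_mul, h, mul_zero]
    · exact fun k _ => (hII _ ((continuous_pow k).continuousOn.mul hf)).const_mul _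
  have hsq : ∫ u in (0:ℝ)..1, f u * f u = 0 := by
    have hnn : 0 ≤ ∫ u in (0:ℝ)..1, f u * f u :=
      intervalIntegral.integral_nonneg zero_le_one fun u _ => mul_self_nonneg _
    obtain ⟨C, hC⟩ := (isCompact_Icc (a := (0:ℝ)) (b := 1)).exists_bound_of_continuousOn hf
    have hC0 : 0 ≤ C := (norm_nonneg _).trans (hC 0 ⟨le_rfl, zero_le_one⟩)
    refine le_antisymm (le_of_forall_pos_le_add fun ε hε => ?_) hnn
    obtain ⟨p, hpn⟩ := exists_polynomial_near_of_continuousOn 0 1 f hf (ε / (C + 1)) (by positivity)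
    have e : ∫ u in (0:ℝ)..1, f u * f u = ∫ u in (0:ℝ)..1, (f u * f u - p.eval u * f u) := by
      have h1 : IntervalIntegrable (fun u => f u * f u) MeasureTheory.volume 0 1 :=
        hII _ (hf.mul hf)
      have h2 : IntervalIntegrable (fun u => p.eval u * f u) MeasureTheory.volume 0 1 :=
        hII _ (p.continuous.continuousOn.mul hf)
      rw [intervalIntegral.integral_sub h1 h2, hp, sub_zero]
    rw [e, zero_add]
    have : ∫ u in (0:ℝ)..1, (f u * f u - p.eval u * f u) ≤ ∫ u in (0:ℝ)..1, ε := by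
      refine intervalIntegral.integral_mono_on zero_le_one
        (hII _ ((hf.mul hf).sub (p.continuous.continuousOn.mul hf)))
        intervalIntegrable_const fun u hu => ?_
      have h1 := hpn u hu
      have h2 := hC u hu
      rw [Real.norm_eq_abs] at h2
      calc f u * f u - p.eval u * f u ≤ |(p.eval u - f u) * f u| := by
            rw [← abs_neg]; refine le_trans (le_of_eq ?_) (le_abs_self _); ring
        _ = |p.eval u - f u| * |f u| := abs_mul _ _
        _ ≤ ε / (C + 1) * C := by gcongr
        _ ≤ ε := by rw [div_mul_eq_mul_div, div_le_iff₀ (by positivity)]; nlinarith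
    simpa using this
  intro u hu'
  by_contra hne
  have := intervalIntegral.integral_pos (a := 0) (b := 1) zero_lt_one (hf.mul hf)
    (fun u _ => mul_self_nonneg _) ⟨u, hu', mul_self_pos.2 hne⟩
  exact this.ne' hsq

/-- The Riesz-type kernel `u ∑ Λ(n) (1/n - u)₊`. -/
noncomputable def vmTerm (n : ℕ) (u : ℝ) : ℝ :=
  ArithmeticFunction.vonMangoldt n * (u * max (1 / n - u) 0)

noncomputable def zTerm (ρ : XiZero) (u : ℝ) : ℝ :=
  xiMult ρ * (((u : ℂ) ^ (2 - (ρ : ℂ)) - (u : ℂ) ^ 2) / (ρ * (1 - ρ))).re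

noncomputable def trivTerm (j : ℕ) (u : ℝ) : ℝ :=
  (u ^ 2 - u ^ (2 * j + 4)) / ((2 * j + 2) * (2 * j + 3))

lemma continuous_vmTerm (n : ℕ) : Continuous (vmTerm n) := by
  unfold vmTerm; fun_prop

lemma continuous_trivTerm (j : ℕ) : Continuous (trivTerm j) := by
  unfold trivTerm; fun_prop

lemma continuous_zTerm (ρ : XiZero) : Continuous (zTerm ρ) := by
  have h : Continuous fun u : ℝ => (u : ℂ) ^ (2 - (ρ : ℂ)) :=
    Complex.continuous_ofReal_cpow_const (by
      have := ρ.re_lt_one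
      simp; linarith)
  unfold zTerm
  fun_prop

lemma XiZero.norm_mul_ge (ρ : XiZero) : (ρ : ℂ).im ^ 2 ≤ ‖(ρ : ℂ) * (1 - ρ)‖ := by
  have h1 := Complex.abs_im_le_norm (ρ : ℂ)
  have h2 := Complex.abs_im_le_norm (1 - (ρ : ℂ))
  simp only [Complex.sub_im, Complex.one_im, zero_sub, abs_neg] at h2
  rw [norm_mul, ← sq_abs, sq]
  gcongr

lemma abs_zTerm_le (ρ : XiZero) {u : ℝ} (hu : 0 ≤ u) :
    |zTerm ρ u| ≤ xiMult ρ / (ρ : ℂ).im ^ 2 * (u ^ (2 - (ρ : ℂ).re) + u ^ 2) := by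
  have h1 := ρ.norm_mul_ge
  have h0 : 0 < (ρ : ℂ).im ^ 2 := by have := ρ.im_sq_gt; linarith
  rw [zTerm, abs_mul, abs_of_nonneg (xiMult_nonneg ρ), div_mul_eq_mul_div, mul_div_assoc]
  refine mul_le_mul_of_nonneg_left ?_ (xiMult_nonneg ρ)
  refine (Complex.abs_re_le_norm _).trans ?_
  rw [norm_div]
  have h2 : ‖(u : ℂ) ^ (2 - (ρ : ℂ)) - (u : ℂ) ^ 2‖ ≤ u ^ (2 - (ρ : ℂ).re) + u ^ 2 := by
    refine (norm_sub_le _ _).trans (add_le_add (le_of_eq ?_) (le_of_eq ?_))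
    · rw [Complex.norm_cpow_eq_rpow_re_of_nonneg hu]
      · simp
      · have := ρ.re_lt_one
        simp; linarith
    · rw [norm_pow, Complex.norm_real, Real.norm_of_nonneg hu]
  exact div_le_div₀ (by positivity) h2 h0 h1

lemma abs_zTerm_le_of_mem (ρ : XiZero) {u : ℝ} (hu : u ∈ Set.Icc (0:ℝ) 1) :
    |zTerm ρ u| ≤ 2 * (xiMult ρ / (ρ : ℂ).im ^ 2) := by
  refine (abs_zTerm_le ρ hu.1).trans ?_
  have h1 : u ^ (2 - (ρ : ℂ).re) ≤ 1 :=
    Real.rpow_le_one hu.1 hu.2 (by linarith [ρ.re_lt_one])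
  have h2 : u ^ 2 ≤ 1 := pow_le_one₀ hu.1 hu.2
  nlinarith [xiWeight_nonneg ρ]

lemma summable_vonMangoldt_div_sq :
    Summable fun n : ℕ => ArithmeticFunction.vonMangoldt n * (1 / (n : ℝ) ^ 2) := by
  have h := (hasSum_vonMangoldt_cos (σ := 2) one_lt_two 0).summable
  refine h.congr fun n => ?_
  simp only [zero_mul, Real.cos_zero, mul_one]
  rw [Real.rpow_neg (by positivity), Real.rpow_two, one_div]

lemma abs_vmTerm_le (n : ℕ) {u : ℝ} (hu : u ∈ Set.Icc (0:ℝ) 1) :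
    |vmTerm n u| ≤ ArithmeticFunction.vonMangoldt n * (1 / (n : ℝ) ^ 2) := by
  have h0 := ArithmeticFunction.vonMangoldt_nonneg (n := n)
  rw [vmTerm, abs_mul, abs_of_nonneg h0]
  refine mul_le_mul_of_nonneg_left ?_ h0
  rw [abs_of_nonneg (mul_nonneg hu.1 (le_max_right _ _))]
  have hn : (0:ℝ) ≤ 1 / n := by positivity
  have e : 1 / (n : ℝ) ^ 2 = (1 / n) * (1 / n) := by rw [sq]; field_simp
  rw [e]
  rcases le_total u (1 / n : ℝ) with h | h
  · have : max (1 / (n : ℝ) - u) 0 ≤ 1 / n := max_le (by linarith [hu.1]) hn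
    exact mul_le_mul h this (le_max_right _ _) hn
  · rw [max_eq_right (by linarith), mul_zero]
    positivity

lemma trivTerm_bounds (j : ℕ) {u : ℝ} (hu : u ∈ Set.Icc (0:ℝ) 1) :
    0 ≤ trivTerm j u ∧ trivTerm j u ≤ u ^ 2 * (1 / ((j : ℝ) + 1) ^ 2) := by
  have h1 : u ^ (2 * j + 4) ≤ u ^ 2 := pow_le_pow_of_le_one hu.1 hu.2 (by omega)
  have h2 : 0 ≤ u ^ (2 * j + 4) := pow_nonneg hu.1 _
  have h3 : 0 ≤ u ^ 2 := sq_nonneg u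
  unfold trivTerm
  refine ⟨div_nonneg (by linarith) (by positivity), ?_⟩
  rw [mul_one_div]
  have hj := Nat.cast_nonneg (α := ℝ) j
  exact div_le_div₀ h3 (by linarith) (by positivity) (by nlinarith)

lemma abs_trivTerm_le (j : ℕ) {u : ℝ} (hu : u ∈ Set.Icc (0:ℝ) 1) :
    |trivTerm j u| ≤ 1 / ((j : ℝ) + 1) ^ 2 := by
  obtain ⟨h1, h2⟩ := trivTerm_bounds j hu
  rw [abs_of_nonneg h1]
  refine h2.trans (mul_le_of_le_one_left (by positivity) (pow_le_one₀ hu.1 hu.2))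

lemma HasSum.of_eq {ι : Type*} {f g : ι → ℝ} {a b : ℝ} (h : HasSum f a) (hf : ∀ i, g i = f i)
    (hb : b = a) : HasSum g b := by
  rw [hb, funext hf]; exact h

lemma integral_pow_mul_hinge (k : ℕ) {a : ℝ} (h0 : 0 ≤ a) (h1 : a ≤ 1) :
    ∫ u in (0:ℝ)..1, u ^ k * (u * max (a - u) 0) = a ^ (k + 3) / ((k + 3) * (k + 2)) := by
  have hi : ∀ b c : ℝ, IntervalIntegrable (fun u : ℝ => u ^ k * (u * max (a - u) 0))
      MeasureTheory.volume b c := fun b c => Continuous.intervalIntegrable (by fun_prop) _ _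
  rw [← intervalIntegral.integral_add_adjacent_intervals (hi 0 a) (hi a 1)]
  have e1 : ∫ u in (0:ℝ)..a, u ^ k * (u * max (a - u) 0) =
      ∫ u in (0:ℝ)..a, (a * u ^ (k + 1) - u ^ (k + 2)) := by
    refine intervalIntegral.integral_congr fun u hu => ?_
    rw [Set.uIcc_of_le h0] at hu
    rw [max_eq_left (by linarith [hu.2])]
    ring
  have e2 : ∫ u in a..1, u ^ k * (u * max (a - u) 0) = ∫ u in a..1, (0:ℝ) := by
    refine intervalIntegral.integral_congr fun u hu => ?_
    rw [Set.uIcc_of_le h1] at hu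
    rw [max_eq_right (by linarith [hu.1])]
    ring
  rw [e1, e2, intervalIntegral.integral_sub, intervalIntegral.integral_const_mul, integral_pow,
    integral_pow]
  · simp only [intervalIntegral.integral_zero]
    push_cast
    field_simp
    ring
  · exact Continuous.intervalIntegrable (by fun_prop) _ _
  · exact Continuous.intervalIntegrable (by fun_prop) _ _

lemma integral_pow_mul_mul_log (k : ℕ) :
    ∫ u in (0:ℝ)..1, u ^ k * (u * Real.log u) = -1 / ((k : ℝ) + 2) ^ 2 := by
  have hc : Continuous fun u : ℝ => u ^ (k + 1) * (u * Real.log u) / (k + 2) -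
      u ^ (k + 2) / (k + 2) ^ 2 := by
    have := Real.continuous_mul_log
    fun_prop
  have hi : Continuous fun u : ℝ => u ^ k * (u * Real.log u) := by
    have := Real.continuous_mul_log
    fun_prop
  rw [intervalIntegral.integral_eq_sub_of_hasDerivAt_of_le zero_le_one hc.continuousOn ?_
    (hi.intervalIntegrable _ _)]
  · simp; ring
  · intro u hu
    have hl := Real.hasDerivAt_log hu.1.ne'
    have h := ((((hasDerivAt_pow (k + 1) u).mul ((hasDerivAt_id u).mul hl)).div_const
      ((k : ℝ) + 2)).sub ((hasDerivAt_pow (k + 2) u).div_const (((k : ℝ) + 2) ^ 2)))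
    refine HasDerivAt.congr_deriv h ?_
    have hu' := hu.1.ne'
    simp only [Pi.mul_apply, id, Nat.add_sub_cancel]
    rw [show k + 2 - 1 = k + 1 by omega]
    push_cast
    field_simp
    ring

lemma integral_pow_mul_trivTerm (k j : ℕ) :
    ∫ u in (0:ℝ)..1, u ^ k * trivTerm j u =
      (1 / (2 * j + 3) - 1 / (2 * j + 5 + k)) / (((k : ℝ) + 3) * (k + 2)) := by
  have e : ∀ u : ℝ, u ^ k * trivTerm j u =
      (1 / ((2 * j + 2) * (2 * j + 3))) * (u ^ (k + 2) - u ^ (k + 2 * j + 4)) := by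
    intro u; unfold trivTerm; ring
  simp only [e]
  rw [intervalIntegral.integral_const_mul, intervalIntegral.integral_sub, integral_pow,
    integral_pow]
  · push_cast
    simp only [one_pow, ne_eq, Nat.add_eq_zero_iff, one_ne_zero, and_false, not_false_eq_true,
      zero_pow]
    have h1 : (k:ℝ) + 2 * j + 4 + 1 = 2 * j + 5 + k := by ring
    rw [h1]
    field_simp
    ring
  · exact Continuous.intervalIntegrable (by fun_prop) _ _
  · exact Continuous.intervalIntegrable (by fun_prop) _ _

lemma XiZero.ne_zero (ρ : XiZero) : (ρ : ℂ) ≠ 0 := fun h => by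
  have := ρ.re_pos; rw [h] at this; simp at this

lemma XiZero.one_sub_ne_zero (ρ : XiZero) : 1 - (ρ : ℂ) ≠ 0 := fun h => by
  have := ρ.re_lt_one; rw [← sub_eq_zero.1 h] at this; simp at this

lemma integral_pow_mul_zTerm (k : ℕ) (ρ : XiZero) :
    ∫ u in (0:ℝ)..1, u ^ k * zTerm ρ u =
      (xiMult ρ * (1 / (1 - (ρ : ℂ))).re - xiMult ρ * (1 / ((k : ℂ) + 3 - ρ)).re) /
        (((k : ℝ) + 3) * (k + 2)) := by
  have hr := ρ.re_lt_one
  have h1 := ρ.ne_zero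
  have h2 := ρ.one_sub_ne_zero
  have hre : 0 < ((k : ℂ) + 3 - ρ).re := by
    simp only [Complex.sub_re, Complex.add_re, Complex.natCast_re, Complex.re_ofNat]
    have := Nat.cast_nonneg (α := ℝ) k
    linarith
  have h3 : (k : ℂ) + 3 - ρ ≠ 0 := fun h => by rw [h] at hre; simp at hre
  have e : ∀ u ∈ Set.uIcc (0:ℝ) 1, u ^ k * zTerm ρ u =
      Complex.reCLM ((xiMult ρ : ℂ) / (ρ * (1 - ρ)) *
        ((u : ℂ) ^ ((k : ℂ) + 2 - ρ) - (u : ℂ) ^ (k + 2))) := by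
    intro u _
    have hcp : (u : ℂ) ^ ((k : ℂ) + 2 - ρ) = (u : ℂ) ^ k * (u : ℂ) ^ (2 - (ρ : ℂ)) := by
      by_cases hu : (u : ℂ) = 0
      · rw [hu, Complex.zero_cpow, Complex.zero_cpow, mul_zero]
        · intro h; have := congrArg Complex.re h; simp at this; linarith
        · intro h; rw [show (k : ℂ) + 3 - ρ = (k + 2 - ρ) + 1 by ring, h] at hre h3
          have := congrArg Complex.re h
          simp only [Complex.sub_re, Complex.add_re, Complex.natCast_re, Complex.re_ofNat,
            Complex.zero_re] at this
          have := Nat.cast_nonneg (α := ℝ) k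
          linarith
      · rw [show (k : ℂ) + 2 - ρ = k + (2 - ρ) by ring, Complex.cpow_add _ _ hu,
          Complex.cpow_natCast]
    rw [hcp, zTerm, Complex.reCLM_apply]
    have : (xiMult ρ : ℂ) / (ρ * (1 - ρ)) *
        ((u : ℂ) ^ k * (u : ℂ) ^ (2 - (ρ : ℂ)) - (u : ℂ) ^ (k + 2)) =
        ((u ^ k * xiMult ρ : ℝ) : ℂ) * (((u : ℂ) ^ (2 - (ρ : ℂ)) - (u : ℂ) ^ 2) / (ρ * (1 - ρ))) := by
      push_cast; ring
    rw [this, Complex.re_ofReal_mul]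
    ring
  have hi1 : IntervalIntegrable (fun u : ℝ => (u : ℂ) ^ ((k : ℂ) + 2 - ρ))
      MeasureTheory.volume 0 1 := by
    refine intervalIntegral.intervalIntegrable_cpow' ?_
    have : ((k : ℂ) + 2 - ρ).re = ((k : ℂ) + 3 - ρ).re - 1 := by
      simp only [Complex.sub_re, Complex.add_re, Complex.natCast_re, Complex.re_ofNat]; ring
    linarith
  have hi2 : IntervalIntegrable (fun u : ℝ => (u : ℂ) ^ (k + 2)) MeasureTheory.volume 0 1 :=
    Continuous.intervalIntegrable (by fun_prop) _ _
  rw [intervalIntegral.integral_congr e,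
    ContinuousLinearMap.intervalIntegral_comp_comm _ ((hi1.sub hi2).const_mul _),
    intervalIntegral.integral_const_mul, intervalIntegral.integral_sub hi1 hi2, integral_cpow]
  · have e2 : ∫ u in (0:ℝ)..1, (u : ℂ) ^ (k + 2) = 1 / ((k : ℂ) + 3) := by
      have : ∀ u : ℝ, (u : ℂ) ^ (k + 2) = ((u ^ (k + 2) : ℝ) : ℂ) := fun u => by push_cast; rfl
      simp only [this]
      rw [intervalIntegral.integral_ofReal, integral_pow]
      push_cast
      simp
      ring
    rw [e2, show (k : ℂ) + 2 - ρ + 1 = k + 3 - ρ by ring]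
    simp only [Complex.ofReal_one, Complex.one_cpow, Complex.ofReal_zero, Complex.zero_cpow h3,
      sub_zero]
    have hk3 : (k : ℂ) + 3 ≠ 0 := by exact_mod_cast (by omega : k + 3 ≠ 0)
    have hk2 : (k : ℂ) + 2 ≠ 0 := by exact_mod_cast (by omega : k + 2 ≠ 0)
    have : (xiMult ρ : ℂ) / (ρ * (1 - ρ)) * (1 / ((k : ℂ) + 3 - ρ) - 1 / ((k : ℂ) + 3)) =
        ((xiMult ρ / (((k : ℝ) + 3) * (k + 2)) : ℝ) : ℂ) *
          (1 / (1 - (ρ : ℂ)) - 1 / ((k : ℂ) + 3 - ρ)) := by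
      push_cast
      field_simp
      ring
    rw [this, Complex.reCLM_apply, Complex.re_ofReal_mul, Complex.sub_re]
    ring
  · left
    have : ((k : ℂ) + 2 - ρ).re = ((k : ℂ) + 3 - ρ).re - 1 := by
      simp only [Complex.sub_re, Complex.add_re, Complex.natCast_re, Complex.re_ofNat]; ring
    linarith

lemma hasSum_xiMult_moment (k : ℕ) :
    HasSum (fun ρ : XiZero => (xiMult ρ * (1 / (1 - (ρ : ℂ))).re -
        xiMult ρ * (1 / ((k : ℂ) + 3 - ρ)).re) / (((k : ℝ) + 3) * (k + 2)))
      (((logDeriv riemannXi 1).re - (logDeriv riemannXi ((k : ℂ) + 3)).re) /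
        (((k : ℝ) + 3) * (k + 2))) := by
  have h3 : 1 ≤ ((k : ℂ) + 3).re := by
    simp only [Complex.add_re, Complex.natCast_re, Complex.re_ofNat]
    have := Nat.cast_nonneg (α := ℝ) k
    linarith
  exact ((hasSum_re_logDeriv_riemannXi (s := 1) (by simp)).sub
    (hasSum_re_logDeriv_riemannXi h3)).div_const _

lemma hasSum_digamma_sub {z w : ℂ} (hz : 0 < z.re) (hw : 0 < w.re) :
    HasSum (fun n : ℕ => 1 / (w + n) - 1 / (z + n)) (Complex.digamma z - Complex.digamma w) := by
  have h := (summable_digamma_term hz).hasSum.sub (summable_digamma_term hw).hasSum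
  rw [tsum_digamma hz, tsum_digamma hw] at h
  simpa only [sub_sub_sub_cancel_left, sub_sub_sub_cancel_right] using h

lemma digamma_add_one' {z : ℂ} (hz : 0 < z.re) :
    Complex.digamma (z + 1) = Complex.digamma z + 1 / z := by
  simpa using digamma_add_natCast hz 1

lemma hasSum_trivTerm_moment (k : ℕ) :
    HasSum (fun j : ℕ => (1 / (2 * j + 3) - 1 / (2 * j + 5 + k)) / (((k : ℝ) + 3) * (k + 2)))
      (((Complex.digamma (((k : ℂ) + 3) / 2)).re / 2 + 1 / ((k : ℝ) + 3) - 1 + Real.log 2 +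
        Real.eulerMascheroniConstant / 2) / (((k : ℝ) + 3) * (k + 2))) := by
  have hk := Nat.cast_nonneg (α := ℝ) k
  have e2 : ((((k : ℝ) + 3) / 2 : ℝ) : ℂ) = ((k : ℂ) + 3) / 2 := by push_cast; rfl
  have hz0 : 0 < (((k : ℂ) + 3) / 2).re := by
    rw [← e2, Complex.ofReal_re]; positivity
  have hz : 0 < (((k : ℂ) + 3) / 2 + 1).re := by
    rw [Complex.add_re, Complex.one_re]; linarith
  have hw : 0 < (1 / 2 + 1 : ℂ).re := by norm_num
  have h := (Complex.hasSum_re (hasSum_digamma_sub hz hw)).mul_left (1 / 2)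
  rw [digamma_add_one' hz0, digamma_add_one' (by norm_num), Complex.digamma_one_half] at h
  refine HasSum.div_const ?_ _
  have e3 : (1 / (((k : ℂ) + 3) / 2)).re = 2 / ((k : ℝ) + 3) := by
    rw [← e2, ← Complex.ofReal_one, ← Complex.ofReal_div, Complex.ofReal_re]
    field_simp
  have e4 : (Complex.log 2).re = Real.log 2 := by
    rw [show (2 : ℂ) = ((2 : ℝ) : ℂ) by simp, Complex.log_ofReal_re]
  refine h.of_eq (fun j => ?_) ?_
  · have e5 : (1 / ((1 / 2 + 1 : ℂ) + j) - 1 / (((k : ℂ) + 3) / 2 + 1 + j)) =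
        ((2 / (2 * j + 3) - 2 / (2 * j + 5 + k) : ℝ) : ℂ) := by
      push_cast
      congr 1
      · rw [show (1 / 2 + 1 : ℂ) + j = (2 * j + 3) / 2 by ring, one_div_div]
      · rw [show ((k : ℂ) + 3) / 2 + 1 + j = (2 * j + 5 + k) / 2 by ring, one_div_div]
    rw [e5, Complex.ofReal_re]
    ring
  · simp only [one_div_one_div, Complex.sub_re, Complex.add_re, e3, Complex.ofReal_re,
      Complex.mul_re, e4, Complex.neg_re, Complex.re_ofNat, Complex.neg_im, Complex.im_ofNat]
    ring

lemma hasSum_vmTerm_moment (k : ℕ) :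
    HasSum (fun n : ℕ => ArithmeticFunction.vonMangoldt n *
        ((1 / (n : ℝ)) ^ (k + 3) / (((k : ℝ) + 3) * (k + 2))))
      (-(logDeriv riemannZeta ((k : ℂ) + 3)).re / (((k : ℝ) + 3) * (k + 2))) := by
  have hk := Nat.cast_nonneg (α := ℝ) k
  have h := hasSum_vonMangoldt_cos (σ := k + 3) (by linarith) 0
  have e : (⟨(k : ℝ) + 3, 0⟩ : ℂ) = (k : ℂ) + 3 := by apply Complex.ext <;> simp
  rw [e] at h
  refine (h.div_const (((k : ℝ) + 3) * (k + 2))).of_eq (fun n => ?_) rfl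
  have : (n : ℝ) ^ (-((k : ℝ) + 3)) = (1 / (n : ℝ)) ^ (k + 3) := by
    rw [Real.rpow_neg (by positivity), one_div, inv_pow, ← Real.rpow_natCast]
    push_cast; rfl
  rw [this]
  simp
  ring

/-- Explicit formula for the Riesz-type mean of `Λ(n)/n`. -/
theorem tsum_vmTerm_eq {u : ℝ} (hu : u ∈ Set.Icc (0:ℝ) 1) :
    ∑' n, vmTerm n u = -(u * Real.log u) - (1 + Real.eulerMascheroniConstant) * (u - u ^ 2) +
      ∑' ρ, zTerm ρ u + ∑' j, trivTerm j u := by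
  have cv := continuousOn_tsum_of_bound (fun i => (continuous_vmTerm i).continuousOn)
    (fun n u hu => abs_vmTerm_le n hu) summable_vonMangoldt_div_sq
  have cz := continuousOn_tsum_of_bound (fun i => (continuous_zTerm i).continuousOn)
    (fun n u hu => abs_zTerm_le_of_mem n hu) (summable_xiMult_div_im_sq.mul_left 2)
  have ct := continuousOn_tsum_of_bound (fun i => (continuous_trivTerm i).continuousOn)
    (fun n u hu => abs_trivTerm_le n hu) summable_one_div_add_one_sq
  have cl : Continuous fun u : ℝ => u * Real.log u := Real.continuous_mul_log
  have cq : Continuous fun u : ℝ => (1 + Real.eulerMascheroniConstant) * (u - u ^ 2) := by fun_prop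
  have key := eqOn_zero_of_moments (f := fun u => (∑' n, vmTerm n u) + u * Real.log u +
    (1 + Real.eulerMascheroniConstant) * (u - u ^ 2) - (∑' ρ, zTerm ρ u) - ∑' j, trivTerm j u)
    ((((cv.add cl.continuousOn).add cq.continuousOn).sub cz).sub ct) ?_ u hu
  · linarith
  intro k
  have hu01 : Set.uIcc (0:ℝ) 1 = Set.Icc 0 1 := Set.uIcc_of_le zero_le_one
  have int : ∀ {g : ℝ → ℝ}, ContinuousOn g (Set.Icc 0 1) →
      IntervalIntegrable (fun u => u ^ k * g u) MeasureTheory.volume 0 1 := fun hg =>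
    ContinuousOn.intervalIntegrable (by
      rw [hu01]; exact (continuous_pow k).continuousOn.mul hg)
  have iv := int cv
  have iz := int cz
  have it := int ct
  have il := int cl.continuousOn
  have iq := int cq.continuousOn
  have mV := (hasSum_moments k (fun i => (continuous_vmTerm i).continuousOn)
    (fun n u hu => abs_vmTerm_le n hu) summable_vonMangoldt_div_sq
    (c := fun n : ℕ => ArithmeticFunction.vonMangoldt n *
      ((1 / (n : ℝ)) ^ (k + 3) / (((k : ℝ) + 3) * (k + 2)))) fun n => ?_).unique
    (hasSum_vmTerm_moment k)
  · have mZ := (hasSum_moments k (fun i => (continuous_zTerm i).continuousOn)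
      (fun n u hu => abs_zTerm_le_of_mem n hu) (summable_xiMult_div_im_sq.mul_left 2)
      (integral_pow_mul_zTerm k)).unique (hasSum_xiMult_moment k)
    have mT := (hasSum_moments k (fun i => (continuous_trivTerm i).continuousOn)
      (fun n u hu => abs_trivTerm_le n hu) summable_one_div_add_one_sq
      (integral_pow_mul_trivTerm k)).unique (hasSum_trivTerm_moment k)
    have mL := integral_pow_mul_mul_log k
    have mQ : ∫ u in (0:ℝ)..1, u ^ k * ((1 + Real.eulerMascheroniConstant) * (u - u ^ 2)) =
        (1 + Real.eulerMascheroniConstant) * (1 / (k + 2) - 1 / (k + 3)) := by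
      have e : ∀ u : ℝ, u ^ k * ((1 + Real.eulerMascheroniConstant) * (u - u ^ 2)) =
          (1 + Real.eulerMascheroniConstant) * (u ^ (k + 1) - u ^ (k + 2)) := by
        intro u; ring
      simp only [e]
      rw [intervalIntegral.integral_const_mul, intervalIntegral.integral_sub
        (Continuous.intervalIntegrable (by fun_prop) _ _)
        (Continuous.intervalIntegrable (by fun_prop) _ _), integral_pow, integral_pow]
      push_cast
      simp only [one_pow, ne_eq, Nat.add_eq_zero_iff, one_ne_zero, and_false, not_false_eq_true,
        zero_pow, OfNat.ofNat_ne_zero]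
      ring
    have e : ∀ u : ℝ, u ^ k * ((∑' n, vmTerm n u) + u * Real.log u +
        (1 + Real.eulerMascheroniConstant) * (u - u ^ 2) - (∑' ρ, zTerm ρ u) - ∑' j, trivTerm j u) =
        u ^ k * (∑' n, vmTerm n u) + u ^ k * (u * Real.log u) +
        u ^ k * ((1 + Real.eulerMascheroniConstant) * (u - u ^ 2)) - u ^ k * (∑' ρ, zTerm ρ u) -
        u ^ k * ∑' j, trivTerm j u := fun u => by ring
    simp only [e]
    rw [intervalIntegral.integral_sub (((iv.add il).add iq).sub iz) it,
      intervalIntegral.integral_sub ((iv.add il).add iq) iz,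
      intervalIntegral.integral_add (iv.add il) iq, intervalIntegral.integral_add iv il,
      mV, mZ, mT, mL, mQ, logDeriv_riemannXi_one]
    have hk := Nat.cast_nonneg (α := ℝ) k
    have hx := re_logDeriv_riemannXi_ofReal (σ := k + 3) (by linarith)
    have e3 : (((k : ℝ) + 3 : ℝ) : ℂ) = (k : ℂ) + 3 := by push_cast; rfl
    have e4 : ((((k : ℝ) + 3) / 2 : ℝ) : ℂ) = ((k : ℂ) + 3) / 2 := by push_cast; rfl
    rw [e3, e4] at hx
    rw [hx, Real.log_mul (by norm_num) Real.pi_ne_zero, show (4:ℝ) = 2 ^ 2 by norm_num, Real.log_pow]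
    have h1 : (k : ℝ) + 3 - 1 = k + 2 := by ring
    rw [h1]
    push_cast
    field_simp
    ring
  · have h : ∀ u : ℝ, u ^ k * vmTerm n u = ArithmeticFunction.vonMangoldt n *
        (u ^ k * (u * max (1 / n - u) 0)) := fun u => by unfold vmTerm; ring
    simp only [h]
    rw [intervalIntegral.integral_const_mul, integral_pow_mul_hinge k (by positivity)]
    rcases Nat.eq_zero_or_pos n with rfl | hn
    · simp
    · rw [div_le_one (by positivity)]; exact_mod_cast hn

/-- Riesz-type mean `∑_{n ≤ y} Λ(n) (1/n - 1/y)`. -/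
noncomputable def rieszMean (y : ℝ) : ℝ :=
  ∑' n : ℕ, ArithmeticFunction.vonMangoldt n * max (1 / n - 1 / y) 0

/-- The error term of `rieszMean`. -/
noncomputable def rieszErr (y : ℝ) : ℝ :=
  rieszMean y - Real.log y + 1 + Real.eulerMascheroniConstant

/-- Contribution of one zero of `ξ` to `rieszErr`. -/
noncomputable def zeroTerm (ρ : XiZero) (t : ℝ) : ℝ :=
  xiMult ρ * ((t : ℂ) ^ ((ρ : ℂ) - 1) / (ρ * (1 - ρ))).re

/-- The part of `rieszErr` that is `O(1/t)`. -/
noncomputable def rieszTail (t : ℝ) : ℝ :=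
  rieszErr t - ∑' ρ, zeroTerm ρ t

lemma rieszMean_eq_sum {y : ℝ} (hy : 0 < y) {N : ℕ} (hN : y ≤ N) :
    rieszMean y = ∑ n ∈ Ioc 0 N, ArithmeticFunction.vonMangoldt n * max (1 / n - 1 / y) 0 := by
  refine tsum_eq_sum fun n hn => ?_
  rw [mem_Ioc, not_and_or, not_lt, not_le] at hn
  rcases hn with hn | hn
  · simp [Nat.le_zero.1 hn]
  · have : (1:ℝ) / n ≤ 1 / y := one_div_le_one_div_of_le hy (hN.trans (by exact_mod_cast hn.le))
    rw [max_eq_right (by linarith), mul_zero]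

lemma abs_zeroTerm_le (ρ : XiZero) {t : ℝ} (ht : 0 < t) :
    |zeroTerm ρ t| ≤ xiMult ρ / (ρ : ℂ).im ^ 2 * t ^ ((ρ : ℂ).re - 1) := by
  have h1 := ρ.norm_mul_ge
  have h0 : 0 < (ρ : ℂ).im ^ 2 := by have := ρ.im_sq_gt; linarith
  rw [zeroTerm, abs_mul, abs_of_nonneg (xiMult_nonneg ρ), div_mul_eq_mul_div, mul_div_assoc]
  refine mul_le_mul_of_nonneg_left ?_ (xiMult_nonneg ρ)
  refine (Complex.abs_re_le_norm _).trans ?_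
  rw [norm_div, Complex.norm_cpow_eq_rpow_re_of_pos ht]
  simp only [Complex.sub_re, Complex.one_re]
  exact div_le_div_of_nonneg_left (Real.rpow_nonneg ht.le _) h0 h1

lemma summable_zeroTerm {t : ℝ} (ht : 1 ≤ t) : Summable fun ρ => zeroTerm ρ t :=
  Summable.of_norm_bounded (summable_zeroSum ht) fun ρ => abs_zeroTerm_le ρ (by linarith)

lemma abs_tsum_zeroTerm_le {t : ℝ} (ht : 1 ≤ t) : |∑' ρ, zeroTerm ρ t| ≤ zeroSum t :=
  tsum_of_norm_bounded (f := fun ρ => zeroTerm ρ t) (summable_zeroSum ht).hasSum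
    fun ρ => abs_zeroTerm_le ρ (by linarith)

lemma tsum_one_div_add_one_sq_le : ∑' j : ℕ, 1 / ((j : ℝ) + 1) ^ 2 ≤ 1.65 := by
  have h := (hasSum_nat_add_iff' 1).2 hasSum_zeta_two
  have e : ∑' j : ℕ, 1 / ((j : ℝ) + 1) ^ 2 = Real.pi ^ 2 / 6 := by
    have := h.tsum_eq
    push_cast at this
    rw [this]; simp
  rw [e]
  have := Real.pi_lt_d4
  have := Real.pi_pos
  nlinarith

lemma mul_tsum_vmTerm {y : ℝ} (hy : 0 < y) : y * ∑' n, vmTerm n (1 / y) = rieszMean y := by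
  rw [rieszMean, ← tsum_mul_left]
  refine tsum_congr fun n => ?_
  unfold vmTerm
  field_simp

lemma abs_rieszTail_le {t : ℝ} (ht : 1 ≤ t) : |rieszTail t| ≤ 3.3 / t := by
  have ht0 : 0 < t := by linarith
  have hu : 1 / t ∈ Set.Icc (0:ℝ) 1 := ⟨by positivity, by rw [div_le_one ht0]; exact ht⟩
  have h := tsum_vmTerm_eq hu
  have hv := mul_tsum_vmTerm ht0
  have hz : ∀ ρ : XiZero, t * zTerm ρ (1 / t) =
      zeroTerm ρ t - xiMult ρ * (1 / ((ρ : ℂ) * (1 - ρ))).re * (1 / t) := by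
    intro ρ
    have htc : (t : ℂ) ≠ 0 := by exact_mod_cast ht0.ne'
    have e1 : ((1 / t : ℝ) : ℂ) ^ (2 - (ρ : ℂ)) = (t : ℂ) ^ ((ρ : ℂ) - 1) / t := by
      rw [Complex.ofReal_div, Complex.ofReal_one, one_div, Complex.inv_cpow, ← Complex.cpow_neg,
        show -(2 - (ρ : ℂ)) = (ρ - 1) - 1 by ring, Complex.cpow_sub _ _ htc, Complex.cpow_one]
      rw [Complex.arg_ofReal_of_nonneg ht0.le]; exact Real.pi_pos.ne
    have e2 : (((1 / t : ℝ) : ℂ) ^ (2 - (ρ : ℂ)) - ((1 / t : ℝ) : ℂ) ^ 2) / (ρ * (1 - ρ)) =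
        ((1 / t : ℝ) : ℂ) * ((t : ℂ) ^ ((ρ : ℂ) - 1) / (ρ * (1 - ρ)) -
          ((1 / t : ℝ) : ℂ) * (1 / (ρ * (1 - ρ)))) := by
      rw [e1]; push_cast; ring
    rw [zTerm, e2, Complex.re_ofReal_mul, Complex.sub_re, Complex.re_ofReal_mul, zeroTerm]
    field_simp
  have hb : ∀ ρ : XiZero, ‖xiMult ρ * (1 / ((ρ : ℂ) * (1 - ρ))).re * (1 / t)‖ ≤
      xiMult ρ / (ρ : ℂ).im ^ 2 * (1 / t) := by
    intro ρ
    have h0 : 0 < (ρ : ℂ).im ^ 2 := by have := ρ.im_sq_gt; linarith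
    rw [norm_mul, norm_mul, Real.norm_of_nonneg (xiMult_nonneg ρ), Real.norm_of_nonneg hu.1]
    refine mul_le_mul_of_nonneg_right ?_ hu.1
    rw [div_eq_mul_one_div (xiMult ρ)]
    refine mul_le_mul_of_nonneg_left ((Complex.abs_re_le_norm _).trans ?_) (xiMult_nonneg ρ)
    rw [norm_div, norm_one]
    exact one_div_le_one_div_of_le h0 ρ.norm_mul_ge
  have hs := summable_xiMult_div_im_sq.mul_right (1 / t)
  have hc := tsum_of_norm_bounded hs.hasSum hb
  rw [Real.norm_eq_abs] at hc
  have hzs : t * ∑' ρ, zTerm ρ (1 / t) = (∑' ρ, zeroTerm ρ t) -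
      ∑' ρ : XiZero, xiMult ρ * (1 / ((ρ : ℂ) * (1 - ρ))).re * (1 / t) := by
    rw [← tsum_mul_left, ← Summable.tsum_sub (summable_zeroTerm ht)
      (Summable.of_norm_bounded hs hb)]
    exact tsum_congr hz
  have hT0 : 0 ≤ ∑' j, trivTerm j (1 / t) := tsum_nonneg fun j => (trivTerm_bounds j hu).1
  have hT1 : ∑' j, trivTerm j (1 / t) ≤ (1 / t) ^ 2 * ∑' j : ℕ, 1 / ((j : ℝ) + 1) ^ 2 := by
    rw [← tsum_mul_left]
    exact Summable.tsum_le_tsum (fun j => (trivTerm_bounds j hu).2)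
      (Summable.of_norm_bounded summable_one_div_add_one_sq fun j => abs_trivTerm_le j hu)
      (summable_one_div_add_one_sq.mul_left _)
  have hT2 : t * ∑' j, trivTerm j (1 / t) ≤ 1.65 / t := by
    calc t * ∑' j, trivTerm j (1 / t) ≤ t * ((1 / t) ^ 2 * 1.65) := by
          gcongr
          exact hT1.trans (by gcongr; exact tsum_one_div_add_one_sq_le)
      _ = 1.65 / t := by field_simp
  have hT3 : 0 ≤ t * ∑' j, trivTerm j (1 / t) := by positivity
  have hlog : Real.log (1 / t) = -Real.log t := by rw [one_div, Real.log_inv]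
  have e : rieszTail t = (1 + Real.eulerMascheroniConstant) / t -
      (∑' ρ : XiZero, xiMult ρ * (1 / ((ρ : ℂ) * (1 - ρ))).re * (1 / t)) +
      t * ∑' j, trivTerm j (1 / t) := by
    rw [rieszTail, rieszErr, ← hv, h, mul_add, mul_add, hzs, hlog]
    field_simp
    ring
  have hg0 := Real.one_half_lt_eulerMascheroniConstant
  have hg1 := eulerMascheroniConstant_lt
  have hc2 : ∑' ρ : XiZero, xiMult ρ / (ρ : ℂ).im ^ 2 * (1 / t) ≤ 0.0472 / t := by
    rw [tsum_mul_right, mul_one_div]; gcongr; exact tsum_xiMult_div_im_sq_le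
  have hc' := abs_le.1 hc
  have a1 : (1 + Real.eulerMascheroniConstant) / t ≤ 1.5775 / t := by gcongr; linarith
  have a0 : 0 ≤ (1 + Real.eulerMascheroniConstant) / t := div_nonneg (by linarith) ht0.le
  have b1 : 1.5775 / t + 0.0472 / t + 1.65 / t ≤ 3.3 / t := by
    rw [← add_div, ← add_div]; gcongr; norm_num
  have b2 : 0.0472 / t ≤ 3.3 / t := by gcongr; norm_num
  rw [e, abs_le]
  constructor <;> linarith [hc'.1, hc'.2]

lemma rieszErr_eq (t : ℝ) : rieszErr t = (∑' ρ, zeroTerm ρ t) + rieszTail t := by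
  rw [rieszTail]; ring

lemma abs_rieszErr_le {t : ℝ} (ht : 1 ≤ t) : |rieszErr t| ≤ zeroSum t + 3.3 / t := by
  rw [rieszErr_eq]
  exact (abs_add_le _ _).trans (add_le_add (abs_tsum_zeroTerm_le ht) (abs_rieszTail_le ht))

/-- `1 / log t + 1 / log² t`. -/
noncomputable def mertW (t : ℝ) : ℝ := 1 / Real.log t + 1 / Real.log t ^ 2

/-- `-t` times the derivative of `mertW`. -/
noncomputable def mertG (t : ℝ) : ℝ := 1 / Real.log t ^ 2 + 2 / Real.log t ^ 3

/-- `∑_{n ≤ y} Λ(n) / (n log n)`. -/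
noncomputable def mertPi (y : ℝ) : ℝ :=
  ∑ n ∈ Ioc 0 ⌊y⌋₊, ArithmeticFunction.vonMangoldt n / (n * Real.log n)

noncomputable def mertQ (y : ℝ) : ℝ :=
  mertPi y - Real.log (Real.log y) - (Chebyshev.psi y - y) / (y * Real.log y) -
    mertW y * rieszErr y

lemma hasDerivAt_mertW {t : ℝ} (ht : 1 < t) : HasDerivAt mertW (-(mertG t / t)) t := by
  have hl : 0 < Real.log t := Real.log_pos ht
  have h := Real.hasDerivAt_log (show t ≠ 0 by linarith)
  have := ((hasDerivAt_const t (1:ℝ)).div h hl.ne').add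
    ((hasDerivAt_const t (1:ℝ)).div (h.pow 2) (pow_ne_zero 2 hl.ne'))
  refine HasDerivAt.congr_deriv this ?_
  unfold mertG
  have ht' : t ≠ 0 := by linarith
  simp only [Pi.pow_apply]
  field_simp
  ring

lemma continuousOn_log_Ioi_one : ContinuousOn Real.log (Set.Ioi 1) :=
  Real.continuousOn_log.mono fun t ht h => by
    rw [Set.mem_singleton_iff] at h; rw [h, Set.mem_Ioi] at ht; linarith

lemma continuousOn_mertG : ContinuousOn mertG (Set.Ioi 1) := by
  have hl : ∀ t ∈ Set.Ioi (1:ℝ), Real.log t ≠ 0 := fun t ht => (Real.log_pos ht).ne'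
  exact (continuousOn_const.div (continuousOn_log_Ioi_one.pow 2) fun t ht => pow_ne_zero _ (hl t ht)).add
    (continuousOn_const.div (continuousOn_log_Ioi_one.pow 3) fun t ht => pow_ne_zero _ (hl t ht))

lemma mertW_pos {t : ℝ} (ht : 1 < t) : 0 < mertW t := by
  have := Real.log_pos ht
  unfold mertW; positivity

lemma mertG_pos {t : ℝ} (ht : 1 < t) : 0 < mertG t := by
  have := Real.log_pos ht
  unfold mertG; positivity

/-- One summand of `mertQ` once `n ≤ s`. -/
noncomputable def mertTerm (n : ℕ) (s : ℝ) : ℝ :=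
  1 / (n * Real.log n) - 1 / (s * Real.log s) - mertW s * (1 / n - 1 / s)

lemma hasDerivAt_mertTerm (n : ℕ) {s : ℝ} (hs : 1 < s) :
    HasDerivAt (mertTerm n) (mertG s / s * (1 / n - 1 / s)) s := by
  have hl : 0 < Real.log s := Real.log_pos hs
  have hs' : s ≠ 0 := by linarith
  have h := Real.hasDerivAt_log hs'
  have h1 := ((hasDerivAt_const s (1:ℝ)).div ((hasDerivAt_id s).mul h) (mul_pos (show 0 < id s by simp only [id]; linarith) hl).ne')
  have h2 := (hasDerivAt_mertW hs).mul
    ((hasDerivAt_const s (1 / (n:ℝ))).sub ((hasDerivAt_const s (1:ℝ)).div (hasDerivAt_id s) hs'))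
  have := ((hasDerivAt_const s (1 / (n * Real.log n))).sub h1).sub h2
  refine HasDerivAt.congr_deriv this ?_
  simp only [Pi.sub_apply, Pi.div_apply, Pi.mul_apply, id]
  unfold mertW
  field_simp
  ring

lemma mertTerm_self {n : ℕ} : mertTerm n n = 0 := by unfold mertTerm; simp

lemma integral_mertTerm {n : ℕ} (hn : 2 ≤ n) {a b : ℝ} (ha : 1 < a) (hab : a ≤ b) :
    ∫ t in a..b, mertG t / t * max (1 / n - 1 / t) 0 =
      mertTerm n (max n b) - mertTerm n (max n a) := by
  have hn1 : (1:ℝ) < n := by exact_mod_cast hn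
  have hmax : ∀ t : ℝ, 1 < max (n:ℝ) t := fun t => lt_max_of_lt_left hn1
  refine MeasureTheory.integral_eq_of_hasDerivAt_off_countable_of_le
    (fun t => mertTerm n (max n t)) _ hab (Set.countable_singleton (n:ℝ)) ?_ ?_ ?_
  · intro t _
    exact ((hasDerivAt_mertTerm n (hmax t)).continuousAt.comp
      (f := fun t : ℝ => max (n:ℝ) t) (by fun_prop)).continuousWithinAt
  · rintro t ⟨ht, htn⟩
    have ht1 : 1 < t := ha.trans ht.1
    rcases lt_or_gt_of_ne (show t ≠ n from htn) with h | h
    · have e : (fun t => mertTerm n (max n t)) =ᶠ[nhds t] fun _ => 0 := by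
        filter_upwards [gt_mem_nhds h] with u hu
        rw [max_eq_left hu.le, mertTerm_self]
      have h2 : 1 / (n:ℝ) ≤ 1 / t := one_div_le_one_div_of_le (by linarith) h.le
      rw [max_eq_right (by linarith), mul_zero]
      exact (hasDerivAt_const t (0:ℝ)).congr_of_eventuallyEq e
    · have e : (fun t => mertTerm n (max n t)) =ᶠ[nhds t] mertTerm n := by
        filter_upwards [lt_mem_nhds h] with u hu
        rw [max_eq_right (le_of_lt hu)]
      have h2 : 1 / t ≤ 1 / (n:ℝ) := one_div_le_one_div_of_le (by linarith) (le_of_lt h)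
      rw [max_eq_left (by linarith)]
      exact (hasDerivAt_mertTerm n ht1).congr_of_eventuallyEq e
  · refine ContinuousOn.intervalIntegrable ?_
    rw [Set.uIcc_of_le hab]
    have hsub : Set.Icc a b ⊆ Set.Ioi 1 := fun t ht => ha.trans_le ht.1
    have h0 : ∀ t ∈ Set.Icc a b, t ≠ 0 := fun t ht => by have := ht.1; linarith
    exact ((continuousOn_mertG.mono hsub).div continuousOn_id h0).mul
      ((continuousOn_const.sub (continuousOn_const.div continuousOn_id h0)).sup continuousOn_const)

lemma sum_mertTerm_eq {y : ℝ} (hy : 1 < y) {N : ℕ} (hN : y ≤ N) :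
    ∑ n ∈ Ioc 0 N, ArithmeticFunction.vonMangoldt n * mertTerm n (max n y) =
      mertPi y - Chebyshev.psi y / (y * Real.log y) - mertW y * rieszMean y := by
  have hy0 : 0 < y := by linarith
  have hf : Ioc 0 ⌊y⌋₊ = (Ioc 0 N).filter fun n : ℕ => (n:ℝ) ≤ y := by
    ext n
    simp only [mem_Ioc, mem_filter]
    constructor
    · rintro ⟨h1, h2⟩
      have h3 : (n:ℝ) ≤ y := (Nat.le_floor_iff hy0.le).1 h2
      exact ⟨⟨h1, by exact_mod_cast h3.trans hN⟩, h3⟩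
    · rintro ⟨⟨h1, -⟩, h3⟩
      exact ⟨h1, Nat.le_floor h3⟩
  rw [mertPi, Chebyshev.psi, rieszMean_eq_sum hy0 hN, hf, sum_filter, sum_filter, sum_div, mul_sum,
    ← sum_sub_distrib, ← sum_sub_distrib]
  refine sum_congr rfl fun n hn => ?_
  have hn0 : (0:ℝ) < n := by exact_mod_cast (mem_Ioc.1 hn).1
  by_cases h : (n:ℝ) ≤ y
  · have h2 : 1 / y ≤ 1 / (n:ℝ) := one_div_le_one_div_of_le hn0 h
    rw [if_pos h, if_pos h, max_eq_right h, max_eq_left (by linarith), mertTerm]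
    ring
  · have h2 : 1 / (n:ℝ) ≤ 1 / y := one_div_le_one_div_of_le hy0 (by linarith)
    rw [if_neg h, if_neg h, max_eq_left (by linarith), max_eq_right (by linarith), mertTerm_self]
    ring

lemma intervalIntegrable_of_Ioi_one {f : ℝ → ℝ} (hf : ContinuousOn f (Set.Ioi 1)) {a b : ℝ}
    (ha : 1 < a) (hab : a ≤ b) : IntervalIntegrable f MeasureTheory.volume a b := by
  refine ContinuousOn.intervalIntegrable (hf.mono ?_)
  rw [Set.uIcc_of_le hab]
  exact fun t ht => ha.trans_le ht.1

lemma continuousOn_mertG_div : ContinuousOn (fun t => mertG t / t) (Set.Ioi 1) :=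
  continuousOn_mertG.div continuousOn_id fun t ht => by
    have : (1:ℝ) < t := ht
    show t ≠ 0
    linarith

lemma integral_mertG_mul_log {a b : ℝ} (ha : 1 < a) (hab : a ≤ b) :
    ∫ t in a..b, mertG t / t * (Real.log t - 1 - Real.eulerMascheroniConstant) =
      (Real.log (Real.log b) - 1 / Real.log b -
        mertW b * (Real.log b - 1 - Real.eulerMascheroniConstant)) -
      (Real.log (Real.log a) - 1 / Real.log a -
        mertW a * (Real.log a - 1 - Real.eulerMascheroniConstant)) := by
  have hd : ∀ t : ℝ, 1 < t → HasDerivAt (fun t => Real.log (Real.log t) - 1 / Real.log t -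
        mertW t * (Real.log t - 1 - Real.eulerMascheroniConstant))
      (mertG t / t * (Real.log t - 1 - Real.eulerMascheroniConstant)) t := by
    intro t ht
    have hl := Real.log_pos ht
    have ht0 : t ≠ 0 := by linarith
    have h := Real.hasDerivAt_log ht0
    have := ((h.log hl.ne').sub ((hasDerivAt_const t (1:ℝ)).div h hl.ne')).sub
      ((hasDerivAt_mertW ht).mul ((h.sub_const 1).sub_const Real.eulerMascheroniConstant))
    refine HasDerivAt.congr_deriv this ?_
    unfold mertW
    field_simp
    ring
  refine intervalIntegral.integral_eq_sub_of_hasDerivAt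
    (f := fun t => Real.log (Real.log t) - 1 / Real.log t -
        mertW t * (Real.log t - 1 - Real.eulerMascheroniConstant)) (fun t ht => ?_) ?_
  · rw [Set.uIcc_of_le hab] at ht
    exact hd t (ha.trans_le ht.1)
  · exact intervalIntegrable_of_Ioi_one (continuousOn_mertG_div.mul
      ((continuousOn_log_Ioi_one.sub continuousOn_const).sub continuousOn_const)) ha hab

lemma integral_mertG_mul_rieszErr {a b : ℝ} (ha : 1 < a) (hab : a ≤ b) :
    ∫ t in a..b, mertG t / t * rieszErr t = mertQ b - mertQ a := by
  obtain ⟨N, hN⟩ := exists_nat_ge b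
  have h1 : ∀ t ∈ Set.uIcc a b, mertG t / t * rieszErr t =
      (∑ n ∈ Ioc 0 N, ArithmeticFunction.vonMangoldt n *
        (mertG t / t * max (1 / n - 1 / t) 0)) -
      mertG t / t * (Real.log t - 1 - Real.eulerMascheroniConstant) := by
    intro t ht
    rw [Set.uIcc_of_le hab] at ht
    rw [rieszErr, rieszMean_eq_sum (by linarith [ht.1]) (ht.2.trans hN)]
    have : ∀ n : ℕ, ArithmeticFunction.vonMangoldt n * (mertG t / t * max (1 / n - 1 / t) 0) =
        mertG t / t * (ArithmeticFunction.vonMangoldt n * max (1 / n - 1 / t) 0) := fun n => by ring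
    simp only [this]
    rw [← mul_sum]
    ring
  have hi : ∀ n : ℕ, IntervalIntegrable (fun t => ArithmeticFunction.vonMangoldt n *
      (mertG t / t * max (1 / n - 1 / t) 0)) MeasureTheory.volume a b := by
    intro n
    refine intervalIntegrable_of_Ioi_one ?_ ha hab
    refine continuousOn_const.mul (continuousOn_mertG_div.mul ?_)
    refine (continuousOn_const.sub (continuousOn_const.div continuousOn_id fun t ht => ?_)).sup
      continuousOn_const
    have : (1:ℝ) < t := ht
    show t ≠ 0
    linarith
  have hi2 : IntervalIntegrable (fun t => mertG t / t *
      (Real.log t - 1 - Real.eulerMascheroniConstant)) MeasureTheory.volume a b :=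
    intervalIntegrable_of_Ioi_one (continuousOn_mertG_div.mul
      ((continuousOn_log_Ioi_one.sub (continuousOn_const (c := 1))).sub
        (continuousOn_const (c := Real.eulerMascheroniConstant)))) ha hab
  have hi3 : IntervalIntegrable (fun t => ∑ n ∈ Ioc 0 N, ArithmeticFunction.vonMangoldt n *
      (mertG t / t * max (1 / n - 1 / t) 0)) MeasureTheory.volume a b := by
    have := IntervalIntegrable.sum (Ioc 0 N) fun n _ => hi n
    simpa only [Finset.sum_fn] using this
  rw [intervalIntegral.integral_congr h1, intervalIntegral.integral_sub hi3 hi2, intervalIntegral.integral_finsetSum fun n _ => hi n,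
    integral_mertG_mul_log ha hab]
  have h2 : ∀ n ∈ Ioc 0 N, ∫ t in a..b, ArithmeticFunction.vonMangoldt n *
      (mertG t / t * max (1 / n - 1 / t) 0) =
      ArithmeticFunction.vonMangoldt n * mertTerm n (max n b) -
        ArithmeticFunction.vonMangoldt n * mertTerm n (max n a) := by
    intro n hn
    rw [intervalIntegral.integral_const_mul]
    rcases Nat.lt_or_ge n 2 with h | h
    · have : n = 1 := by have := (mem_Ioc.1 hn).1; omega
      subst this; simp
    · rw [integral_mertTerm h ha hab]; ring
  rw [sum_congr rfl h2, sum_sub_distrib, sum_mertTerm_eq (ha.trans_le hab) hN,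
    sum_mertTerm_eq ha (hab.trans hN)]
  have e : ∀ t : ℝ, 1 < t → (Chebyshev.psi t - t) / (t * Real.log t) =
      Chebyshev.psi t / (t * Real.log t) - 1 / Real.log t := by
    intro t ht
    have := Real.log_pos ht
    have : t ≠ 0 := by linarith
    field_simp
  rw [mertQ, mertQ, e a ha, e b (ha.trans_le hab), rieszErr, rieszErr]
  ring

/-- Integration by parts against an antitone nonnegative weight. -/
lemma abs_integral_mul_deriv_le {G G' V V' : ℝ → ℝ} {a b C : ℝ} (hab : a ≤ b)
    (hG : ∀ t ∈ Set.Icc a b, HasDerivAt G (G' t) t) (hV : ∀ t ∈ Set.Icc a b, HasDerivAt V (V' t) t)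
    (hG' : ContinuousOn G' (Set.Icc a b)) (hV' : ContinuousOn V' (Set.Icc a b))
    (hneg : ∀ t ∈ Set.Icc a b, G' t ≤ 0) (hb : 0 ≤ G b) (hC : ∀ t ∈ Set.Icc a b, |V t| ≤ C) :
    |∫ t in a..b, G t * V' t| ≤ 2 * C * G a := by
  have hu : Set.uIcc a b = Set.Icc a b := Set.uIcc_of_le hab
  have ma : a ∈ Set.Icc a b := ⟨le_rfl, hab⟩
  have mb : b ∈ Set.Icc a b := ⟨hab, le_rfl⟩
  have hC0 : 0 ≤ C := (abs_nonneg _).trans (hC a ma)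
  have iG' : IntervalIntegrable G' MeasureTheory.volume a b :=
    ContinuousOn.intervalIntegrable (by rwa [hu])
  have iV' : IntervalIntegrable V' MeasureTheory.volume a b :=
    ContinuousOn.intervalIntegrable (by rwa [hu])
  rw [intervalIntegral.integral_mul_deriv_eq_deriv_mul (by rwa [hu]) (by rwa [hu]) iG' iV']
  have hi : ∫ t in a..b, G' t = G b - G a :=
    intervalIntegral.integral_eq_sub_of_hasDerivAt (by rwa [hu]) iG'
  have hle : ‖∫ t in a..b, G' t * V t‖ ≤ ∫ t in a..b, -G' t * C := by
    refine intervalIntegral.norm_integral_le_of_norm_le hab ?_ (iG'.neg.mul_const C)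
    refine Eventually.of_forall fun t ht => ?_
    have ht' := Set.Ioc_subset_Icc_self ht
    rw [norm_mul, Real.norm_of_nonpos (hneg t ht'), Real.norm_eq_abs]
    exact mul_le_mul_of_nonneg_left (hC t ht') (by linarith [hneg t ht'])
  rw [intervalIntegral.integral_mul_const, intervalIntegral.integral_neg, hi,
    Real.norm_eq_abs] at hle
  have hnn : ∫ t in a..b, G' t ≤ 0 := by
    have h := intervalIntegral.integral_nonneg (μ := MeasureTheory.volume) hab (f := fun t => -G' t) fun t ht => by
      linarith [hneg t ht]
    rw [intervalIntegral.integral_neg] at h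
    linarith
  have h1 := hC a ma
  have h2 := hC b mb
  have hGa : G b ≤ G a := by linarith
  have e1 : |G b * V b| ≤ G b * C := by
    rw [abs_mul, abs_of_nonneg hb]; gcongr
  have e2 : |G a * V a| ≤ G a * C := by
    rw [abs_mul, abs_of_nonneg (hb.trans hGa)]
    exact mul_le_mul_of_nonneg_left h1 (hb.trans hGa)
  have h3 := abs_sub (G b * V b - G a * V a) (∫ t in a..b, G' t * V t)
  have h4 := abs_sub (G b * V b) (G a * V a)
  nlinarith

lemma hasDerivAt_mertG {t : ℝ} (ht : 1 < t) :
    HasDerivAt mertG (-((2 / Real.log t ^ 3 + 6 / Real.log t ^ 4) / t)) t := by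
  have hl : 0 < Real.log t := Real.log_pos ht
  have h := Real.hasDerivAt_log (show t ≠ 0 by linarith)
  have := ((hasDerivAt_const t (1:ℝ)).div (h.pow 2) (pow_ne_zero 2 hl.ne')).add
    ((hasDerivAt_const t (2:ℝ)).div (h.pow 3) (pow_ne_zero 3 hl.ne'))
  refine HasDerivAt.congr_deriv this ?_
  have ht' : t ≠ 0 := by linarith
  simp only [Pi.pow_apply]
  field_simp
  ring

/-- A primitive of `zeroTerm ρ t / t`. -/
noncomputable def zeroPrim (ρ : XiZero) (t : ℝ) : ℝ :=
  xiMult ρ * ((t : ℂ) ^ ((ρ : ℂ) - 1) / (ρ - 1) / (ρ * (1 - ρ))).re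

lemma hasDerivAt_zeroPrim (ρ : XiZero) {t : ℝ} (ht : 0 < t) :
    HasDerivAt (zeroPrim ρ) (zeroTerm ρ t / t) t := by
  have h1 : (ρ : ℂ) - 1 ≠ 0 := fun h => ρ.one_sub_ne_zero (by rw [← neg_sub, h, neg_zero])
  have htc : (t : ℂ) ≠ 0 := by exact_mod_cast ht.ne'
  have h := hasDerivAt_ofReal_cpow_const (x := t) (r := (ρ : ℂ) - 1) ht.ne' h1
  have h3 := (Complex.reCLM.hasFDerivAt.comp_hasDerivAt t
    ((h.div_const ((ρ : ℂ) - 1)).div_const ((ρ : ℂ) * (1 - ρ)))).const_mul (xiMult ρ)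
  refine HasDerivAt.congr_deriv h3 ?_
  rw [Complex.reCLM_apply, zeroTerm, Complex.cpow_sub _ _ htc, Complex.cpow_one,
    mul_div_cancel_left₀ _ h1]
  have : (t : ℂ) ^ ((ρ : ℂ) - 1) / t / (ρ * (1 - ρ)) =
      ((1 / t : ℝ) : ℂ) * ((t : ℂ) ^ ((ρ : ℂ) - 1) / (ρ * (1 - ρ))) := by push_cast; ring
  rw [this, Complex.re_ofReal_mul]
  ring

lemma abs_zeroPrim_le (ρ : XiZero) {t : ℝ} (ht : 0 < t) :
    |zeroPrim ρ t| ≤ xiMult ρ / (ρ : ℂ).im ^ 2 * t ^ ((ρ : ℂ).re - 1) / 6.5 := by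
  have h1 := ρ.norm_mul_ge
  have h0 : 0 < (ρ : ℂ).im ^ 2 := by have := ρ.im_sq_gt; linarith
  have h2 : 6.5 ≤ ‖(ρ : ℂ) - 1‖ := by
    have := Complex.abs_im_le_norm ((ρ : ℂ) - 1)
    simp only [Complex.sub_im, Complex.one_im, sub_zero] at this
    exact ρ.abs_im_gt.le.trans this
  rw [zeroPrim, abs_mul, abs_of_nonneg (xiMult_nonneg ρ)]
  have e : xiMult ρ / (ρ : ℂ).im ^ 2 * t ^ ((ρ : ℂ).re - 1) / 6.5 =
      xiMult ρ * (t ^ ((ρ : ℂ).re - 1) / 6.5 / (ρ : ℂ).im ^ 2) := by ring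
  rw [e]
  refine mul_le_mul_of_nonneg_left ?_ (xiMult_nonneg ρ)
  refine (Complex.abs_re_le_norm _).trans ?_
  rw [norm_div, norm_div, Complex.norm_cpow_eq_rpow_re_of_pos ht]
  simp only [Complex.sub_re, Complex.one_re]
  have h3 := Real.rpow_nonneg ht.le ((ρ : ℂ).re - 1)
  exact div_le_div₀ (by positivity) (div_le_div_of_nonneg_left h3 (by norm_num) h2) h0 h1

lemma continuousOn_zeroTerm (ρ : XiZero) : ContinuousOn (zeroTerm ρ) (Set.Ioi 1) := by
  intro t ht
  have ht1 : (1:ℝ) < t := ht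
  have h : ContinuousAt (fun t : ℝ => (t : ℂ) ^ ((ρ : ℂ) - 1)) t := by
    refine (continuousAt_cpow_const ?_).comp Complex.continuous_ofReal.continuousAt
    left; simp; linarith
  unfold zeroTerm
  exact (continuousAt_const.mul (Complex.continuous_re.continuousAt.comp
    (h.div_const _))).continuousWithinAt

lemma abs_zeroTerm_le_of_le (ρ : XiZero) {a t : ℝ} (ha : 0 < a) (hat : a ≤ t) :
    |zeroTerm ρ t| ≤ xiMult ρ / (ρ : ℂ).im ^ 2 * a ^ ((ρ : ℂ).re - 1) := by
  refine (abs_zeroTerm_le ρ (ha.trans_le hat)).trans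
    (mul_le_mul_of_nonneg_left ?_ (xiWeight_nonneg ρ))
  exact Real.rpow_le_rpow_of_nonpos ha hat (by linarith [ρ.re_lt_one])

lemma abs_integral_zeroTerm_le (ρ : XiZero) {a b : ℝ} (ha : 1 < a) (hab : a ≤ b) :
    |∫ t in a..b, mertG t / t * zeroTerm ρ t| ≤
      2 / 6.5 * mertG a * (xiMult ρ / (ρ : ℂ).im ^ 2 * a ^ ((ρ : ℂ).re - 1)) := by
  have hsub : Set.Icc a b ⊆ Set.Ioi 1 := fun t ht => ha.trans_le ht.1
  have h0 : ∀ t ∈ Set.Icc a b, t ≠ 0 := fun t ht => by have := ht.1; linarith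
  have e : ∀ t, mertG t / t * zeroTerm ρ t = mertG t * (zeroTerm ρ t / t) := fun t => by ring
  simp only [e]
  have hlc : ContinuousOn Real.log (Set.Icc a b) := continuousOn_log_Ioi_one.mono hsub
  have hl : ∀ t ∈ Set.Icc a b, Real.log t ≠ 0 := fun t ht => (Real.log_pos (hsub ht)).ne'
  refine (abs_integral_mul_deriv_le (G := mertG) (V := zeroPrim ρ)
    (C := xiMult ρ / (ρ : ℂ).im ^ 2 * a ^ ((ρ : ℂ).re - 1) / 6.5) hab
    (fun t ht => hasDerivAt_mertG (hsub ht))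
    (fun t ht => hasDerivAt_zeroPrim ρ (by linarith [ht.1])) ?_
    (((continuousOn_zeroTerm ρ).mono hsub).div continuousOn_id h0) (fun t ht => ?_)
    (mertG_pos (ha.trans_le hab)).le fun t ht => ?_).trans (le_of_eq (by ring))
  · exact ((((continuousOn_const.div (hlc.pow 3) fun t ht => pow_ne_zero _ (hl t ht)).add
      (continuousOn_const.div (hlc.pow 4) fun t ht => pow_ne_zero _ (hl t ht)))).div
      continuousOn_id h0).neg
  · have := Real.log_pos (hsub ht)
    have ht0 : 0 < t := by linarith [ht.1]
    rw [neg_nonpos]; positivity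
  · refine (abs_zeroPrim_le ρ (by linarith [ht.1])).trans ?_
    refine div_le_div_of_nonneg_right (mul_le_mul_of_nonneg_left ?_ (xiWeight_nonneg ρ)) (by norm_num)
    exact Real.rpow_le_rpow_of_nonpos (by linarith) ht.1 (by linarith [ρ.re_lt_one])

lemma integral_mertG_div {a b : ℝ} (ha : 1 < a) (hab : a ≤ b) :
    ∫ t in a..b, mertG t / t = mertW a - mertW b := by
  have h := intervalIntegral.integral_eq_sub_of_hasDerivAt (f := mertW)
    (f' := fun t => -(mertG t / t)) (a := a) (b := b) (fun t ht => ?_)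
    (intervalIntegrable_of_Ioi_one continuousOn_mertG_div ha hab).neg
  · rw [intervalIntegral.integral_neg] at h
    linarith
  · rw [Set.uIcc_of_le hab] at ht
    exact hasDerivAt_mertW (ha.trans_le ht.1)

lemma continuousOn_rieszErr : ContinuousOn rieszErr (Set.Ioi 1) := by
  intro t ht
  have ht1 : (1:ℝ) < t := ht
  obtain ⟨N, hN⟩ := exists_nat_gt t
  have e : rieszErr =ᶠ[nhds t] fun y => (∑ n ∈ Ioc 0 N, ArithmeticFunction.vonMangoldt n *
      max (1 / n - 1 / y) 0) - Real.log y + 1 + Real.eulerMascheroniConstant := by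
    filter_upwards [gt_mem_nhds hN, lt_mem_nhds ht1] with y hy hy1
    rw [rieszErr, rieszMean_eq_sum (by linarith) (le_of_lt hy)]
  refine ContinuousAt.continuousWithinAt (ContinuousAt.congr ?_ e.symm)
  have h1 : ContinuousAt (fun y : ℝ => 1 / y) t := by
    simpa only [one_div] using continuousAt_inv₀ (show t ≠ 0 by linarith)
  have h2 : ContinuousAt Real.log t := Real.continuousAt_log (by linarith)
  fun_prop

theorem abs_mertQ_sub_le {a b : ℝ} (ha : 1 < a) (hab : a ≤ b) :
    |mertQ b - mertQ a| ≤ 2 / 6.5 * mertG a * zeroSum a + 3.3 / a * mertW a := by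
  have hsub : Set.Icc a b ⊆ Set.Ioi 1 := fun t ht => ha.trans_le ht.1
  have ha0 : 0 < a := by linarith
  have hz : ContinuousOn (fun t => ∑' ρ, zeroTerm ρ t) (Set.Icc a b) :=
    continuousOn_tsum (fun ρ => (continuousOn_zeroTerm ρ).mono hsub) (summable_zeroSum ha.le)
      fun ρ t ht => abs_zeroTerm_le_of_le ρ ha0 ht.1
  have hG : ContinuousOn (fun t => mertG t / t) (Set.Icc a b) := continuousOn_mertG_div.mono hsub
  have hE : ContinuousOn rieszErr (Set.Icc a b) := continuousOn_rieszErr.mono hsub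
  have hu : Set.uIcc a b = Set.Icc a b := Set.uIcc_of_le hab
  have int : ∀ {g : ℝ → ℝ}, ContinuousOn g (Set.Icc a b) →
      IntervalIntegrable (fun t => mertG t / t * g t) MeasureTheory.volume a b := fun hg =>
    ContinuousOn.intervalIntegrable (by rw [hu]; exact hG.mul hg)
  have iz := int hz
  have iT : IntervalIntegrable (fun t => mertG t / t * rieszTail t) MeasureTheory.volume a b :=
    int (hE.sub hz)
  have split : mertQ b - mertQ a = (∫ t in a..b, mertG t / t * ∑' ρ, zeroTerm ρ t) +
      ∫ t in a..b, mertG t / t * rieszTail t := by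
    rw [← integral_mertG_mul_rieszErr ha hab, ← intervalIntegral.integral_add iz iT]
    refine intervalIntegral.integral_congr fun t _ => ?_
    rw [rieszErr_eq]; ring
  have hGp : ∀ t ∈ Set.Icc a b, 0 ≤ mertG t / t := fun t ht =>
    div_nonneg (mertG_pos (hsub ht)).le (by linarith [ht.1])
  have b1 : |∫ t in a..b, mertG t / t * ∑' ρ, zeroTerm ρ t| ≤ 2 / 6.5 * mertG a * zeroSum a := by
    have hs := intervalIntegral.hasSum_integral_of_dominated_convergence
      (μ := MeasureTheory.volume) (a := a) (b := b)
      (F := fun (ρ : XiZero) t => mertG t / t * zeroTerm ρ t)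
      (f := fun t => mertG t / t * ∑' ρ, zeroTerm ρ t)
      (fun ρ t => mertG t / t * (xiMult ρ / (ρ : ℂ).im ^ 2 * a ^ ((ρ : ℂ).re - 1))) ?_ ?_ ?_ ?_ ?_
    · rw [← hs.tsum_eq, zeroSum, ← tsum_mul_left]
      exact tsum_of_norm_bounded (f := fun ρ => ∫ t in a..b, mertG t / t * zeroTerm ρ t)
        ((summable_zeroSum ha.le).mul_left _).hasSum
        fun ρ => abs_integral_zeroTerm_le ρ ha hab
    · intro ρ
      have : ContinuousOn (fun t => mertG t / t * zeroTerm ρ t) (Set.uIoc a b) := by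
        refine (hG.mul ((continuousOn_zeroTerm ρ).mono hsub)).mono ?_
        rw [Set.uIoc_of_le hab]; exact Set.Ioc_subset_Icc_self
      exact this.aestronglyMeasurable measurableSet_uIoc
    · refine fun ρ => Eventually.of_forall fun t ht => ?_
      rw [Set.uIoc_of_le hab] at ht
      have ht' := Set.Ioc_subset_Icc_self ht
      rw [norm_mul, Real.norm_of_nonneg (hGp t ht'), Real.norm_eq_abs]
      exact mul_le_mul_of_nonneg_left (abs_zeroTerm_le_of_le ρ ha0 ht'.1) (hGp t ht')
    · exact Eventually.of_forall fun t _ => (summable_zeroSum ha.le).mul_left _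
    · simp only [tsum_mul_left]
      exact (ContinuousOn.intervalIntegrable (by rwa [hu])).mul_const _
    · refine Eventually.of_forall fun t ht => ?_
      rw [Set.uIoc_of_le hab] at ht
      exact (summable_zeroTerm (by linarith [ht.1])).hasSum.mul_left (mertG t / t)
  have b2 : |∫ t in a..b, mertG t / t * rieszTail t| ≤ 3.3 / a * mertW a := by
    have h := intervalIntegral.norm_integral_le_of_norm_le (μ := MeasureTheory.volume)
      (f := fun t => mertG t / t * rieszTail t) (g := fun t => mertG t / t * (3.3 / a)) hab
      (Eventually.of_forall fun t ht => ?_)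
      ((intervalIntegrable_of_Ioi_one continuousOn_mertG_div ha hab).mul_const _)
    · rw [intervalIntegral.integral_mul_const, integral_mertG_div ha hab, Real.norm_eq_abs] at h
      refine h.trans ?_
      rw [mul_comm]
      have := mertW_pos (ha.trans_le hab)
      gcongr
      linarith
    · have ht' := Set.Ioc_subset_Icc_self ht
      rw [norm_mul, Real.norm_of_nonneg (hGp t ht'), Real.norm_eq_abs]
      refine mul_le_mul_of_nonneg_left ((abs_rieszTail_le (by linarith [ht'.1])).trans ?_) (hGp t ht')
      exact div_le_div_of_nonneg_left (by norm_num) ha0 ht'.1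
  rw [split]
  exact (abs_add_le _ _).trans (add_le_add b1 b2)

/-- `∑ Λ(n) / (n log n) n^(-δ)`. -/
noncomputable def mertS (δ : ℝ) : ℝ :=
  ∑' n : ℕ, ArithmeticFunction.vonMangoldt n / (n * Real.log n) * (n : ℝ) ^ (-δ)

lemma mert_coeff_nonneg (n : ℕ) : 0 ≤ ArithmeticFunction.vonMangoldt n / (n * Real.log n) :=
  div_nonneg ArithmeticFunction.vonMangoldt_nonneg
    (mul_nonneg n.cast_nonneg (Real.log_natCast_nonneg n))

lemma summable_mertS {δ : ℝ} (hδ : 0 < δ) : Summable fun n : ℕ =>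
    ArithmeticFunction.vonMangoldt n / (n * Real.log n) * (n : ℝ) ^ (-δ) := by
  have h : Summable fun n : ℕ => (n : ℝ) ^ (-(1 + δ)) :=
    Real.summable_nat_rpow.2 (by linarith)
  refine Summable.of_nonneg_of_le (fun n => mul_nonneg (mert_coeff_nonneg n) (by positivity))
    (fun n => ?_) h
  rcases Nat.lt_or_ge n 2 with hn | hn
  · have h0 : Real.log n = 0 := by interval_cases n <;> simp
    rw [h0]; simp; positivity
  have hn0 : (0:ℝ) < n := by positivity
  have hl : 0 < Real.log n := Real.log_pos (by exact_mod_cast hn)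
  rw [neg_add, Real.rpow_add hn0, Real.rpow_neg_one]
  gcongr
  rw [div_le_iff₀ (by positivity), ← mul_assoc, inv_mul_cancel₀ hn0.ne', one_mul]
  exact ArithmeticFunction.vonMangoldt_le_log

lemma exp_mertS {δ : ℝ} (hδ : 0 < δ) :
    (Real.exp (mertS δ) : ℂ) = riemannZeta (1 + δ) := by
  rw [← riemannZeta_eq_exp_LSeries (by simpa), LSeries, mertS]
  push_cast
  congr 1
  refine tsum_congr fun n => ?_
  rcases eq_or_ne n 0 with rfl | hn
  · simp
  have hn0 : (n:ℂ) ≠ 0 := by exact_mod_cast hn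
  rw [LSeries.term_of_ne_zero hn, Complex.cpow_add _ _ hn0, Complex.cpow_one,
    Complex.ofReal_cpow n.cast_nonneg]
  push_cast
  rw [Complex.cpow_neg]
  ring

lemma tendsto_mertS_add_log :
    Tendsto (fun δ => mertS δ + Real.log δ) (nhdsWithin 0 (Set.Ioi 0)) (nhds 0) := by
  have h1 : Tendsto (fun δ : ℝ => (1 + δ : ℂ)) (nhdsWithin 0 (Set.Ioi 0))
      (nhdsWithin 1 {1}ᶜ) := by
    refine tendsto_nhdsWithin_iff.2 ⟨?_, ?_⟩
    · have : Continuous fun δ : ℝ => (1 + δ : ℂ) := by fun_prop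
      have := (this.tendsto 0).mono_left (nhdsWithin_le_nhds (s := Set.Ioi (0:ℝ)))
      simpa using this
    · filter_upwards [self_mem_nhdsWithin] with δ hδ
      simpa using (ne_of_gt (Set.mem_Ioi.1 hδ))
  have h2 := (riemannZeta_residue_one.comp h1).norm
  rw [norm_one] at h2
  have h3 := (Real.continuousAt_log one_ne_zero).tendsto.comp h2
  rw [Real.log_one] at h3
  refine h3.congr' ?_
  filter_upwards [self_mem_nhdsWithin] with δ hδ
  have hδ : 0 < δ := hδ
  simp only [Function.comp_apply, add_sub_cancel_left]
  rw [← exp_mertS hδ, ← Complex.ofReal_mul, Complex.norm_real, Real.norm_of_nonneg (by positivity),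
    Real.log_mul hδ.ne' (Real.exp_ne_zero _), Real.log_exp, add_comm]

lemma mertPi_exp_eq {u : ℝ} : mertPi (Real.exp u) =
    ∑' n : ℕ, if Real.log n ≤ u then
      ArithmeticFunction.vonMangoldt n / (n * Real.log n) else 0 := by
  rw [tsum_eq_sum (s := Ioc 0 ⌊Real.exp u⌋₊), mertPi]
  · refine sum_congr rfl fun n hn => ?_
    rw [mem_Ioc] at hn
    rw [if_pos]
    rw [Real.log_le_iff_le_exp (by exact_mod_cast hn.1)]
    exact (Nat.le_floor_iff (Real.exp_pos _).le).1 hn.2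
  · intro n hn
    rcases Nat.eq_zero_or_pos n with rfl | h0
    · simp
    rw [if_neg]
    rw [Real.log_le_iff_le_exp (by exact_mod_cast h0)]
    intro h
    exact hn (mem_Ioc.2 ⟨h0, Nat.le_floor h⟩)

lemma integral_exp_neg_mul_mertPi {δ : ℝ} (hδ : 0 < δ) :
    ∫ v in Set.Ioi (0:ℝ), Real.exp (-v) * mertPi (Real.exp (v / δ)) = mertS δ := by
  set a : ℕ → ℝ := fun n => ArithmeticFunction.vonMangoldt n / (n * Real.log n) with ha
  set F : ℕ → ℝ → ℝ := fun n => (Set.Ici (δ * Real.log n)).indicator fun v => Real.exp (-v) * a n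
    with hF
  have hII (n : ℕ) : MeasureTheory.IntegrableOn (fun v => Real.exp (-v) * a n)
      (Set.Ici (δ * Real.log n)) :=
    ((integrableOn_Ici_iff_integrableOn_Ioi (by simp)).2 (integrableOn_exp_neg_Ioi _)).mul_const _
  have hFi (n : ℕ) : MeasureTheory.IntegrableOn (F n) (Set.Ioi 0) :=
    ((MeasureTheory.integrable_indicator_iff measurableSet_Ici).2 (hII n)).integrableOn
  have hFn (n : ℕ) (v : ℝ) : ‖F n v‖ = F n v := Real.norm_of_nonneg <|
    Set.indicator_nonneg (fun v _ => mul_nonneg (Real.exp_pos _).le (mert_coeff_nonneg n)) v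
  have hI (n : ℕ) : ∫ v in Set.Ioi (0:ℝ), F n v = a n * (n : ℝ) ^ (-δ) := by
    rcases Nat.eq_zero_or_pos n with rfl | h0
    · simp [hF, ha]
    have h1 : (1:ℝ) ≤ n := by exact_mod_cast h0
    rw [← MeasureTheory.integral_Ici_eq_integral_Ioi, MeasureTheory.setIntegral_indicator measurableSet_Ici,
      Set.inter_eq_self_of_subset_right (Set.Ici_subset_Ici.2
        (mul_nonneg hδ.le (Real.log_nonneg h1))), MeasureTheory.integral_Ici_eq_integral_Ioi,
      MeasureTheory.integral_mul_const, integral_exp_neg_Ioi, Real.rpow_def_of_pos (by linarith), mul_comm]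
    ring_nf
  have h := MeasureTheory.hasSum_integral_of_summable_integral_norm
    (μ := MeasureTheory.volume.restrict (Set.Ioi (0:ℝ))) (F := F) hFi (by
      simp only [hFn, hI]; exact summable_mertS hδ)
  simp only [hI] at h
  rw [mertS, h.tsum_eq]
  refine MeasureTheory.integral_congr_ae (Eventually.of_forall fun v => ?_)
  simp only
  rw [mertPi_exp_eq, ← tsum_mul_left]
  refine tsum_congr fun n => ?_
  simp only [hF, Set.indicator_apply, Set.mem_Ici, le_div_iff₀ hδ, mul_comm δ]
  split_ifs <;> simp [ha]

lemma monotone_mertPi : Monotone mertPi := fun x y h => by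
  refine sum_le_sum_of_subset_of_nonneg (fun n hn => ?_) fun n _ _ => mert_coeff_nonneg n
  rw [mem_Ioc] at hn ⊢
  exact ⟨hn.1, hn.2.trans (Nat.floor_mono h)⟩

lemma mertPi_eq_zero {y : ℝ} (hy : y < 2) : mertPi y = 0 := by
  refine sum_eq_zero fun n hn => ?_
  rw [mem_Ioc] at hn
  have : ⌊y⌋₊ < 2 := (Nat.floor_lt' two_ne_zero).2 hy
  have : n = 1 := by omega
  simp [this]

/-- The total oscillation of `mertQ` beyond `a`. -/
noncomputable def mertTail (a : ℝ) : ℝ := 2 / 6.5 * mertG a * zeroSum a + 3.3 / a * mertW a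

lemma zeroSum_le_const {t : ℝ} (ht : 1 ≤ t) : zeroSum t ≤ 0.05 := by
  have h := zeroSum_le ht
  have : 1 / t ≤ 1 := by rw [div_le_one (by linarith)]; exact ht
  linarith

lemma tendsto_mertW : Tendsto mertW atTop (nhds 0) := by
  have h := Real.tendsto_log_atTop.inv_tendsto_atTop
  have := h.add (h.pow 2)
  simp only [ne_eq, OfNat.ofNat_ne_zero, not_false_eq_true, zero_pow, add_zero] at this
  refine this.congr fun x => ?_
  simp [mertW]

lemma tendsto_mertG : Tendsto mertG atTop (nhds 0) := by
  have h := Real.tendsto_log_atTop.inv_tendsto_atTop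
  have := (h.pow 2).add ((h.pow 3).const_mul 2)
  simp only [ne_eq, OfNat.ofNat_ne_zero, not_false_eq_true, zero_pow, add_zero, mul_zero] at this
  refine this.congr fun x => ?_
  simp [mertG, div_eq_mul_inv]

lemma tendsto_mertTail : Tendsto mertTail atTop (nhds 0) := by
  have h := (tendsto_mertG.const_mul 0.05).add (tendsto_mertW.const_mul 3.3)
  simp only [mul_zero, add_zero] at h
  refine squeeze_zero' ?_ ?_ h
  · filter_upwards [eventually_gt_atTop 1] with a ha
    have := mertG_pos ha
    have := mertW_pos ha
    have := zeroSum_nonneg a (by linarith)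
    unfold mertTail; positivity
  · filter_upwards [eventually_gt_atTop 1] with a ha
    have h1 := mertG_pos ha
    have h2 := mertW_pos ha
    have h0 := zeroSum_nonneg a (by linarith)
    have h3 := zeroSum_le_const ha.le
    unfold mertTail
    refine add_le_add ?_ ?_
    · nlinarith [mul_le_mul_of_nonneg_left h3 h1.le, mul_nonneg h1.le h0]
    · refine mul_le_mul_of_nonneg_right ?_ h2.le
      rw [div_le_iff₀ (by linarith)]; linarith

lemma exists_tendsto_mertQ : ∃ M, Tendsto mertQ atTop (nhds M) := by
  have hC : CauchySeq fun y : ℝ => mertQ (max y 2) := by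
    refine cauchySeq_of_le_tendsto_0 (fun y => mertTail (max y 2) + mertTail (max y 2))
      (fun x y N hx hy => ?_) ?_
    · have h0 : (1:ℝ) < max N 2 := lt_max_of_lt_right (by norm_num)
      have h1 := abs_mertQ_sub_le h0 (max_le_max_right 2 hx)
      have h2 := abs_mertQ_sub_le h0 (max_le_max_right 2 hy)
      refine (dist_triangle_right _ _ (mertQ (max N 2))).trans (add_le_add ?_ ?_)
      · rw [Real.dist_eq]; exact h1
      · rw [Real.dist_eq]; exact h2
    · have : Tendsto (fun y : ℝ => max y 2) atTop atTop :=
        tendsto_atTop_mono (fun y => le_max_left y 2) tendsto_id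
      have h := tendsto_mertTail.comp this
      simpa using h.add h
  obtain ⟨M, hM⟩ := cauchySeq_tendsto_of_complete hC
  refine ⟨M, hM.congr' ?_⟩
  filter_upwards [eventually_ge_atTop 2] with y hy
  rw [max_eq_left hy]

lemma abs_mertPi_sub_sub_le {y : ℝ} (hy : 2 ≤ y) :
    |mertPi y - Real.log (Real.log y) - mertQ y| ≤ 5 * mertW y + 6 / Real.log y := by
  have hl : 0 < Real.log y := Real.log_pos (by linarith)
  have h1 := abs_rieszErr_le (show 1 ≤ y by linarith)
  have h2 := zeroSum_le_const (show 1 ≤ y by linarith)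
  have h3 : 3.3 / y ≤ 3.3 := by rw [div_le_iff₀ (by linarith)]; linarith
  have hw := mertW_pos (show 1 < y by linarith)
  have h4 := Chebyshev.psi_le_const_mul_self (show 0 ≤ y by linarith)
  have h5 := Chebyshev.psi_nonneg y
  have h6 : Real.log 4 ≤ 1.4 := by
    rw [show (4:ℝ) = 2 ^ 2 by norm_num, Real.log_pow]; push_cast; linarith [Real.log_two_lt_d9]
  have e : mertPi y - Real.log (Real.log y) - mertQ y =
      mertW y * rieszErr y + (Chebyshev.psi y - y) / (y * Real.log y) := by
    unfold mertQ; ring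
  rw [e]
  refine (abs_add_le _ _).trans (add_le_add ?_ ?_)
  · rw [abs_mul, abs_of_pos hw, mul_comm]; gcongr; linarith
  · rw [abs_div, abs_of_pos (mul_pos (show 0 < y by linarith) hl), div_le_div_iff₀ (by positivity) hl,
      ← mul_assoc]
    gcongr
    rw [abs_le]
    constructor <;> nlinarith

lemma mertW_le_mertW {x y : ℝ} (hx : 1 < x) (h : x ≤ y) : mertW y ≤ mertW x := by
  have := Real.log_pos hx
  have := Real.log_le_log (by linarith) h
  unfold mertW; gcongr

lemma exists_abs_mertPi_sub_le :
    ∃ C, ∀ y : ℝ, 2 ≤ y → |mertPi y - Real.log (Real.log y)| ≤ C := by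
  refine ⟨5 * mertW 2 + 6 / Real.log 2 + (mertTail 2 + |mertQ 2|), fun y hy => ?_⟩
  have h1 := abs_mertPi_sub_sub_le hy
  have h2 := abs_mertQ_sub_le (show (1:ℝ) < 2 by norm_num) hy
  have h3 := mertW_le_mertW (show (1:ℝ) < 2 by norm_num) hy
  have hl := Real.log_pos (show (1:ℝ) < 2 by norm_num)
  have h4 : 6 / Real.log y ≤ 6 / Real.log 2 := by
    have := Real.log_le_log (by norm_num) hy
    gcongr
  have h5 : |mertQ y| ≤ mertTail 2 + |mertQ 2| := by
    have := abs_sub_abs_le_abs_sub (mertQ y) (mertQ 2)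
    unfold mertTail; linarith
  have h6 := abs_sub_abs_le_abs_sub (mertPi y - Real.log (Real.log y)) (mertQ y)
  linarith

lemma tendsto_mertPi_sub {M : ℝ} (hM : Tendsto mertQ atTop (nhds M)) :
    Tendsto (fun y => mertPi y - Real.log (Real.log y)) atTop (nhds M) := by
  have h := (tendsto_mertW.const_mul 5).add (Real.tendsto_log_atTop.inv_tendsto_atTop.const_mul 6)
  simp only [mul_zero, add_zero] at h
  have h0 : Tendsto (fun y => mertPi y - Real.log (Real.log y) - mertQ y) atTop (nhds 0) := by
    refine squeeze_zero_norm' ?_ h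
    filter_upwards [eventually_ge_atTop 2] with y hy
    simpa [div_eq_mul_inv] using abs_mertPi_sub_sub_le hy
  have := h0.add hM
  simpa using this

lemma abs_log_le_rpow {v : ℝ} (hv : 0 < v) : |Real.log v| ≤ v + 2 * v ^ (-(1/2) : ℝ) := by
  have h0 : 0 < v ^ (-(1/2) : ℝ) := Real.rpow_pos_of_pos hv _
  have h1 := Real.log_le_sub_one_of_pos hv
  have h2 := Real.log_le_sub_one_of_pos h0
  rw [Real.log_rpow hv] at h2
  rw [abs_le]; constructor <;> linarith

lemma integrable_exp_neg_mul_abs_log : MeasureTheory.IntegrableOn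
    (fun v : ℝ => Real.exp (-v) * |Real.log v|) (Set.Ioi 0) := by
  have h1 := Real.GammaIntegral_convergent (show (0:ℝ) < 2 by norm_num)
  have h2 := Real.GammaIntegral_convergent (show (0:ℝ) < 1/2 by norm_num)
  refine (h1.add (h2.const_mul 2)).mono' ?_ ?_
  · exact (Measurable.mul (by fun_prop) (Real.measurable_log.abs)).aestronglyMeasurable
  · refine (MeasureTheory.ae_restrict_iff' measurableSet_Ioi).2 (Eventually.of_forall fun v hv => ?_)
    have h := abs_log_le_rpow hv
    rw [Real.norm_of_nonneg (by positivity)]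
    simp only [Pi.add_apply]
    have e1 : v ^ ((2:ℝ) - 1) = v := by norm_num
    have e2 : ((1:ℝ)/2 - 1) = -(1/2) := by norm_num
    rw [e1, e2]
    nlinarith [mul_le_mul_of_nonneg_left h (Real.exp_pos (-v)).le]

lemma integral_exp_neg_mul_log :
    ∫ v in Set.Ioi (0:ℝ), Real.exp (-v) * Real.log v = -Real.eulerMascheroniConstant := by
  have h1 := Complex.hasDerivAt_GammaIntegral (s := 1) (by simp)
  have h2 : HasDerivAt Complex.Gamma _ 1 := h1.congr_of_eventuallyEq (by
    have : IsOpen {s : ℂ | 0 < s.re} := isOpen_lt continuous_const Complex.continuous_re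
    filter_upwards [this.mem_nhds (by simp)] with a ha using Complex.Gamma_eq_integral ha)
  have h3 := h2.unique Complex.hasDerivAt_Gamma_one
  have h4 : ∫ v in Set.Ioi (0:ℝ), (v:ℂ) ^ ((1:ℂ) - 1) * (Real.log v * Real.exp (-v)) =
      ((∫ v in Set.Ioi (0:ℝ), Real.exp (-v) * Real.log v : ℝ) : ℂ) := by
    rw [← integral_complex_ofReal]
    refine MeasureTheory.integral_congr_ae (Eventually.of_forall fun v => ?_)
    simp [mul_comm]
  rw [h4] at h3
  exact_mod_cast h3

theorem tendsto_mertQ : Tendsto mertQ atTop (nhds Real.eulerMascheroniConstant) := by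
  obtain ⟨M, hM⟩ := exists_tendsto_mertQ
  suffices M = Real.eulerMascheroniConstant by rwa [← this]
  obtain ⟨C, hC⟩ := exists_abs_mertPi_sub_le
  have hC0 : 0 ≤ C := (abs_nonneg _).trans (hC 2 le_rfl)
  have hP := tendsto_mertPi_sub hM
  have ie : MeasureTheory.IntegrableOn (fun v : ℝ => Real.exp (-v)) (Set.Ioi 0) :=
    integrableOn_exp_neg_Ioi 0
  have il : MeasureTheory.IntegrableOn (fun v : ℝ => Real.exp (-v) * Real.log v) (Set.Ioi 0) := by
    refine integrable_exp_neg_mul_abs_log.mono'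
      (Measurable.mul (by fun_prop) Real.measurable_log).aestronglyMeasurable
      (Eventually.of_forall fun v => ?_)
    rw [norm_mul, Real.norm_of_nonneg (Real.exp_pos _).le, Real.norm_eq_abs]
  have hlim : Tendsto (fun δ : ℝ => ∫ v in Set.Ioi (0:ℝ),
      Real.exp (-v) * (mertPi (Real.exp (v / δ)) + Real.log δ)) (nhdsWithin 0 (Set.Ioi 0))
      (nhds (∫ v in Set.Ioi (0:ℝ), Real.exp (-v) * (M + Real.log v))) := by
    refine MeasureTheory.tendsto_integral_filter_of_dominated_convergence
      (fun v => Real.exp (-v) * C + Real.exp (-v) * |Real.log v|) ?_ ?_ ?_ ?_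
    · refine Eventually.of_forall fun δ => Measurable.aestronglyMeasurable ?_
      exact (by fun_prop : Measurable fun v : ℝ => Real.exp (-v)).mul
        ((monotone_mertPi.measurable.comp (by fun_prop)).add_const _)
    · filter_upwards [Ioo_mem_nhdsGT (show (0:ℝ) < 1 by norm_num)] with δ hδ
      refine (MeasureTheory.ae_restrict_iff' measurableSet_Ioi).2
        (Eventually.of_forall fun v hv => ?_)
      have hv : 0 < v := hv
      rw [norm_mul, Real.norm_of_nonneg (Real.exp_pos _).le, ← mul_add, Real.norm_eq_abs]
      gcongr
      rcases le_or_gt 2 (Real.exp (v / δ)) with h | h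
      · have h1 := hC _ h
        rw [Real.log_exp, Real.log_div hv.ne' hδ.1.ne'] at h1
        calc _ = |(mertPi (Real.exp (v / δ)) - (Real.log v - Real.log δ)) + Real.log v| := by
              congr 1; ring
          _ ≤ _ := (abs_add_le _ _).trans (by gcongr)
      · rw [mertPi_eq_zero h, zero_add]
        have h1 : v / δ < 1 := by
          have := Real.add_one_le_exp (v / δ)
          linarith
        rw [div_lt_one hδ.1] at h1
        have h2 := Real.log_lt_log hv h1
        have h3 := Real.log_neg hδ.1 hδ.2
        rw [abs_of_neg h3, abs_of_neg (h2.trans h3)]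
        linarith
    · exact (ie.mul_const C).add integrable_exp_neg_mul_abs_log
    · refine (MeasureTheory.ae_restrict_iff' measurableSet_Ioi).2
        (Eventually.of_forall fun v hv => ?_)
      have hv : 0 < v := hv
      refine Tendsto.const_mul _ ?_
      have h1 : Tendsto (fun δ : ℝ => Real.exp (v / δ)) (nhdsWithin 0 (Set.Ioi 0)) atTop :=
        Real.tendsto_exp_atTop.comp (tendsto_inv_nhdsGT_zero.const_mul_atTop hv)
      refine ((hP.comp h1).add_const (Real.log v)).congr' ?_
      filter_upwards [self_mem_nhdsWithin] with δ hδ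
      have hδ : 0 < δ := hδ
      simp only [Function.comp_apply]
      rw [Real.log_exp, Real.log_div hv.ne' hδ.ne']; ring
  have hval : ∫ v in Set.Ioi (0:ℝ), Real.exp (-v) * (M + Real.log v) =
      M - Real.eulerMascheroniConstant := by
    simp only [mul_add]
    rw [MeasureTheory.integral_add (ie.mul_const M) il, MeasureTheory.integral_mul_const,
      integral_exp_neg_mul_log, integral_exp_neg_Ioi_zero]
    ring
  have hII {δ : ℝ} (hδ : 0 < δ) : ∫ v in Set.Ioi (0:ℝ),
      Real.exp (-v) * (mertPi (Real.exp (v / δ)) + Real.log δ) = mertS δ + Real.log δ := by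
    have hi : MeasureTheory.IntegrableOn
        (fun v : ℝ => Real.exp (-v) * mertPi (Real.exp (v / δ))) (Set.Ioi 0) := by
      refine MeasureTheory.Integrable.of_integral_ne_zero ?_
      rw [integral_exp_neg_mul_mertPi hδ]
      refine ((summable_mertS hδ).tsum_pos
        (fun n => mul_nonneg (mert_coeff_nonneg n) (by positivity)) 2 ?_).ne'
      have := Real.log_pos (show (1:ℝ) < 2 by norm_num)
      rw [ArithmeticFunction.vonMangoldt_apply_prime Nat.prime_two]
      push_cast
      positivity
    simp only [mul_add]
    rw [MeasureTheory.integral_add hi (ie.mul_const _), MeasureTheory.integral_mul_const,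
      integral_exp_neg_mul_mertPi hδ, integral_exp_neg_Ioi_zero, one_mul]
  rw [hval] at hlim
  have := tendsto_nhds_unique (hlim.congr' (by
    filter_upwards [self_mem_nhdsWithin] with δ hδ using hII hδ)) tendsto_mertS_add_log
  linarith

/-- An explicit form of Mertens' theorem for prime powers. -/
theorem mertPi_le {y : ℝ} (hy : 1 < y) :
    mertPi y ≤ Real.eulerMascheroniConstant + Real.log (Real.log y) +
      (Chebyshev.psi y - y) / (y * Real.log y) + mertW y * |rieszErr y| + mertTail y := by
  have h : |Real.eulerMascheroniConstant - mertQ y| ≤ mertTail y := by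
    refine le_of_tendsto (tendsto_mertQ.sub_const (mertQ y)).abs ?_
    filter_upwards [eventually_ge_atTop y] with b hb using abs_mertQ_sub_le hy hb
  have h1 := neg_le_abs (Real.eulerMascheroniConstant - mertQ y)
  have h2 := mul_le_mul_of_nonneg_left (le_abs_self (rieszErr y)) (mertW_pos hy).le
  unfold mertQ at *
  linarith

/-- Moving the argument of `mertPi` costs at most the corresponding weighted change of `ψ`. -/
lemma mertPi_sub_le {x y : ℝ} (hy : 1 < y) :
    mertPi x - mertPi y ≤ (Chebyshev.psi x - Chebyshev.psi y) / (y * Real.log y) := by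
  have hl := Real.log_pos hy
  have hy0 : 0 < y := by linarith
  have hpos : 0 < y * Real.log y := by positivity
  rcases le_total y x with h | h
  · have hd (f : ℕ → ℝ) : ∑ n ∈ Ioc 0 ⌊x⌋₊, f n - ∑ n ∈ Ioc 0 ⌊y⌋₊, f n =
        ∑ n ∈ Ioc 0 ⌊x⌋₊ \ Ioc 0 ⌊y⌋₊, f n := by
      rw [← sum_sdiff (Ioc_subset_Ioc_right (Nat.floor_mono h))]; ring
    rw [mertPi, mertPi, Chebyshev.psi, Chebyshev.psi, hd, hd, sum_div]
    refine sum_le_sum fun n hn => ?_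
    simp only [Finset.mem_sdiff, mem_Ioc, not_and, not_le] at hn
    have hn' : y < n := (Nat.floor_lt hy0.le).1 (hn.2 hn.1.1)
    have := Real.log_le_log hy0 hn'.le
    have := ArithmeticFunction.vonMangoldt_nonneg (n := n)
    gcongr
  · have hd (f : ℕ → ℝ) : ∑ n ∈ Ioc 0 ⌊x⌋₊, f n - ∑ n ∈ Ioc 0 ⌊y⌋₊, f n =
        -∑ n ∈ Ioc 0 ⌊y⌋₊ \ Ioc 0 ⌊x⌋₊, f n := by
      rw [← sum_sdiff (Ioc_subset_Ioc_right (Nat.floor_mono h))]; ring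
    rw [mertPi, mertPi, Chebyshev.psi, Chebyshev.psi, hd, hd, neg_div, neg_le_neg_iff, sum_div]
    refine sum_le_sum fun n hn => ?_
    simp only [Finset.mem_sdiff, mem_Ioc] at hn
    have hn' : (n:ℝ) ≤ y := (Nat.le_floor_iff hy0.le).1 hn.1.2
    rcases Nat.lt_or_ge n 2 with h2 | h2
    · have : n = 1 := by omega
      simp [this]
    have h1 : (1:ℝ) < n := by exact_mod_cast h2
    have := Real.log_pos h1
    have := Real.log_le_log (by linarith) hn'
    have := ArithmeticFunction.vonMangoldt_nonneg (n := n)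
    gcongr

lemma sum_primePow_le_mertPi (m : ℕ) :
    ∑ p ∈ Nat.primesLE m, ∑ k ∈ Icc 1 (p.log m), (1 / (p:ℝ)) ^ k / k ≤ mertPi m := by
  set a : ℕ → ℝ := fun n => ArithmeticFunction.vonMangoldt n / (n * Real.log n) with ha
  have hterm : ∀ p ∈ Nat.primesLE m, ∀ k ∈ Icc 1 (p.log m), (1 / (p:ℝ)) ^ k / k = a (p ^ k) := by
    intro p hp k hk
    have hp := Nat.prime_of_mem_primesLE hp
    rw [mem_Icc] at hk
    have h1 : (1:ℝ) < p := by exact_mod_cast hp.one_lt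
    have hl := Real.log_pos h1
    have hk0 : (k:ℝ) ≠ 0 := by have := hk.1; positivity
    simp only [ha]
    rw [ArithmeticFunction.vonMangoldt_apply_pow (by omega),
      ArithmeticFunction.vonMangoldt_apply_prime hp]
    push_cast
    rw [Real.log_pow, one_div, inv_pow]
    field_simp
  calc _ = ∑ p ∈ Nat.primesLE m, ∑ k ∈ Icc 1 (p.log m), a (p ^ k) :=
        sum_congr rfl fun p hp => sum_congr rfl (hterm p hp)
    _ = ∑ p ∈ Nat.primesLE m, ∑ q ∈ image (fun k => p ^ k) (Icc 1 (p.log m)), a q := by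
        refine sum_congr rfl fun p hp => ?_
        exact (sum_image fun a _ b _ hab =>
          Nat.pow_right_injective (Nat.two_le_of_mem_primesLE hp) hab).symm
    _ = ∑ q ∈ (Nat.primesLE m).biUnion fun p => image (p ^ ·) (Icc 1 (p.log m)), a q := by
        rw [sum_biUnion]
        rw [pairwiseDisjoint_iff]
        rintro p hp q hq ⟨r, hr⟩
        simp only [mem_inter, mem_image, mem_Icc] at hr
        obtain ⟨⟨k, hk, rfl⟩, l, hl, h⟩ := hr
        exact ((Nat.prime_of_mem_primesLE hq).pow_inj' (Nat.prime_of_mem_primesLE hp)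
          (by omega) (by omega) h).1.symm
    _ ≤ mertPi m := by
        rw [mertPi, Nat.floor_natCast]
        refine sum_le_sum_of_subset_of_nonneg (fun q hq => ?_) fun n _ _ => mert_coeff_nonneg n
        simp only [mem_biUnion, mem_image, mem_Icc] at hq
        obtain ⟨p, hp, k, hk, rfl⟩ := hq
        have h0 := (Nat.prime_of_mem_primesLE hp)
        have hpm := Nat.le_of_mem_primesLE hp
        exact mem_Ioc.2 ⟨pow_pos h0.pos k, Nat.pow_le_of_le_log (by have := h0.pos; omega) hk.2⟩

lemma neg_log_one_sub_le {u : ℝ} (h0 : 0 ≤ u) (h1 : u < 1) (K : ℕ) :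
    -Real.log (1 - u) ≤ ∑ k ∈ Icc 1 K, u ^ k / k + u ^ (K + 1) / ((K + 1) * (1 - u)) := by
  have h := Real.hasSum_pow_div_log_of_abs_lt_one (x := u) (by rwa [abs_of_nonneg h0])
  rw [← h.tsum_eq, ← h.summable.sum_add_tsum_nat_add K]
  refine add_le_add (le_of_eq ?_) ?_
  · rw [range_eq_Ico]
    have := sum_Ico_add' (fun n : ℕ => u ^ n / (n:ℝ)) 0 K 1
    push_cast at this
    rw [this]; rfl
  · have hg := (hasSum_geometric_of_lt_one h0 h1).mul_left (u ^ (K + 1) / (K + 1))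
    refine (hasSum_le (fun n => ?_) ((summable_nat_add_iff K).2 h.summable).hasSum hg).trans
      (le_of_eq (by rw [← div_eq_mul_inv, div_div]))
    rw [div_mul_eq_mul_div, ← pow_add, show n + K + 1 = K + 1 + n by ring]
    push_cast
    gcongr
    linarith [(n.cast_nonneg : (0:ℝ) ≤ n)]

lemma sum_primes_telescope_le {z m : ℕ} (hz : 2 ≤ z) (hm : z ≤ m) :
    ∑ p ∈ Ioc z m, (if p.Prime then 1 / ((p:ℝ) - 2) - 1 / p else 0) ≤
      1 / ((z:ℝ) - 1) - (if Odd m then 1 / (m:ℝ) else 1 / ((m:ℝ) - 1)) := by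
  have hz' : (2:ℝ) ≤ z := by exact_mod_cast hz
  induction m, hm using Nat.le_induction with
  | base =>
    simp only [Ioc_self, sum_empty]
    split_ifs
    · rw [sub_nonneg]
      exact one_div_le_one_div_of_le (by linarith) (by linarith)
    · rw [sub_self]
  | succ m hm ih =>
    have hm' : (2:ℝ) ≤ m := hz'.trans (by exact_mod_cast hm)
    rw [sum_Ioc_succ_top hm]
    rcases Nat.even_or_odd m with he | ho
    · rw [if_pos he.add_one]
      rw [if_neg (Nat.not_odd_iff_even.2 he)] at ih
      push_cast
      have e : (m:ℝ) + 1 - 2 = m - 1 := by ring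
      rw [e]
      split_ifs
      · linarith
      · have : 1 / ((m:ℝ) + 1) ≤ 1 / ((m:ℝ) - 1) :=
          one_div_le_one_div_of_le (by linarith) (by linarith)
        linarith
    · rw [if_neg (Nat.not_odd_iff_even.2 ho.add_one)]
      rw [if_pos ho] at ih
      rw [if_neg fun h => by
        have := h.eq_two_or_odd'
        rcases this with h | h
        · omega
        · exact (Nat.not_odd_iff_even.2 ho.add_one) h]
      push_cast
      rw [add_sub_cancel_right]
      linarith

lemma sum_primes_ratio_le {z : ℕ} (hz : 2 ≤ z) :
    ∑ p ∈ Ioc 0 z, (if p.Prime then (p:ℝ) / (p - 1) else 0) ≤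
      if Odd z then 0.75 * (z:ℝ) + 1.25 else 0.75 * (z:ℝ) + 0.5 := by
  induction z, hz using Nat.le_induction with
  | base =>
    rw [if_neg (by decide), sum_Ioc_succ_top (by norm_num), sum_Ioc_succ_top (by norm_num)]
    norm_num
  | succ m hm ih =>
    have hm' : (2:ℝ) ≤ m := by exact_mod_cast hm
    rw [sum_Ioc_succ_top (by omega)]
    rcases Nat.even_or_odd m with he | ho
    · rw [if_pos he.add_one]
      rw [if_neg (Nat.not_odd_iff_even.2 he)] at ih
      push_cast
      rw [add_sub_cancel_right]
      split_ifs
      · have : ((m:ℝ) + 1) / m ≤ 1.5 := by rw [div_le_iff₀ (by linarith)]; linarith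
        linarith
      · linarith
    · rw [if_neg (Nat.not_odd_iff_even.2 ho.add_one)]
      rw [if_pos ho] at ih
      rw [if_neg fun h => by
        have := h.eq_two_or_odd'
        rcases this with h | h
        · omega
        · exact (Nat.not_odd_iff_even.2 ho.add_one) h]
      push_cast
      linarith

/-- The mass of the prime powers missed by `mertPi` in the logarithm of the Euler product. -/
lemma sum_neg_log_le_mertPi_add {m : ℕ} (hm : 9 ≤ m) :
    ∑ p ∈ Nat.primesLE m, -Real.log (1 - 1 / (p:ℝ)) ≤
      mertPi m + (1 / (4 * ((m.sqrt:ℝ) - 1)) + (0.75 * (m.sqrt:ℝ) + 1.25) / (3 * m)) := by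
  set z := m.sqrt with hz
  have hz3 : 3 ≤ z := Nat.le_sqrt.2 (by omega)
  have hzm : z ≤ m := Nat.sqrt_le_self m
  have hmpos : (0:ℝ) < m := by positivity
  set r : ℕ → ℝ := fun p => (1 / (p:ℝ)) ^ (p.log m + 1) / ((p.log m + 1) * (1 - 1 / (p:ℝ))) with hr
  have h1 : ∑ p ∈ Nat.primesLE m, -Real.log (1 - 1 / (p:ℝ)) ≤ mertPi m + ∑ p ∈ Nat.primesLE m, r p := by
    refine le_trans ?_ (add_le_add_left (sum_primePow_le_mertPi m) _)
    rw [← sum_add_distrib]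
    refine sum_le_sum fun p hp => ?_
    have hp1 : (1:ℝ) < p := by exact_mod_cast Nat.one_lt_of_mem_primesLE hp
    refine neg_log_one_sub_le (by positivity) ?_ _
    rw [div_lt_one (by linarith)]; exact hp1
  refine h1.trans (add_le_add_right ?_ _)
  have hset : Nat.primesLE m = (Ioc 0 m).filter Nat.Prime := by
    ext p
    rw [Nat.mem_primesLE, mem_filter, mem_Ioc]
    exact ⟨fun h => ⟨⟨h.2.pos, h.1⟩, h.2⟩, fun h => ⟨h.1.2, h.2⟩⟩
  rw [hset, sum_filter, ← sum_Ioc_consecutive _ (Nat.zero_le z) hzm, add_comm]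
  refine add_le_add ?_ ?_
  · have hb : ∀ p ∈ Ioc z m, (if p.Prime then r p else 0) ≤
        1 / 4 * (if p.Prime then 1 / ((p:ℝ) - 2) - 1 / p else 0) := by
      intro p hp
      rw [mem_Ioc] at hp
      split_ifs with hpp
      · have hp3 : (3:ℝ) < p := by exact_mod_cast lt_of_le_of_lt hz3 hp.1
        have hK : 1 ≤ p.log m := Nat.le_log_of_pow_le hpp.one_lt (by rw [pow_one]; exact hp.2)
        have hK' : (1:ℝ) ≤ (p.log m : ℝ) := by exact_mod_cast hK
        have hu : 1 / (p:ℝ) ≤ 1 := by rw [div_le_one (by linarith)]; linarith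
        have hu1 : 0 < 1 - 1 / (p:ℝ) := by
          rw [sub_pos, div_lt_one (by linarith)]; linarith
        calc r p ≤ (1 / (p:ℝ)) ^ 2 / (2 * (1 - 1 / (p:ℝ))) := by
              refine div_le_div₀ (by positivity)
                (pow_le_pow_of_le_one (by positivity) hu (by omega)) (by positivity) ?_
              gcongr; linarith
          _ = 1 / (2 * p * (p - 1)) := by
              have : (p:ℝ) - 1 ≠ 0 := by linarith
              have : (p:ℝ) ≠ 0 := by linarith
              field_simp
          _ ≤ 1 / (2 * p * (p - 2)) := by
              refine one_div_le_one_div_of_le (by nlinarith) ?_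
              gcongr; linarith
          _ = _ := by
              have : (p:ℝ) - 2 ≠ 0 := by linarith
              have : (p:ℝ) ≠ 0 := by linarith
              field_simp; ring
      · simp
    refine (sum_le_sum hb).trans ?_
    rw [← mul_sum]
    have h := sum_primes_telescope_le (show 2 ≤ z by omega) hzm
    have h0 : (0:ℝ) ≤ if Odd m then 1 / (m:ℝ) else 1 / ((m:ℝ) - 1) := by
      have : (9:ℝ) ≤ m := by exact_mod_cast hm
      split_ifs
      · positivity
      · exact div_nonneg zero_le_one (by linarith)
    have e : 1 / (4 * ((z:ℝ) - 1)) = 1 / 4 * (1 / ((z:ℝ) - 1)) := by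
      rw [div_mul_div_comm, one_mul]
    rw [e]
    gcongr
    linarith
  · have hb : ∀ p ∈ Ioc 0 z, (if p.Prime then r p else 0) ≤
        (if p.Prime then (p:ℝ) / (p - 1) else 0) * (1 / (3 * m)) := by
      intro p hp
      rw [mem_Ioc] at hp
      split_ifs with hpp
      · have hp1 : (1:ℝ) < p := by exact_mod_cast hpp.one_lt
        have hK : 2 ≤ p.log m := Nat.le_log_of_pow_le hpp.one_lt (by
          rw [pow_two]; exact (Nat.mul_le_mul hp.2 hp.2).trans (Nat.sqrt_le m))
        have hK' : (2:ℝ) ≤ (p.log m : ℝ) := by exact_mod_cast hK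
        have hlt : (m:ℝ) < (p:ℝ) ^ (p.log m + 1) := by
          exact_mod_cast Nat.lt_pow_succ_log_self hpp.one_lt m
        have hu1 : 0 < 1 - 1 / (p:ℝ) := by
          rw [sub_pos, div_lt_one (by linarith)]; exact hp1
        calc r p ≤ (1 / (m:ℝ)) / (3 * (1 - 1 / (p:ℝ))) := by
              refine div_le_div₀ (by positivity) ?_ (by positivity) ?_
              · rw [one_div, one_div, inv_pow]
                exact inv_anti₀ hmpos hlt.le
              · gcongr; linarith
          _ = _ := by
              have : (p:ℝ) - 1 ≠ 0 := by linarith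
              have : (p:ℝ) ≠ 0 := by linarith
              field_simp
      · simp
    refine (sum_le_sum hb).trans ?_
    rw [← sum_mul, ← div_eq_mul_one_div]
    have h := sum_primes_ratio_le (show 2 ≤ z by omega)
    gcongr
    refine h.trans ?_
    split_ifs <;> linarith

/-- The prime powers contribute little to `ψ`. -/
lemma psi_sub_theta_le_fourth_root {t : ℝ} (ht : 11.89 ≤ t) :
    Chebyshev.psi (t ^ 4) - Chebyshev.theta (t ^ 4) ≤
      Real.log 4 * (t ^ 2 * (1 + 1 / 5.2) + Real.log (t ^ 4) / Real.log 2 * t) := by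
  have ht0 : 0 < t := by linarith
  set x := t ^ 4 with hx
  have hx1 : 1 ≤ x := one_le_pow₀ (by linarith)
  have hx2 : 2 ≤ x := by
    have : (11.89:ℝ) ^ 4 ≤ t ^ 4 := by gcongr
    rw [hx]; norm_num at this ⊢; linarith
  have h4 : x ^ ((1:ℝ) / (4:ℕ)) = t := by
    rw [hx, ← Real.rpow_natCast t 4, ← Real.rpow_mul ht0.le]; norm_num
  have h2 : x ^ ((1:ℝ) / (2:ℕ)) = t ^ 2 := by
    rw [hx, ← Real.rpow_natCast t 4, ← Real.rpow_mul ht0.le, ← Real.rpow_natCast t 2]; norm_num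
  have h3 : x ^ ((1:ℝ) / (3:ℕ)) ≤ t ^ 2 / 5.2 := by
    refine le_of_pow_le_pow_left₀ (n := 3) (by norm_num) (by positivity) ?_
    rw [← Real.rpow_mul_natCast (by positivity)]
    have e : (1:ℝ) / (3:ℕ) * (3:ℕ) = 1 := by norm_num
    rw [e, Real.rpow_one, hx, div_pow, le_div_iff₀ (by norm_num)]
    have : (11.89:ℝ) ^ 2 ≤ t ^ 2 := by gcongr
    have h4 : 0 < t ^ 4 := by positivity
    nlinarith
  have hl4 : 0 < Real.log 4 := Real.log_pos (by norm_num)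
  have hl2 : 0 < Real.log 2 := Real.log_pos (by norm_num)
  rw [Chebyshev.psi_eq_theta_add_sum_theta hx2, add_sub_cancel_left]
  set N := ⌊Real.log x / Real.log 2⌋₊ with hN
  have hNle : (N:ℝ) ≤ Real.log x / Real.log 2 :=
    Nat.floor_le (div_nonneg (Real.log_nonneg hx1) hl2.le)
  have hb : ∀ n ∈ Icc 2 N, Chebyshev.theta (x ^ ((1:ℝ) / n)) ≤
      Real.log 4 * (t + (if n = 2 then t ^ 2 else 0) + if n = 3 then t ^ 2 / 5.2 else 0) := by
    intro n hn
    rw [mem_Icc] at hn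
    refine (Chebyshev.theta_le_log4_mul_x (by positivity)).trans ?_
    gcongr
    rcases (show n = 2 ∨ n = 3 ∨ 4 ≤ n by omega) with rfl | rfl | h
    · rw [h2]; simp [ht0.le]
    · rw [if_neg (by norm_num), if_pos rfl]
      norm_num at h3 ⊢; linarith
    · rw [if_neg (by omega), if_neg (by omega), add_zero, add_zero, ← h4]
      refine Real.rpow_le_rpow_of_exponent_le hx1 ?_
      have : (4:ℝ) ≤ n := by exact_mod_cast h
      push_cast
      exact one_div_le_one_div_of_le (by norm_num) this
  refine (sum_le_sum hb).trans ?_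
  rw [← mul_sum, sum_add_distrib, sum_add_distrib, sum_ite_eq', sum_ite_eq', sum_const,
    Nat.card_Icc, nsmul_eq_mul]
  refine mul_le_mul_of_nonneg_left ?_ hl4.le
  have e1 : (if 2 ∈ Icc 2 N then t ^ 2 else 0) ≤ t ^ 2 := by split_ifs <;> nlinarith
  have e2 : (if 3 ∈ Icc 2 N then t ^ 2 / 5.2 else 0) ≤ t ^ 2 / 5.2 := by
    split_ifs
    · rfl
    · positivity
  have e3 : ((N + 1 - 2 : ℕ) : ℝ) * t ≤ Real.log x / Real.log 2 * t := by
    have : ((N + 1 - 2 : ℕ) : ℝ) ≤ N := by exact_mod_cast (by omega)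
    gcongr
    linarith
  have e4 : t ^ 2 * (1 + 1 / 5.2) = t ^ 2 + t ^ 2 / 5.2 := by ring
  linarith

/-- `log x / x ^ (1/4)` decreases. -/
lemma log_pow_four_le {t s : ℝ} (hs : Real.exp 1 ≤ s) (hst : s ≤ t) :
    Real.log (t ^ 4) ≤ 4 * Real.log s / s * t := by
  have hs0 : 0 < s := (Real.exp_pos 1).trans_le hs
  have ht0 : 0 < t := hs0.trans_le hst
  have h1 : 1 ≤ Real.log s := by rwa [Real.le_log_iff_exp_le hs0]
  have h2 := Real.log_le_sub_one_of_pos (div_pos ht0 hs0)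
  rw [Real.log_div ht0.ne' hs0.ne'] at h2
  have h3 : 1 ≤ t / s := by rwa [one_le_div hs0]
  rw [Real.log_pow]
  push_cast
  have e : 4 * Real.log s / s * t = 4 * (Real.log s * (t / s)) := by ring
  rw [e]
  nlinarith

/-- A lower bound for `θ` of Chebyshev strength. -/
lemma theta_ge_two_thirds {m : ℕ} {t : ℝ} (ht : 11.89 ≤ t) (hm : (m:ℝ) = t ^ 4)
    (hL : Real.log m ≤ 0.833 * t) : 0.66 * (m:ℝ) ≤ Chebyshev.theta m := by
  have h := psi_sub_theta_le_fourth_root ht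
  rw [← hm] at h
  have hl4 : Real.log 4 ≤ 1.3863 := by
    rw [show (4:ℝ) = 2 ^ 2 by norm_num, Real.log_pow]; push_cast; linarith [Real.log_two_lt_d9]
  have hl2 := Real.log_two_gt_d9
  have hpsi := Chebyshev.psi_ge m
  have h0 : (0:ℝ) < m := by rw [hm]; positivity
  have hm1 : (1:ℝ) ≤ m := by rw [hm]; exact one_le_pow₀ (by linarith)
  have hlog : Real.log (m + 1) ≤ 0.833 * t + 1 := by
    have : Real.log (m + 1) ≤ Real.log m + 1 := by
      have h1 : Real.log ((m + 1) / m) ≤ (m + 1) / m - 1 := Real.log_le_sub_one_of_pos (by positivity)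
      rw [Real.log_div (by positivity) h0.ne'] at h1
      have : ((m:ℝ) + 1) / m - 1 ≤ 1 := by
        rw [sub_le_iff_le_add, div_le_iff₀ h0]; linarith
      linarith
    linarith
  have hdiv : Real.log m / Real.log 2 ≤ 1.2019 * t := by
    rw [div_le_iff₀ (by linarith)]
    nlinarith
  have hq : Real.log 4 * (t ^ 2 * (1 + 1 / 5.2) + Real.log m / Real.log 2 * t) ≤ 3.32 * t ^ 2 := by
    have h1 : t ^ 2 * (1 + 1 / 5.2) + Real.log m / Real.log 2 * t ≤ 2.3943 * t ^ 2 := by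
      nlinarith
    have h2 : 0 ≤ t ^ 2 := by positivity
    have h3 : 0 ≤ Real.log 4 := Real.log_nonneg (by norm_num)
    nlinarith [mul_le_mul_of_nonneg_left h1 h3, mul_le_mul_of_nonneg_right hl4 h2]
  have h5 : (0.6931:ℝ) * t ^ 4 ≤ m * Real.log 2 := by rw [← hm]; nlinarith
  have h6 : 3.32 * t ^ 2 + 0.833 * t + 1 ≤ 0.0331 * t ^ 4 := by
    have : (141:ℝ) ≤ t ^ 2 := by nlinarith
    nlinarith
  rw [hm] at *
  linarith

lemma log_four_le : Real.log 4 ≤ 1.3863 := by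
  rw [show (4:ℝ) = 2 ^ 2 by norm_num, Real.log_pow]; push_cast; linarith [Real.log_two_lt_d9]

lemma theta_log_bounds {m : ℕ} {t : ℝ} (ht : 11.89 ≤ t) (hm : (m:ℝ) = t ^ 4)
    (hL : Real.log m ≤ 0.833 * t) :
    Real.log m - 0.416 ≤ Real.log (Chebyshev.theta m) ∧
      Real.log (Chebyshev.theta m) ≤ Real.log m + 0.33 := by
  have h1 := theta_ge_two_thirds ht hm hL
  have h0 : (0:ℝ) < m := by rw [hm]; positivity
  have h2 := Chebyshev.theta_le_log4_mul_x h0.le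
  have hy : 0 < Chebyshev.theta m := lt_of_lt_of_le (by positivity) h1
  constructor
  · have h3 := Real.log_le_log (by positivity) h1
    rw [Real.log_mul (by norm_num) h0.ne'] at h3
    have h4 : -0.416 ≤ Real.log 0.66 := by
      have h5 : Real.log (1 / 0.66) ≤ 0.416 := by
        rw [Real.log_le_iff_le_exp (by norm_num)]
        refine le_trans ?_ (Real.sum_le_exp_of_nonneg (by norm_num) 6)
        norm_num [sum_range_succ, Nat.factorial]
      rw [one_div, Real.log_inv] at h5
      linarith
    linarith
  · have h3 := Real.log_le_log hy h2
    rw [Real.log_mul (Real.log_pos (by norm_num)).ne' h0.ne'] at h3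
    have h4 : Real.log (Real.log 4) ≤ 0.33 := by
      rw [Real.log_le_iff_le_exp (Real.log_pos (by norm_num))]
      refine log_four_le.trans (le_trans ?_ (Real.sum_le_exp_of_nonneg (by norm_num) 5))
      norm_num [sum_range_succ, Nat.factorial]
    linarith

/-- The contribution of proper prime powers to the error in Mertens' theorem. -/
lemma prime_power_error_le {m : ℕ} {t s κ : ℝ} (hs : 11.89 ≤ s) (hst : s ≤ t)
    (hm : (m:ℝ) = t ^ 4) (hκ : κ ≤ 0.833) (hL : Real.log m ≤ κ * t) :
    (1 / (4 * ((m.sqrt:ℝ) - 1)) + (0.75 * (m.sqrt:ℝ) + 1.25) / (3 * m)) *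
        (Real.log m * Real.log (Chebyshev.theta m)) +
      (Chebyshev.psi m - Chebyshev.theta m) * Real.log m / Chebyshev.theta m +
      6.6 * (Real.log m + 1.045) / Chebyshev.theta m ≤
    0.507 * (κ * (κ + 0.028)) + 2.1005 * (κ * (1.1924 + 1.4428 * κ)) / s + 0.0055 := by
  have ht : 11.89 ≤ t := hs.trans hst
  have ht0 : 0 < t := by linarith
  have hs0 : 0 < s := by linarith
  have hL' : Real.log m ≤ 0.833 * t := hL.trans (by gcongr)
  have h1 := theta_ge_two_thirds ht hm hL'
  obtain ⟨hl1, hl2⟩ := theta_log_bounds ht hm hL'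
  have hq := psi_sub_theta_le_fourth_root ht
  rw [← hm] at hq
  have h0 : (0:ℝ) < m := by rw [hm]; positivity
  set L := Real.log m with hLdef
  set y := Chebyshev.theta m with hy
  have hy0 : 0 < y := lt_of_lt_of_le (by positivity) h1
  have hL9 : 1 ≤ L := by
    rw [hLdef, Real.le_log_iff_exp_le h0, hm]
    have : (11.89:ℝ) ^ 4 ≤ t ^ 4 := by gcongr
    have := Real.exp_one_lt_d9
    norm_num at *; linarith
  have hκ0 : 0 < κ := by
    by_contra! h
    nlinarith
  have hl0 : 0 ≤ Real.log y := by linarith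
  have hR : 1 / (4 * ((m.sqrt:ℝ) - 1)) + (0.75 * (m.sqrt:ℝ) + 1.25) / (3 * m) ≤ 0.507 / t ^ 2 := by
    have hz1 : (m.sqrt:ℝ) ≤ t ^ 2 := by
      refine le_of_pow_le_pow_left₀ (n := 2) two_ne_zero (by positivity) ?_
      rw [← pow_mul, ← hm]; exact_mod_cast Nat.sqrt_le' m
    have hz2 : t ^ 2 ≤ (m.sqrt:ℝ) + 1 := by
      refine le_of_pow_le_pow_left₀ (n := 2) two_ne_zero (by positivity) ?_
      rw [← pow_mul, ← hm]; exact_mod_cast (Nat.lt_succ_sqrt' m).le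
    have ht2 : (141.3:ℝ) ≤ t ^ 2 := by nlinarith
    have e1 : 1 / (4 * ((m.sqrt:ℝ) - 1)) ≤ 1 / (4 * (t ^ 2 - 2)) := by
      refine one_div_le_one_div_of_le (by linarith) (by linarith)
    have e2 : (0.75 * (m.sqrt:ℝ) + 1.25) / (3 * m) ≤ (0.75 * t ^ 2 + 1.25) / (3 * t ^ 4) := by
      rw [hm]; gcongr
    have e3 : 1 / (4 * (t ^ 2 - 2)) ≤ 0.2537 / t ^ 2 := by
      rw [div_le_div_iff₀ (by linarith) (by positivity)]; linarith
    have e4 : (0.75 * t ^ 2 + 1.25) / (3 * t ^ 4) ≤ 0.2531 / t ^ 2 := by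
      rw [div_le_div_iff₀ (by positivity) (by positivity)]
      nlinarith
    have e5 : (0.507:ℝ) / t ^ 2 = 0.2537 / t ^ 2 + 0.2533 / t ^ 2 := by ring
    have e6 : (0.2531:ℝ) / t ^ 2 ≤ 0.2533 / t ^ 2 := by gcongr; norm_num
    linarith
  have hLl : L * Real.log y ≤ κ * (κ + 0.028) * t ^ 2 := by
    have e1 : Real.log y ≤ (κ + 0.028) * t := by linarith
    calc L * Real.log y ≤ (κ * t) * ((κ + 0.028) * t) := by gcongr
      _ = _ := by ring
  have b1 : (1 / (4 * ((m.sqrt:ℝ) - 1)) + (0.75 * (m.sqrt:ℝ) + 1.25) / (3 * m)) *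
        (L * Real.log y) ≤ 0.507 * (κ * (κ + 0.028)) := by
    calc _ ≤ 0.507 / t ^ 2 * (κ * (κ + 0.028) * t ^ 2) := by
          refine mul_le_mul hR hLl (by positivity) (by positivity)
      _ = _ := by field_simp
  have hq2 : Chebyshev.psi m - y ≤ 1.3863 * ((1.1924 + 1.4428 * κ) * t ^ 2) := by
    refine hq.trans ?_
    have hd : L / Real.log 2 ≤ 1.4428 * κ * t := by
      have := Real.log_two_gt_d9
      rw [div_le_iff₀ (by linarith)]
      have : 0 < κ * t := by positivity
      nlinarith
    refine mul_le_mul log_four_le ?_ ?_ (by norm_num)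
    · nlinarith
    · have := Real.log_two_gt_d9
      positivity
  have b2 : (Chebyshev.psi m - y) * L / y ≤ 2.1005 * (κ * (1.1924 + 1.4428 * κ)) / s := by
    calc _ ≤ (1.3863 * ((1.1924 + 1.4428 * κ) * t ^ 2)) * (κ * t) / (0.66 * m) := by gcongr
      _ = 1.3863 / 0.66 * (κ * (1.1924 + 1.4428 * κ)) / t := by rw [hm]; field_simp
      _ ≤ _ := by gcongr; norm_num
  have b3 : 6.6 * (L + 1.045) / y ≤ 0.0055 := by
    rw [div_le_iff₀ hy0]
    have : (1680:ℝ) ≤ t ^ 3 := by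
      have : (11.89:ℝ) ^ 3 ≤ t ^ 3 := by gcongr
      norm_num at *; linarith
    have e : t ^ 4 = t * t ^ 3 := by ring
    have : 1680 * t ≤ m := by rw [hm, e]; nlinarith
    linarith
  linarith

/-- Mertens' product up to `m`, with the error expressed through `θ(m)`. -/
lemma sum_neg_log_le_add {m : ℕ} {t s κ C : ℝ} (hs : 11.89 ≤ s) (hst : s ≤ t)
    (hm : (m:ℝ) = t ^ 4) (hκ : κ ≤ 0.833) (hL : Real.log m ≤ κ * t) (hL9 : 9.9 ≤ Real.log m)
    (hZ : zeroSum (Chebyshev.theta m) * (Real.log m + 1.435) ≤ C)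
    (hC : 0.507 * (κ * (κ + 0.028)) + 2.1005 * (κ * (1.1924 + 1.4428 * κ)) / s + 0.0055 + C
      ≤ 1.1185) :
    ∑ p ∈ Nat.primesLE m, -Real.log (1 - 1 / (p:ℝ)) ≤
      Real.eulerMascheroniConstant + Real.log (Real.log (Chebyshev.theta m)) +
        1.1185 / (Real.log m * Real.log (Chebyshev.theta m)) := by
  have ht : 11.89 ≤ t := hs.trans hst
  have hL' : Real.log m ≤ 0.833 * t := hL.trans (by gcongr)
  obtain ⟨hl1, -⟩ := theta_log_bounds ht hm hL'
  have herr := prime_power_error_le hs hst hm hκ hL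
  have h1 := theta_ge_two_thirds ht hm hL'
  have hm4 : (11.89:ℝ) ^ 4 ≤ m := by rw [hm]; gcongr
  have hm9 : 9 ≤ m := by
    have : (9:ℝ) ≤ m := le_trans (by norm_num) hm4
    exact_mod_cast this
  have hP := sum_neg_log_le_mertPi_add hm9
  set L := Real.log m with hLdef
  set y := Chebyshev.theta m with hy
  set R := 1 / (4 * ((m.sqrt:ℝ) - 1)) + (0.75 * (m.sqrt:ℝ) + 1.25) / (3 * m) with hR
  have hy1 : 1 < y := by norm_num at hm4; linarith
  have hsub := mertPi_sub_le (x := m) hy1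
  have hmp := mertPi_le hy1
  have hE := abs_rieszErr_le hy1.le
  have hZ0 := zeroSum_nonneg y (by linarith)
  set Z := zeroSum y with hZdef
  set l := Real.log y with hl
  have hl9 : 9.48 ≤ l := by linarith
  have hl0 : 0 < l := by linarith
  have hy0 : 0 < y := by linarith
  have hLl : L ≤ 1.045 * l := by linarith
  have hwE : mertW y * |rieszErr y| ≤ mertW y * (Z + 3.3 / y) :=
    mul_le_mul_of_nonneg_left hE (mertW_pos hy1).le
  have hK : (mertW y * |rieszErr y| + mertTail y) * (L * l) ≤
      Z * (L + 1.435) + 6.6 * (L + 1.045) / y := by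
    have hLl0 : 0 < L * l := by positivity
    calc _ ≤ (mertW y * (Z + 3.3 / y) + mertTail y) * (L * l) := by
          refine mul_le_mul_of_nonneg_right ?_ hLl0.le
          linarith
      _ = Z * (L + L / l * (1 + 2 / 6.5 * (1 + 2 / l))) + 6.6 * (L + L / l) / y := by
          unfold mertTail mertW mertG
          rw [← hl]
          field_simp
          ring
      _ ≤ _ := by
          have e1 : L / l ≤ 1.045 := by rwa [div_le_iff₀ hl0]
          have e2 : 2 / l ≤ 0.211 := by rw [div_le_iff₀ hl0]; linarith
          have e0 : 0 ≤ L / l := by positivity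
          have e3 : L / l * (1 + 2 / 6.5 * (1 + 2 / l)) ≤ 1.435 := by
            calc L / l * (1 + 2 / 6.5 * (1 + 2 / l)) ≤ 1.045 * (1 + 2 / 6.5 * (1 + 0.211)) := by gcongr
              _ ≤ 1.435 := by norm_num
          gcongr
  have hT : R + (Chebyshev.psi m - y) / (y * l) + (mertW y * |rieszErr y| + mertTail y) ≤
      1.1185 / (L * l) := by
    rw [le_div_iff₀ (by positivity)]
    have e : (Chebyshev.psi m - y) / (y * l) * (L * l) = (Chebyshev.psi m - y) * L / y := by
      field_simp
    rw [add_mul, add_mul, e]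
    linarith
  have e : (Chebyshev.psi m - y) / (y * l) =
      (Chebyshev.psi m - Chebyshev.psi y) / (y * l) + (Chebyshev.psi y - y) / (y * l) := by ring
  linarith

lemma log_ge_of_twenty_thousand {m : ℕ} (hm : 20000 ≤ m) : 9.9 ≤ Real.log m := by
  have hm' : (20000:ℝ) ≤ m := by exact_mod_cast hm
  refine le_trans ?_ (Real.log_le_log (by norm_num) hm')
  rw [Real.le_log_iff_exp_le (by norm_num)]
  have h1 : Real.exp 1 ^ 10 ≤ 2.7182818286 ^ 10 := by
    have := Real.exp_one_lt_d9
    gcongr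
  have h2 : (1.105:ℝ) ≤ Real.exp 0.1 := by
    refine le_trans ?_ (Real.sum_le_exp_of_nonneg (by norm_num) 4)
    norm_num [sum_range_succ, Nat.factorial]
  have h3 : Real.exp 9.9 * Real.exp 0.1 = Real.exp 1 ^ 10 := by
    rw [← Real.exp_add, ← Real.exp_nat_mul]; norm_num
  have h4 := Real.exp_pos 9.9
  norm_num at *
  nlinarith

lemma log_start_le : Real.log 11.89 ≤ 2.476 := by
  rw [Real.log_le_iff_le_exp (by norm_num), show (2.476:ℝ) = (4:ℕ) * 0.619 by norm_num,
    Real.exp_nat_mul]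
  have : (1.857:ℝ) ≤ Real.exp 0.619 := by
    refine le_trans ?_ (Real.sum_le_exp_of_nonneg (by norm_num) 7)
    norm_num [sum_range_succ, Nat.factorial]
  calc (11.89:ℝ) ≤ 1.857 ^ 4 := by norm_num
    _ ≤ _ := by gcongr

lemma sum_neg_log_le_add_of_ge {m : ℕ} (hm : 20000 ≤ m) :
    ∑ p ∈ Nat.primesLE m, -Real.log (1 - 1 / (p:ℝ)) ≤
      Real.eulerMascheroniConstant + Real.log (Real.log (Chebyshev.theta m)) +
        1.1185 / (Real.log m * Real.log (Chebyshev.theta m)) ∧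
    Real.log m - 0.416 ≤ Real.log (Chebyshev.theta m) := by
  have hm' : (20000:ℝ) ≤ m := by exact_mod_cast hm
  have hm0 : (0:ℝ) < m := by linarith
  have hL9 := log_ge_of_twenty_thousand hm
  obtain ⟨t, ht0, hmt⟩ : ∃ t : ℝ, 0 < t ∧ (m:ℝ) = t ^ 4 :=
    ⟨(m:ℝ) ^ (1 / 4 : ℝ), by positivity, by
      rw [← Real.rpow_natCast, ← Real.rpow_mul hm0.le]; norm_num⟩
  have ht : 11.89 ≤ t := by
    refine le_of_pow_le_pow_left₀ (n := 4) (by norm_num) ht0.le ?_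
    rw [← hmt]; norm_num; linarith
  have he1 : Real.exp 1 ≤ 11.89 := by have := Real.exp_one_lt_d9; linarith
  have hL1 : Real.log m ≤ 0.833 * t := by
    rw [hmt]
    refine (log_pow_four_le he1 ht).trans ?_
    gcongr
    have := log_start_le
    rw [div_le_iff₀ (by norm_num)]; linarith
  have h1 := theta_ge_two_thirds ht hmt hL1
  obtain ⟨hl1, -⟩ := theta_log_bounds ht hmt hL1
  refine ⟨?_, hl1⟩
  have hy : 13000 ≤ Chebyshev.theta m := by linarith
  have hZ := zeroSum_le (t := Chebyshev.theta m) (by linarith)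
  have hlZ := log_mul_zeroSum_le (t := Chebyshev.theta m) (by linarith)
  have hZ' : zeroSum (Chebyshev.theta m) ≤ 0.02361 := by
    refine hZ.trans ?_
    have : 1 / Chebyshev.theta m ≤ 1 / 13000 := one_div_le_one_div_of_le (by norm_num) hy
    linarith
  rcases le_total (Real.log m) 14 with h14 | h14
  · refine sum_neg_log_le_add (C := 0.02361 * (14 + 1.435)) le_rfl ht hmt le_rfl hL1 hL9 ?_ ?_
    · gcongr
    · norm_num
  · have ht33 : 33 ≤ t := by
      rw [hmt, Real.log_pow] at h14
      push_cast at h14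
      have : 3.5 ≤ Real.log t := by linarith
      rw [Real.le_log_iff_exp_le ht0] at this
      refine le_trans ?_ this
      rw [show (3.5:ℝ) = (7:ℕ) * 0.5 by norm_num, Real.exp_nat_mul]
      have : (1.648:ℝ) ≤ Real.exp 0.5 := by
        refine le_trans ?_ (Real.sum_le_exp_of_nonneg (by norm_num) 6)
        norm_num [sum_range_succ, Nat.factorial]
      calc (33:ℝ) ≤ 1.648 ^ 7 := by norm_num
        _ ≤ _ := by gcongr
    have hL2 : Real.log m ≤ 0.425 * t := by
      rw [hmt]
      refine (log_pow_four_le (by linarith) ht33).trans ?_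
      gcongr
      have : Real.log 33 ≤ 3.5 := by
        rw [Real.log_le_iff_le_exp (by norm_num), show (3.5:ℝ) = (7:ℕ) * 0.5 by norm_num,
          Real.exp_nat_mul]
        have : (1.648:ℝ) ≤ Real.exp 0.5 := by
          refine le_trans ?_ (Real.sum_le_exp_of_nonneg (by norm_num) 6)
          norm_num [sum_range_succ, Nat.factorial]
        calc (33:ℝ) ≤ 1.648 ^ 7 := by norm_num
          _ ≤ _ := by gcongr
      rw [div_le_iff₀ (by norm_num)]; linarith
    refine sum_neg_log_le_add (C := 0.94) (s := 33) (κ := 0.425) (by norm_num) ht33 hmt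
      (by norm_num) hL2 hL9 ?_ (by norm_num)
    have hZ0 := zeroSum_nonneg (Chebyshev.theta m) (by linarith)
    rcases le_total (Real.log m) 30 with h30 | h30
    · calc zeroSum (Chebyshev.theta m) * (Real.log m + 1.435) ≤ 0.02361 * (30 + 1.435)  :=
          mul_le_mul hZ' (by linarith) (by linarith) (by norm_num)
        _ ≤ 0.94 := by norm_num
    · set l := Real.log (Chebyshev.theta m)
      have : Real.log m + 1.435 ≤ 1.07 * l := by linarith
      calc _ ≤ zeroSum (Chebyshev.theta m) * (1.07 * l) := by gcongr
        _ = 1.07 * (l * zeroSum (Chebyshev.theta m)) := by ring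
        _ ≤ 1.07 * 0.87 := by gcongr
        _ ≤ _ := by norm_num

/-- An explicit Mertens bound in terms of `θ(m)`. -/
theorem sum_neg_log_one_sub_le {m : ℕ} (hm : 20000 ≤ m) :
    ∑ p ∈ Nat.primesLE m, -Real.log (1 - 1 / (p:ℝ)) ≤
      Real.eulerMascheroniConstant +
        Real.log (Real.log (Chebyshev.theta m) + 1.1253 / Real.log m) := by
  obtain ⟨h, hl⟩ := sum_neg_log_le_add_of_ge hm
  have hL := log_ge_of_twenty_thousand hm
  set L := Real.log m
  set l := Real.log (Chebyshev.theta m)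
  have hl9 : 9.484 ≤ l := by linarith
  have hLl : 93 ≤ L * l := by nlinarith
  have hu : Real.log (l + 1.1253 / L) = Real.log l + Real.log (1 + 1.1253 / (L * l)) := by
    rw [← Real.log_mul (by linarith) (by positivity)]
    congr 1
    field_simp
  have hb := Real.le_log_one_add_of_nonneg (x := 1.1253 / (L * l)) (by positivity)
  have hc : 1.1185 / (L * l) ≤ 2 * (1.1253 / (L * l)) / (1.1253 / (L * l) + 2) := by
    generalize L * l = A at hLl
    have hA : 0 < A := by linarith
    have e : 2 * (1.1253 / A) / (1.1253 / A + 2) = 2.2506 / (1.1253 + 2 * A) := by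
      field_simp
      norm_num
    rw [e, div_le_div_iff₀ hA (by linarith)]
    linarith
  rw [hu]
  linarith

/-- The number of integers coprime to `P` in `[s, s + 2 ^ d)`, by binary splitting. -/
def sieveCount (P : ℕ) : ℕ → ℕ → ℕ
  | 0, s => cond (Nat.beq (Nat.gcd s P) 1) 1 0
  | d + 1, s => sieveCount P d s + sieveCount P d (s + 2 ^ d)

lemma count_prime_le_sieveCount {P : ℕ} (hP : ∀ s, s.Prime → 160 ≤ s → Nat.gcd s P = 1) (d : ℕ) :
    ∀ s, 160 ≤ s → Nat.count Nat.Prime (s + 2 ^ d) ≤ Nat.count Nat.Prime s + sieveCount P d s := by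
  induction d with
  | zero =>
    intro s hs
    rw [pow_zero, Nat.count_succ, sieveCount]
    split_ifs with h
    · rw [hP s h hs]; rfl
    · omega
  | succ d ih =>
    intro s hs
    have h1 := ih s hs
    have h2 := ih (s + 2 ^ d) (Nat.le_add_right_of_le hs)
    rw [sieveCount, pow_succ, mul_two, ← add_assoc]
    omega

lemma prime_gcd_primorial {s : ℕ} (hs : s.Prime) (h : 160 ≤ s) : Nat.gcd s (primorial 140) = 1 := by
  rw [← Nat.coprime_iff_gcd_eq_one, primorial]
  refine Nat.Coprime.prod_right fun p hp => ?_
  rw [Finset.mem_filter, Finset.mem_range] at hp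
  exact (Nat.coprime_primes hs hp.2).2 (by omega)

lemma count_prime_twenty_thousand : Nat.count Nat.Prime 20000 ≤ 2262 := by
  have hP := fun s hs h => prime_gcd_primorial (s := s) hs h
  have h0 : Nat.count Nat.Prime 160 ≤ 37 := by decide +kernel
  have h1 := count_prime_le_sieveCount hP 14 160 (by norm_num)
  have h2 := count_prime_le_sieveCount hP 11 16544 (by norm_num)
  have h3 := count_prime_le_sieveCount hP 10 18592 (by norm_num)
  have h4 := count_prime_le_sieveCount hP 8 19616 (by norm_num)
  have h5 := count_prime_le_sieveCount hP 7 19872 (by norm_num)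
  have hs : 37 + sieveCount (primorial 140) 14 160 + sieveCount (primorial 140) 11 16544 +
    sieveCount (primorial 140) 10 18592 + sieveCount (primorial 140) 8 19616 +
    sieveCount (primorial 140) 7 19872 ≤ 2262 := by
    have e : primorial 140 = 10014646650599190067509233131649940057366334653200433090 := by
      decide +kernel
    rw [e]
    decide +kernel
  norm_num at h1 h2 h3 h4 h5
  omega

lemma nth_prime_ge {n : ℕ} (hn : 2262 ≤ n) : 20000 ≤ Nat.nth Nat.Prime n := by
  rw [← Nat.count_le_iff_le_nth Nat.infinite_setOfPred_prime]
  exact count_prime_twenty_thousand.trans hn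

lemma primesLE_nthPrime {n : ℕ} (hn : 1 ≤ n) :
    Nat.primesLE (nthPrime n) = (range n).image (Nat.nth Nat.Prime) := by
  ext p
  rw [Nat.mem_primesLE, Finset.mem_image, nthPrime]
  constructor
  · rintro ⟨h1, h2⟩
    refine ⟨Nat.count Nat.Prime p, ?_, Nat.nth_count h2⟩
    rw [← Nat.nth_count h2, Nat.nth_le_nth Nat.infinite_setOfPred_prime] at h1
    rw [Finset.mem_range]
    omega
  · rintro ⟨k, hk, rfl⟩
    rw [Finset.mem_range] at hk
    exact ⟨(Nat.nth_le_nth Nat.infinite_setOfPred_prime).2 (by omega), Nat.prime_nth_prime k⟩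

lemma primorialAt_eq {n : ℕ} (hn : 1 ≤ n) : primorialAt n = primorial (nthPrime n) := by
  rw [primorial_eq_prod_primesLE, primesLE_nthPrime hn, prod_image]
  · rfl
  · exact fun a _ b _ h => Nat.nth_injective Nat.infinite_setOfPred_prime h

/-- The partial Euler product over `p ≤ m` of `ζ(t)`. -/
noncomputable def eulerPartial (t m : ℕ) : ℝ := ∏ p ∈ Nat.primesLE m, (1 - ((p:ℝ)⁻¹) ^ t)⁻¹

lemma euler_factor_bounds {t k : ℕ} (ht : 2 ≤ t) (hk : 2 ≤ k) :
    0 < 1 - ((k:ℝ)⁻¹) ^ t ∧ 1 ≤ (1 - ((k:ℝ)⁻¹) ^ t)⁻¹ ∧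
      (1 - ((k:ℝ)⁻¹) ^ t)⁻¹ ≤ (k:ℝ) ^ 2 / ((k - 1) * (k + 1)) := by
  have hk' : (2:ℝ) ≤ k := by exact_mod_cast hk
  have h0 : 0 < (k:ℝ)⁻¹ := by positivity
  have h1 : (k:ℝ)⁻¹ < 1 := inv_lt_one_of_one_lt₀ (by linarith)
  have h2 : ((k:ℝ)⁻¹) ^ t ≤ ((k:ℝ)⁻¹) ^ 2 := pow_le_pow_of_le_one h0.le h1.le ht
  have h3 : 0 < 1 - ((k:ℝ)⁻¹) ^ 2 := by nlinarith
  have h4 : 0 < ((k:ℝ)⁻¹) ^ t := by positivity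
  refine ⟨by linarith, (one_le_inv₀ (by linarith)).2 (by linarith), ?_⟩
  calc (1 - ((k:ℝ)⁻¹) ^ t)⁻¹ ≤ (1 - ((k:ℝ)⁻¹) ^ 2)⁻¹ := inv_anti₀ h3 (by linarith)
    _ = _ := by
      have : (k:ℝ) - 1 ≠ 0 := by linarith
      have : (k:ℝ) + 1 ≠ 0 := by linarith
      have e : 1 - ((k:ℝ)⁻¹) ^ 2 = ((k - 1) * (k + 1)) / (k:ℝ) ^ 2 := by
        field_simp
        ring
      rw [e, inv_div]

lemma eulerPartial_pos {t : ℕ} (ht : 2 ≤ t) (m : ℕ) : 0 < eulerPartial t m :=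
  prod_pos fun _ hp => inv_pos.2 (euler_factor_bounds ht (Nat.two_le_of_mem_primesLE hp)).1

lemma eulerPartial_le {t m M : ℕ} (ht : 2 ≤ t) (hm : 1 ≤ m) (hM : m ≤ M) :
    eulerPartial t M ≤ eulerPartial t m * ((M:ℝ) / m * ((m + 1) / (M + 1))) := by
  have hm' : (1:ℝ) ≤ m := by exact_mod_cast hm
  induction M, hM using Nat.le_induction with
  | base =>
    rw [div_self (by linarith), div_self (by linarith), mul_one, mul_one]
  | succ M hM ih =>
    have hM' : (1:ℝ) ≤ M := hm'.trans (by exact_mod_cast hM)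
    obtain ⟨h1, h2, h3⟩ := euler_factor_bounds (k := M + 1) ht (by omega)
    have hA := eulerPartial_pos ht M
    have hstep : eulerPartial t (M + 1) ≤ (1 - (((M + 1 : ℕ):ℝ)⁻¹) ^ t)⁻¹ * eulerPartial t M := by
      unfold eulerPartial
      rw [Nat.primesLE_succ]
      split_ifs
      · rw [prod_insert (Nat.notMem_primesLE M)]
      · exact le_mul_of_one_le_left hA.le h2
    calc _ ≤ _ := hstep
      _ ≤ (((M + 1 : ℕ):ℝ) ^ 2 / (((M + 1 : ℕ):ℝ) - 1) / (((M + 1 : ℕ):ℝ) + 1)) *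
          (eulerPartial t m * ((M:ℝ) / m * ((m + 1) / (M + 1)))) := by
        rw [div_div]
        exact mul_le_mul h3 ih hA.le (h2.trans h3 |>.trans' zero_le_one)
      _ = _ := by
        push_cast
        rw [add_sub_cancel_right]
        field_simp

/-- The completely multiplicative function `n ↦ n ^ (-t)`. -/
noncomputable def invPowHom (t : ℕ) (ht : t ≠ 0) : ℕ →*₀ ℝ where
  toFun n := ((n:ℝ)⁻¹) ^ t
  map_zero' := by simp [ht]
  map_one' := by simp
  map_mul' a b := by push_cast; rw [mul_inv, mul_pow]

lemma tendsto_eulerPartial {t : ℕ} (ht : 2 ≤ t) :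
    Tendsto (eulerPartial t) atTop (nhds (zetaNat t)) := by
  have hsum : Summable fun n : ℕ => ((n:ℝ)⁻¹) ^ t := by
    simpa only [inv_pow] using Real.summable_nat_pow_inv.2 ht
  have h := EulerProduct.eulerProduct_completely_multiplicative
    (f := invPowHom t (by omega)) (hsum.norm)
  have e : ∑' n, invPowHom t (by omega) n = zetaNat t := by
    change ∑' n : ℕ, ((n:ℝ)⁻¹) ^ t = zetaNat t
    rw [hsum.tsum_eq_zero_add, zetaNat]
    simp only [Nat.cast_zero, inv_zero, zero_pow (show t ≠ 0 by omega), zero_add, one_div,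
      Nat.cast_add, Nat.cast_one, inv_pow]
  rw [e] at h
  exact h.comp (tendsto_add_atTop_nat 1)

lemma zetaNat_le {t m : ℕ} (ht : 2 ≤ t) (hm : 1 ≤ m) :
    zetaNat t ≤ eulerPartial t m * Real.exp (2 / (m:ℝ)) := by
  have hm' : (1:ℝ) ≤ m := by exact_mod_cast hm
  refine le_of_tendsto (tendsto_eulerPartial ht) ?_
  filter_upwards [eventually_ge_atTop m] with M hM
  refine (eulerPartial_le ht hm hM).trans (mul_le_mul_of_nonneg_left ?_ (eulerPartial_pos ht m).le)
  have h1 : (M:ℝ) / m * ((m + 1) / (M + 1)) ≤ 1 + 2 / m := by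
    rw [div_mul_div_comm, div_le_iff₀ (by positivity)]
    have : (1 + 2 / (m:ℝ)) * (m * (M + 1)) = (m + 2) * (M + 1) := by field_simp
    rw [this]
    have : (0:ℝ) ≤ M := by positivity
    nlinarith
  linarith [Real.add_one_le_exp (2 / (m:ℝ))]

lemma zetaNat_pos {t : ℕ} (ht : 2 ≤ t) : 0 < zetaNat t := by
  have h : Summable fun k : ℕ => 1 / ((k:ℝ) + 1) ^ t := by
    have := (summable_nat_add_iff 1).2 (Real.summable_one_div_nat_pow.2 ht)
    simpa using this
  exact h.tsum_pos (fun k => by positivity) 0 (by positivity)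

lemma sum_inv_pow_eq {t p : ℕ} (hp : 2 ≤ p) :
    ∑ i ∈ range t, (1:ℝ) / (p:ℝ) ^ i =
      (1 - ((p:ℝ)⁻¹) ^ t) * Real.exp (-Real.log (1 - 1 / (p:ℝ))) := by
  have hp' : (2:ℝ) ≤ p := by exact_mod_cast hp
  have h1 : (p:ℝ)⁻¹ < 1 := inv_lt_one_of_one_lt₀ (by linarith)
  have h2 : ∀ i, (1:ℝ) / (p:ℝ) ^ i = ((p:ℝ)⁻¹) ^ i := fun i => by rw [inv_pow, one_div]
  rw [Real.exp_neg, one_div, Real.exp_log (by linarith)]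
  simp only [h2]
  rw [geom_sum_eq h1.ne, ← div_eq_mul_inv, ← neg_div_neg_eq, neg_sub, neg_sub]

lemma psi_primorial_ratio (t m : ℕ) :
    Psi t (primorial m) / (primorial m : ℝ) =
      (eulerPartial t m)⁻¹ * Real.exp (∑ p ∈ Nat.primesLE m, -Real.log (1 - 1 / (p:ℝ))) := by
  have h : (primorial m : ℝ) ≠ 0 := by exact_mod_cast (primorial_pos m).ne'
  rw [Psi, mul_div_cancel_left₀ _ h, primeFactors_primorial, Real.exp_sum, eulerPartial,
    ← prod_inv_distrib, ← prod_mul_distrib]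
  refine prod_congr rfl fun p hp => ?_
  rw [sum_inv_pow_eq (Nat.two_le_of_mem_primesLE hp), inv_inv]

theorem psi_primorial_upper_bound (t n : ℕ) (ht : 2 ≤ t) (hn : 2263 ≤ n) :
    Psi t (primorialAt n) / (primorialAt n : ℝ) ≤
      Real.exp (Real.eulerMascheroniConstant + 2 / (nthPrime n : ℝ)) / zetaNat t *
        (Real.log (Real.log (primorialAt n)) + 1.1253 / Real.log (nthPrime n)) := by
  have hm : 20000 ≤ nthPrime n := nth_prime_ge (by omega)
  rw [primorialAt_eq (by omega), psi_primorial_ratio]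
  set m := nthPrime n
  have hθ : Chebyshev.theta m = Real.log (primorial m) := by
    rw [Chebyshev.theta_eq_log_primorial, Nat.floor_natCast]
  have hP := sum_neg_log_one_sub_le hm
  obtain ⟨-, hl⟩ := sum_neg_log_le_add_of_ge hm
  have hL := log_ge_of_twenty_thousand hm
  rw [hθ] at hP hl
  have hpos : 0 < Real.log (Real.log (primorial m)) + 1.1253 / Real.log m := by
    have : 0 < 1.1253 / Real.log m := by positivity
    linarith
  have hE := eulerPartial_pos ht m
  have hζ := zetaNat_pos ht
  have h1 : (eulerPartial t m)⁻¹ ≤ Real.exp (2 / (m:ℝ)) / zetaNat t := by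
    rw [inv_le_comm₀ hE (by positivity), inv_div, div_le_iff₀ (Real.exp_pos _)]
    exact zetaNat_le ht (by omega)
  calc _ ≤ Real.exp (2 / (m:ℝ)) / zetaNat t * (Real.exp (Real.eulerMascheroniConstant) *
        (Real.log (Real.log (primorial m)) + 1.1253 / Real.log m)) := by
        refine mul_le_mul h1 ?_ (Real.exp_pos _).le (by positivity)
        rw [← Real.exp_log hpos, ← Real.exp_add]
        exact Real.exp_le_exp.2 hP
    _ = _ := by rw [Real.exp_add]; ring
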